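/- Let Ω ⊂ ℝⁿ, n ≥ 2, be a bounded proper subdomain satisfying a β-quasihyperbolic boundary condition for some β ≤ 1, let p > 1, a ≥ 0 and b ∈ ℝ with (a+n)·(2β/(1+β)) > n + b − p. Then there is a constant C = C(n,p,β,Ω,a,b) > 0 such that for every vector field v ∈ W^{1,p}(Ω,ρ^a)ⁿ, ∫_Ω |Dv|^p ρ^a dx ≤ C { ∫_Ω |ε(v)|^p ρ^{b−p} dx + ∫_Ω |v|^p ρ^a dx }. -/

import Mathlib

open MeasureTheory Set Filter
open scoped ENNReal NNReal Topology

noncomputable section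

abbrev Evec (n : ℕ) := EuclideanSpace ℝ (Fin n)

/-- `ρ(x) = dist(x, ∂Ω)`, the distance to the boundary of `Ω`. -/
def bdist {n : ℕ} (Ω : Set (Evec n)) (x : Evec n) : ℝ := Metric.infDist x (frontier Ω)

/-- A bounded domain: open, connected and bounded. -/
def IsBoundedDomain {n : ℕ} (Ω : Set (Evec n)) : Prop :=
  IsOpen Ω ∧ IsConnected Ω ∧ Bornology.IsBounded Ω

/-- A closed cube in `ℝⁿ`. -/
def IsClosedCube {n : ℕ} (Q : Set (Evec n)) : Prop :=
  ∃ (c : Evec n) (r : ℝ), 0 < r ∧ Q = {x : Evec n | ∀ i, |x i - c i| ≤ r}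

/-- The weighted `p`-energy `∫_S |g(x)|^p ρ(x)^a dx`, where `ρ` is the distance
to the boundary of `Ω`. -/
def wIp {n : ℕ} (Ω S : Set (Evec n)) (p a : ℝ) (g : Evec n → ℝ) : ℝ≥0∞ :=
  ∫⁻ x in S, ENNReal.ofReal (|g x| ^ p * bdist Ω x ^ a)

/-- The weighted `L^p(S, ρ^a)` norm `(∫_S |g(x)|^p ρ(x)^a dx)^{1/p}`. -/
def wLp {n : ℕ} (Ω S : Set (Evec n)) (p a : ℝ) (g : Evec n → ℝ) : ℝ≥0∞ :=
  wIp Ω S p a g ^ (1 / p)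

/-- The weighted average `u_{Ω,a} = (∫_Ω ρ^a)⁻¹ ∫_Ω u ρ^a`. -/
def wAvg {n : ℕ} (Ω : Set (Evec n)) (a : ℝ) (u : Evec n → ℝ) : ℝ :=
  (∫ x in Ω, bdist Ω x ^ a)⁻¹ * ∫ x in Ω, u x * bdist Ω x ^ a

/-- `|∇u(x)|` for a scalar function `u`. -/
def gradLen {n : ℕ} (u : Evec n → ℝ) (x : Evec n) : ℝ := ‖fderiv ℝ u x‖

/-- The entry `∂v_i/∂x_j (x)` of the gradient matrix `Dv`. -/
def pder {n : ℕ} (v : Evec n → Evec n) (i j : Fin n) (x : Evec n) : ℝ :=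
  fderiv ℝ v x (EuclideanSpace.single j 1) i

/-- `|Dv(x)|`, the (Frobenius) norm of the gradient matrix of a vector field `v`. -/
def DvLen {n : ℕ} (v : Evec n → Evec n) (x : Evec n) : ℝ :=
  Real.sqrt (∑ i, ∑ j, pder v i j x ^ 2)

/-- `|ε(v)(x)|`, the norm of the symmetric part `ε_{ij}(v) = (∂v_i/∂x_j + ∂v_j/∂x_i)/2`
of the gradient matrix. -/
def epsLen {n : ℕ} (v : Evec n → Evec n) (x : Evec n) : ℝ :=
  Real.sqrt (∑ i, ∑ j, ((pder v i j x + pder v j i x) / 2) ^ 2)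

/-- `u ∈ W^{1,p}(Ω, ρ^a, ρ^b)` (scalar case). -/
def MemW1 {n : ℕ} (Ω : Set (Evec n)) (p a b : ℝ) (u : Evec n → ℝ) : Prop :=
  DifferentiableOn ℝ u Ω ∧ wIp Ω Ω p a u < ⊤ ∧ wIp Ω Ω p b (gradLen u) < ⊤

/-- `v ∈ W^{1,p}(Ω, ρ^a, ρ^b)ⁿ` (vector case). -/
def MemW1Vec {n : ℕ} (Ω : Set (Evec n)) (p a b : ℝ) (v : Evec n → Evec n) : Prop :=
  DifferentiableOn ℝ v Ω ∧ wIp Ω Ω p a (fun x => ‖v x‖) < ⊤ ∧ wIp Ω Ω p b (DvLen v) < ⊤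

/-- The weighted Poincaré inequality `(P_{p,a,b})`: there is `C > 0` such that
`∫_Ω |u - u_{Ω,a}|^p ρ^a ≤ C ∫_Ω |∇u|^p ρ^b` for all `u ∈ W^{1,p}(Ω,ρ^a,ρ^b)`. -/
def PoincareIneq {n : ℕ} (Ω : Set (Evec n)) (p a b : ℝ) : Prop :=
  ∃ C > 0, ∀ u : Evec n → ℝ, MemW1 Ω p a b u →
    wIp Ω Ω p a (fun x => u x - wAvg Ω a u) ≤ ENNReal.ofReal C * wIp Ω Ω p b (gradLen u)

/-- The quasihyperbolic length `∫ ‖γ'(t)‖ / dist(γ(t), ∂Ω) dt` of a curve `γ : [0,1] → Ω`. -/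
def qhLen {n : ℕ} (Ω : Set (Evec n)) (γ : ℝ → Evec n) : ℝ≥0∞ :=
  ∫⁻ t in Icc (0:ℝ) 1, ENNReal.ofReal (‖deriv γ t‖ / bdist Ω (γ t))

/-- `Ω` satisfies the `β`-quasihyperbolic boundary condition: for some base point `x₀` and
some constant `C₀`, the quasihyperbolic distance `k(x, x₀)` (infimum of quasihyperbolic
lengths of Lipschitz curves joining `x` to `x₀` in `Ω`) satisfies
`k(x,x₀) ≤ (1/β) log( dist(x₀,∂Ω) / dist(x,∂Ω) ) + C₀` for every `x ∈ Ω`. -/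
def QHBC {n : ℕ} (Ω : Set (Evec n)) (β : ℝ) : Prop :=
  ∃ x₀ ∈ Ω, ∃ C₀ : ℝ, ∀ x ∈ Ω, ∀ ε > (0:ℝ), ∃ γ : ℝ → Evec n, ∃ K : ℝ≥0,
    LipschitzOnWith K γ (Icc 0 1) ∧ γ 0 = x ∧ γ 1 = x₀ ∧ (∀ t ∈ Icc (0:ℝ) 1, γ t ∈ Ω) ∧
    qhLen Ω γ ≤ ENNReal.ofReal ((1/β) * Real.log (bdist Ω x₀ / bdist Ω x) + C₀ + ε)

lemma rpow_two_point_ge {p : ℝ} (hp : 2 ≤ p) (m s : ℝ) :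
    |m| ^ p + s ^ 2 * max |m| |s| ^ (p - 2) ≤ (|m + s| ^ p + |m - s| ^ p) / 2 := by
  have hr : 1 ≤ p / 2 := by linarith
  have key : ∀ x : ℝ, |x| ^ p = (x ^ 2) ^ (p / 2) := by
    intro x
    rw [← sq_abs, ← Real.rpow_natCast_mul (abs_nonneg x)]
    congr 1; push_cast; ring
  have h1 : (m ^ 2 + s ^ 2) ^ (p / 2) ≤ (|m + s| ^ p + |m - s| ^ p) / 2 := by
    rw [key (m + s), key (m - s)]
    have := (convexOn_rpow hr).2 (mem_Ici.2 (sq_nonneg (m + s))) (mem_Ici.2 (sq_nonneg (m - s)))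
      (by norm_num : (0:ℝ) ≤ 1 / 2) (by norm_num : (0:ℝ) ≤ 1 / 2) (by norm_num)
    simp only [smul_eq_mul] at this
    calc _ = (1 / 2 * (m + s) ^ 2 + 1 / 2 * (m - s) ^ 2) ^ (p / 2) := by congr 1; ring
      _ ≤ _ := this
      _ = _ := by ring
  refine le_trans ?_ h1
  rcases eq_or_ne m 0 with hm | hm
  · subst hm
    rcases eq_or_ne s 0 with hs | hs
    · subst hs
      simp [Real.zero_rpow (show p ≠ 0 by linarith), Real.zero_rpow (show p / 2 ≠ 0 by linarith)]
    · have : 0 < |s| := abs_pos.2 hs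
      have e : s ^ 2 * |s| ^ (p - 2) = |s| ^ p := by
        rw [← sq_abs, ← Real.rpow_natCast, ← Real.rpow_add this]; congr 1; push_cast; ring
      simp only [abs_zero, Real.zero_rpow (show p ≠ 0 by linarith), max_eq_right this.le, e]
      rw [key]; simp
  have hm2 : 0 < m ^ 2 := by positivity
  have hpos : 0 < m ^ 2 + s ^ 2 := by positivity
  have e1 : (m ^ 2 + s ^ 2) ^ (p / 2)
      = m ^ 2 * (m ^ 2 + s ^ 2) ^ (p / 2 - 1) + s ^ 2 * (m ^ 2 + s ^ 2) ^ (p / 2 - 1) := by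
    rw [← add_mul, mul_comm, ← Real.rpow_add_one hpos.ne']; congr 1; ring
  have e2 : |m| ^ p = m ^ 2 * (m ^ 2) ^ (p / 2 - 1) := by
    rw [key, mul_comm, ← Real.rpow_add_one hm2.ne']; congr 1; ring
  have e3 : max |m| |s| ^ (p - 2) ≤ (m ^ 2 + s ^ 2) ^ (p / 2 - 1) := by
    have : max |m| |s| ^ (p - 2) = (max |m| |s| ^ 2) ^ (p / 2 - 1) := by
      rw [← Real.rpow_natCast_mul (le_max_of_le_left (abs_nonneg m))]
      congr 1; push_cast; ring
    rw [this]
    apply Real.rpow_le_rpow (by positivity) _ (by linarith)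
    rcases max_choice |m| |s| with h | h <;> rw [h, sq_abs] <;> nlinarith [sq_nonneg m, sq_nonneg s]
  rw [e1, e2]
  refine add_le_add (mul_le_mul_of_nonneg_left ?_ hm2.le)
    (mul_le_mul_of_nonneg_left e3 (sq_nonneg s))
  exact Real.rpow_le_rpow hm2.le (by nlinarith [sq_nonneg s]) (by linarith)

/-- Second-difference bound for `|·|^γ`, `0 ≤ γ ≤ 1`, normalised at the larger endpoint. -/
lemma rpow_small_second_diff {γ : ℝ} (h0 : 0 ≤ γ) (h1 : γ ≤ 1) {b : ℝ} (hb0 : 0 ≤ b) (hb2 : b ≤ 2) :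
    |1 - b / 2| ^ γ - (1 + |1 - b| ^ γ) / 2 ≤ b ^ 2 := by
  have hA : |1 - b / 2| = 1 - b / 2 := abs_of_nonneg (by linarith)
  rw [hA]
  have hle1 : (1 - b / 2) ^ γ ≤ 1 := Real.rpow_le_one (by linarith) (by linarith) h0
  have hnn : 0 ≤ |1 - b| ^ γ := by positivity
  rcases le_or_gt 1 b with hb | hb
  · nlinarith
  have hB : |1 - b| = 1 - b := abs_of_pos (by linarith)
  rw [hB]
  have hu : (1 - b / 2) ^ γ ≤ 1 - γ * (b / 2) := by
    have := rpow_one_add_le_one_add_mul_self (s := -(b / 2)) (by linarith) h0 h1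
    calc _ = (1 + -(b / 2)) ^ γ := by congr 1
      _ ≤ _ := this
      _ = _ := by ring
  have hl : (1 - b) * (1 + (1 - γ) * b) ≤ (1 - b) ^ γ := by
    have hpos : 0 < 1 - b := by linarith
    have e : (1 - b) ^ γ = (1 - b) * (1 - b) ^ (γ - 1) := by
      rw [mul_comm, ← Real.rpow_add_one hpos.ne']; congr 1; ring
    rw [e]
    apply mul_le_mul_of_nonneg_left _ hpos.le
    have h2 := rpow_one_add_le_one_add_mul_self (s := -b) (by linarith)
      (p := 1 - γ) (by linarith) (by linarith)
    have h3 : (1 - b) ^ (γ - 1) = ((1 + -b) ^ (1 - γ))⁻¹ := by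
      rw [← Real.rpow_neg (by linarith)]; congr 1 ; ring
    rw [h3]
    have h4 : 0 < (1 + -b) ^ (1 - γ) := Real.rpow_pos_of_pos (by linarith) _
    rw [le_inv_comm₀ (by nlinarith) h4]
    refine h2.trans ?_
    have h5 : 0 < 1 + (1 - γ) * b := by nlinarith
    rw [le_inv_comm₀ (by nlinarith) h5, ← one_div, le_div_iff₀ (by nlinarith)]
    nlinarith [mul_nonneg (mul_nonneg (sub_nonneg.2 h1) hb0) (mul_nonneg (sub_nonneg.2 h1) hb0)]
  nlinarith

/-- Quantitative convexity of `|·|^q`, `1 < q ≤ 2`, normalised at the larger endpoint. -/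
lemma rpow_strong_midpoint {q : ℝ} (h1 : 1 < q) (h2 : q ≤ 2) {b : ℝ} (hb0 : 0 ≤ b) (hb2 : b ≤ 2) :
    |1 - b / 2| ^ q + q * (q - 1) / 8 * b ^ 2 ≤ (1 + |1 - b| ^ q) / 2 := by
  have hconv : ConvexOn ℝ (Icc (0:ℝ) 1) (fun t => t ^ q - q * (q - 1) / 2 * t ^ 2) := by
    have hd : ∀ x : ℝ, 0 < x → HasDerivAt (fun t : ℝ => t ^ q - q * (q - 1) / 2 * t ^ 2)
        (q * x ^ (q - 1) - q * (q - 1) * x) x := by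
      intro x hx
      have := (Real.hasDerivAt_rpow_const (p := q) (Or.inl hx.ne')).sub
        ((hasDerivAt_pow 2 x).const_mul (q * (q - 1) / 2))
      exact this.congr_deriv (by push_cast; ring)
    apply MonotoneOn.convexOn_of_deriv (convex_Icc 0 1)
    · apply ContinuousOn.sub
      · exact (Real.continuous_rpow_const (by linarith)).continuousOn
      · fun_prop
    · intro x hx
      rw [interior_Icc] at hx
      exact (hd x hx.1).differentiableAt.differentiableWithinAt
    · rw [interior_Icc]
      have : MonotoneOn (fun x : ℝ => q * x ^ (q - 1) - q * (q - 1) * x) (Ioo 0 1) := by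
        have hd2 : ∀ x : ℝ, 0 < x → HasDerivAt (fun x : ℝ => q * x ^ (q - 1) - q * (q - 1) * x)
            (q * ((q - 1) * x ^ (q - 1 - 1)) - q * (q - 1)) x := by
          intro x hx
          have := ((Real.hasDerivAt_rpow_const (p := q - 1) (Or.inl hx.ne')).const_mul q).sub
            ((hasDerivAt_id x).const_mul (q * (q - 1)))
          exact this.congr_deriv (by simp)
        apply monotoneOn_of_deriv_nonneg (convex_Ioo 0 1)
        · intro x hx; exact (hd2 x hx.1).continuousAt.continuousWithinAt
        · intro x hx; rw [interior_Ioo] at hx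
          exact (hd2 x hx.1).differentiableAt.differentiableWithinAt
        · intro x hx; rw [interior_Ioo] at hx
          rw [(hd2 x hx.1).deriv]
          have : 1 ≤ x ^ (q - 1 - 1) :=
            Real.one_le_rpow_of_pos_of_le_one_of_nonpos hx.1 hx.2.le (by linarith)
          have : 0 ≤ q * (q - 1) * (x ^ (q - 1 - 1) - 1) :=
            mul_nonneg (mul_nonneg (by linarith) (by linarith)) (by linarith)
          linarith
      intro x hx y hy hxy
      rw [(hd x hx.1).deriv, (hd y hy.1).deriv]
      exact this hx hy hxy
  have hmono : ∀ x y : ℝ, 0 ≤ x → x ≤ y → y ≤ 1 →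
      x ^ q - q * (q - 1) / 2 * x ^ 2 ≤ y ^ q - q * (q - 1) / 2 * y ^ 2 := by
    intro x y hx hxy hy
    rcases eq_or_lt_of_le hx with rfl | hx'
    · rw [Real.zero_rpow (by linarith)]
      have : y ^ (2:ℝ) ≤ y ^ q := by
        rcases eq_or_lt_of_le hxy with h | h
        · rw [← h, Real.zero_rpow (by linarith), Real.zero_rpow (by linarith)]
        · exact Real.rpow_le_rpow_of_exponent_ge h hy h2
      rw [Real.rpow_two] at this
      have : q * (q - 1) / 2 ≤ 1 := by nlinarith
      nlinarith [sq_nonneg y]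
    · have hd : ∀ z : ℝ, 0 < z → HasDerivAt (fun t : ℝ => t ^ q - q * (q - 1) / 2 * t ^ 2)
          (q * z ^ (q - 1) - q * (q - 1) * z) z := by
        intro z hz
        have := (Real.hasDerivAt_rpow_const (p := q) (Or.inl hz.ne')).sub
          ((hasDerivAt_pow 2 z).const_mul (q * (q - 1) / 2))
        exact this.congr_deriv (by push_cast; ring)
      have hm : MonotoneOn (fun t : ℝ => t ^ q - q * (q - 1) / 2 * t ^ 2) (Icc x 1) := by
        apply monotoneOn_of_deriv_nonneg (convex_Icc x 1)
        · intro z hz; exact (hd z (hx'.trans_le hz.1)).continuousAt.continuousWithinAt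
        · intro z hz; rw [interior_Icc] at hz
          exact (hd z (hx'.trans hz.1)).differentiableAt.differentiableWithinAt
        · intro z hz; rw [interior_Icc] at hz
          have hz0 := hx'.trans hz.1
          rw [(hd z hz0).deriv]
          have : z ≤ z ^ (q - 1) := by
            calc z = z ^ (1:ℝ) := (Real.rpow_one z).symm
              _ ≤ _ := Real.rpow_le_rpow_of_exponent_ge hz0 hz.2.le (by linarith)
          have : 0 ≤ q * (z ^ (q - 1) - (q - 1) * z) :=
            mul_nonneg (by linarith) (by nlinarith)
          linarith
      exact hm ⟨le_rfl, hxy.trans hy⟩ ⟨hxy, hy⟩ hxy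
  have ha : |1 - b| ≤ 1 := abs_le.2 ⟨by linarith, by linarith⟩
  have hc := hconv.2 (by simp : (1:ℝ) ∈ Icc (0:ℝ) 1) (⟨abs_nonneg _, ha⟩ : |1 - b| ∈ Icc (0:ℝ) 1)
      (by norm_num : (0:ℝ) ≤ 1 / 2) (by norm_num : (0:ℝ) ≤ 1 / 2) (by norm_num)
  simp only [smul_eq_mul, Real.one_rpow] at hc
  have hm := hmono |1 - b / 2| (1 / 2 * 1 + 1 / 2 * |1 - b|) (abs_nonneg _)
    (by rw [abs_of_nonneg (by linarith : (0:ℝ) ≤ 1 - b / 2)]; linarith [le_abs_self (1 - b)])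
    (by linarith)
  have := hm.trans hc
  rw [sq_abs, sq_abs] at this
  nlinarith

lemma bellman_normalized {p q : ℝ} (hp : 2 ≤ p) (hq1 : 1 < q) (hq2 : q ≤ 2)
    (hpq : (q - 1) * (p - 2) = 2 - q) (m s : ℝ) {b : ℝ} (hb0 : 0 ≤ b) (hb2 : b ≤ 2) :
    max (|m| ^ p) (m ^ 2 * |1 - b / 2| ^ (2 - q)) + |s| * b ≤
      (max (|m + s| ^ p) ((m + s) ^ 2) +
        max (|m - s| ^ p) ((m - s) ^ 2 * |1 - b| ^ (2 - q))) / 2 + 3 * b ^ 2 := by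
  have hγ0 : 0 ≤ 2 - q := by linarith
  have hγ1 : 2 - q ≤ 1 := by linarith
  set t := |1 - b / 2| with ht
  have ht0 : 0 ≤ t := abs_nonneg _
  have ht' : t = 1 - b / 2 := abs_of_nonneg (by linarith)
  have hsplit : ∀ x : ℝ, |x| ^ p = x ^ 2 * |x| ^ (p - 2) := by
    intro x
    rcases eq_or_ne x 0 with rfl | hx
    · simp [Real.zero_rpow (show p ≠ 0 by linarith)]
    · rw [← sq_abs, ← Real.rpow_natCast, ← Real.rpow_add (abs_pos.2 hx)]; congr 1; push_cast; ring
  have htγ : t ^ (2 - q) = (t ^ (q - 1)) ^ (p - 2) := by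
    rw [← hpq, Real.rpow_mul ht0]
  rcases le_or_gt |m| (t ^ (q - 1)) with hm | hm
  · have h1 : |m| ^ p ≤ m ^ 2 * t ^ (2 - q) := by
      rw [hsplit, htγ]
      exact mul_le_mul_of_nonneg_left (Real.rpow_le_rpow (abs_nonneg _) hm (by linarith))
        (sq_nonneg _)
    rw [max_eq_right h1]
    have hm1 : |m| ≤ 1 := hm.trans (Real.rpow_le_one ht0 (by linarith) (by linarith))
    have h3 := rpow_small_second_diff hγ0 hγ1 hb0 hb2
    rw [← ht] at h3
    set ω := |1 - b| ^ (2 - q) with hω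
    have hω0 : 0 ≤ ω := by positivity
    have ha1 : |1 - b| ≤ 1 := abs_le.2 ⟨by linarith, by linarith⟩
    have hω1 : ω ≤ 1 := Real.rpow_le_one (abs_nonneg _) ha1 hγ0
    have h4 : 1 - ω ≤ b := by
      have : |1 - b| ≤ ω := by
        rcases eq_or_lt_of_le (abs_nonneg (1 - b)) with h | h
        · rw [← h]; exact hω0
        · calc |1 - b| = |1 - b| ^ (1:ℝ) := (Real.rpow_one _).symm
            _ ≤ _ := Real.rpow_le_rpow_of_exponent_ge h ha1 hγ1
      linarith [le_abs_self (1 - b)]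
    have hmm : m ^ 2 ≤ 1 := by rw [← sq_abs]; nlinarith [abs_nonneg m]
    have e1 : -(|s| * b) ≤ m * s * (1 - ω) := by
      have : |m * s * (1 - ω)| ≤ 1 * |s| * b := by
        rw [abs_mul, abs_mul, abs_of_nonneg (by linarith : 0 ≤ 1 - ω)]
        gcongr
      have := neg_abs_le (m * s * (1 - ω))
      linarith
    have e2 : m ^ 2 * t ^ (2 - q) ≤ m ^ 2 * ((1 + ω) / 2) + b ^ 2 := by
      nlinarith [sq_nonneg m, sq_nonneg b]
    have e3 := le_max_right (|m + s| ^ p) ((m + s) ^ 2)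
    have e4 := le_max_right (|m - s| ^ p) ((m - s) ^ 2 * ω)
    have e5 : s ^ 2 ≤ s ^ 2 * (1 + ω) := by nlinarith [sq_nonneg s]
    have e6 : 2 * (|s| * b) ≤ s ^ 2 / 2 + 2 * b ^ 2 := by
      nlinarith [sq_nonneg (|s| - 2 * b), sq_abs s]
    nlinarith
  · have h1 : m ^ 2 * t ^ (2 - q) ≤ |m| ^ p := by
      rw [hsplit, htγ]
      exact mul_le_mul_of_nonneg_left (Real.rpow_le_rpow (by positivity) hm.le (by linarith))
        (sq_nonneg _)
    rw [max_eq_left h1]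
    have h2 := rpow_two_point_ge hp m s
    have e3 := le_max_left (|m + s| ^ p) ((m + s) ^ 2)
    have e4 := le_max_left (|m - s| ^ p) ((m - s) ^ 2 * |1 - b| ^ (2 - q))
    suffices |s| * b ≤ s ^ 2 * max |m| |s| ^ (p - 2) + 3 * b ^ 2 by linarith
    rcases le_or_gt b 1 with hb | hb
    · have : 1 / 2 ≤ max |m| |s| ^ (p - 2) := by
        calc (1:ℝ) / 2 ≤ t := by linarith
          _ = t ^ (1:ℝ) := (Real.rpow_one _).symm
          _ ≤ t ^ (2 - q) :=
            Real.rpow_le_rpow_of_exponent_ge (by linarith) (by linarith) hγ1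
          _ = (t ^ (q - 1)) ^ (p - 2) := htγ
          _ ≤ _ := Real.rpow_le_rpow (by positivity) (hm.le.trans (le_max_left _ _)) (by linarith)
      nlinarith [sq_nonneg (|s| - b), sq_abs s, sq_nonneg s]
    · rcases le_or_gt |s| 2 with hs | hs
      · have : 0 ≤ s ^ 2 * max |m| |s| ^ (p - 2) := by positivity
        nlinarith
      · have : 1 ≤ max |m| |s| ^ (p - 2) :=
          Real.one_le_rpow ((by linarith : 1 ≤ |s|).trans (le_max_right _ _)) (by linarith)
        nlinarith [sq_abs s, sq_nonneg s, sq_nonneg b]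

/-- A Bellman function for the duality pairing of `L^p` and `L^q`. -/
def bellmanFun (p q u w : ℝ) : ℝ :=
  24 / (q * (q - 1)) * |w| ^ q + max (|u| ^ p) (u ^ 2 * |w| ^ (2 - q))

lemma bellmanFun_scale {p q : ℝ} (hpq : (q - 1) * p = q) {l : ℝ}
    (hl : l ≠ 0) (u w : ℝ) :
    bellmanFun p q (|l| ^ (q - 1) * u) (l * w) = |l| ^ q * bellmanFun p q u w := by
  have hL : 0 < |l| := abs_pos.2 hl
  unfold bellmanFun
  rw [mul_add, mul_max_of_nonneg _ _ (by positivity)]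
  congr 1
  · rw [abs_mul, Real.mul_rpow hL.le (abs_nonneg _)]; ring
  · congr 1
    · rw [abs_mul, abs_of_nonneg (by positivity : 0 ≤ |l| ^ (q - 1)),
        Real.mul_rpow (by positivity) (abs_nonneg _), ← Real.rpow_mul hL.le, hpq]
    · rw [abs_mul, Real.mul_rpow hL.le (abs_nonneg _), mul_pow, ← Real.rpow_mul_natCast hL.le]
      have : |l| ^ q = |l| ^ ((q - 1) * (2:ℕ)) * |l| ^ (2 - q) := by
        rw [← Real.rpow_add hL]; congr 1; push_cast; ring
      rw [this]; ring

lemma bellmanFun_midpoint_aux {p q : ℝ} (hp : 2 ≤ p) (hq1 : 1 < q) (hq2 : q ≤ 2)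
    (hpq : (q - 1) * p = q) (u u' w w' : ℝ) (hw : |w'| ≤ |w|) :
    bellmanFun p q ((u + u') / 2) ((w + w') / 2) + |u - u'| * |w - w'| / 2 ≤
      (bellmanFun p q u w + bellmanFun p q u' w') / 2 := by
  have hpq' : (q - 1) * (p - 2) = 2 - q := by linarith
  rcases eq_or_ne w 0 with rfl | hw0
  · have hw' : w' = 0 := by simpa using hw
    subst hw'
    have h := rpow_two_point_ge hp ((u + u') / 2) ((u - u') / 2)
    have h1 : (u + u') / 2 + (u - u') / 2 = u := by ring
    have h2 : (u + u') / 2 - (u - u') / 2 = u' := by ring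
    rw [h1, h2] at h
    have hnn : 0 ≤ ((u - u') / 2) ^ 2 * max |(u + u') / 2| |(u - u') / 2| ^ (p - 2) := by
      positivity
    rcases eq_or_lt_of_le hq2 with hq | hq
    · have hp2 : p = 2 := by subst hq; linarith
      subst hq; subst hp2
      simp [bellmanFun]
      nlinarith [sq_nonneg (u - u')]
    · have hq' : 2 - q ≠ 0 := by linarith
      have hm : ∀ x : ℝ, bellmanFun p q x 0 = |x| ^ p := by
        intro x
        simp only [bellmanFun, abs_zero, Real.zero_rpow hq', Real.zero_rpow
            (show q ≠ 0 by linarith),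
          mul_zero, zero_add]
        exact max_eq_left (by positivity)
      have e0 : ((0:ℝ) + 0) / 2 = 0 := by norm_num
      rw [e0, hm, hm, hm]
      simp only [sub_self, abs_zero, mul_zero, zero_div, add_zero]
      linarith
  have hL : 0 < |w| := abs_pos.2 hw0
  set A := |w| ^ (q - 1) with hA
  have hA0 : 0 < A := by positivity
  set b := 1 - w' / w with hb
  have hr : |w' / w| ≤ 1 := by rw [abs_div]; exact div_le_one_of_le₀ hw (abs_nonneg _)
  have hb0 : 0 ≤ b := by linarith [(abs_le.1 hr).2]
  have hb2 : b ≤ 2 := by linarith [(abs_le.1 hr).1]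
  have hW' : w' = w * (1 - b) := by rw [hb]; field_simp; ring
  have hWm : (w + w') / 2 = w * (1 - b / 2) := by rw [hW']; ring
  have hU : u = A * (u / A) := by field_simp
  have hU' : u' = A * (u' / A) := by field_simp
  set y := u / A
  set y' := u' / A
  have hUm : (u + u') / 2 = A * ((y + y') / 2) := by rw [hU, hU']; ring
  have e1 : bellmanFun p q u w = |w| ^ q * bellmanFun p q y 1 := by
    rw [← bellmanFun_scale hpq hw0, mul_one, ← hA, ← hU]
  have e2 : bellmanFun p q u' w' = |w| ^ q * bellmanFun p q y' (1 - b) := by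
    rw [← bellmanFun_scale hpq hw0, ← hA, ← hU', ← hW']
  have e3 : bellmanFun p q ((u + u') / 2) ((w + w') / 2)
      = |w| ^ q * bellmanFun p q ((y + y') / 2) (1 - b / 2) := by
    rw [← bellmanFun_scale hpq hw0, ← hA, ← hUm, ← hWm]
  have e4 : |u - u'| * |w - w'| = |w| ^ q * (|y - y'| * b) := by
    have h1 : u - u' = A * (y - y') := by rw [hU, hU']; ring
    have h2 : w - w' = w * b := by rw [hW']; ring
    rw [h1, h2, abs_mul, abs_mul, abs_of_pos hA0, abs_of_nonneg hb0]
    have : |w| ^ q = A * |w| := by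
      rw [hA, ← Real.rpow_add_one hL.ne']; congr 1; ring
    rw [this]; ring
  rw [e1, e2, e3, e4]
  have hB := bellman_normalized hp hq1 hq2 hpq' ((y + y') / 2) ((y - y') / 2) hb0 hb2
  have hS := rpow_strong_midpoint hq1 hq2 hb0 hb2
  have h1 : (y + y') / 2 + (y - y') / 2 = y := by ring
  have h2 : (y + y') / 2 - (y - y') / 2 = y' := by ring
  rw [h1, h2] at hB
  have hK : 0 < q * (q - 1) := mul_pos (by linarith) (by linarith)
  have hS' : 24 / (q * (q - 1)) * |1 - b / 2| ^ q + 3 * b ^ 2 ≤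
      24 / (q * (q - 1)) * ((1 + |1 - b| ^ q) / 2) := by
    have := mul_le_mul_of_nonneg_left hS (by positivity : 0 ≤ 24 / (q * (q - 1)))
    have e : 24 / (q * (q - 1)) * (q * (q - 1) / 8 * b ^ 2) = 3 * b ^ 2 := by
      have : q - 1 ≠ 0 := by linarith
      field_simp; ring
    linarith
  have hs : |(y - y') / 2| = |y - y'| / 2 := by rw [abs_div]; norm_num
  rw [hs] at hB
  have fin : bellmanFun p q ((y + y') / 2) (1 - b / 2) + |y - y'| * b / 2 ≤
      (bellmanFun p q y 1 + bellmanFun p q y' (1 - b)) / 2 := by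
    unfold bellmanFun
    rw [abs_one, Real.one_rpow, Real.one_rpow, mul_one, mul_one]
    linarith
  have := mul_le_mul_of_nonneg_left fin (by positivity : 0 ≤ |w| ^ q)
  linarith

lemma bellmanFun_midpoint {p q : ℝ} (hp : 2 ≤ p) (hq1 : 1 < q) (hq2 : q ≤ 2)
    (hpq : (q - 1) * p = q) (u u' w w' : ℝ) :
    bellmanFun p q ((u + u') / 2) ((w + w') / 2) + |u - u'| * |w - w'| / 2 ≤
      (bellmanFun p q u w + bellmanFun p q u' w') / 2 := by
  rcases le_total |w'| |w| with h | h
  · exact bellmanFun_midpoint_aux hp hq1 hq2 hpq u u' w w' h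
  · have := bellmanFun_midpoint_aux hp hq1 hq2 hpq u' u w' w h
    rw [add_comm u', add_comm w', abs_sub_comm u', abs_sub_comm w'] at this
    linarith

lemma bellmanFun_le {p q : ℝ} (hp : 2 ≤ p) (hq1 : 1 < q) (hq2 : q ≤ 2)
    (hpq : (q - 1) * p = q) (u w : ℝ) :
    0 ≤ bellmanFun p q u w ∧
      bellmanFun p q u w ≤ (24 / (q * (q - 1)) + 1) * (|u| ^ p + |w| ^ q) := by
  have hK : 0 < 24 / (q * (q - 1)) := by
    have : 0 < q * (q - 1) := mul_pos (by linarith) (by linarith)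
    positivity
  have h1 : 0 ≤ |u| ^ p := by positivity
  have h2 : 0 ≤ |w| ^ q := by positivity
  have h3 : max (|u| ^ p) (u ^ 2 * |w| ^ (2 - q)) ≤ |u| ^ p + |w| ^ q := by
    refine max_le (by linarith) ?_
    rcases eq_or_ne w 0 with rfl | hw
    · rcases eq_or_lt_of_le hq2 with hq | hq
      · have hp2 : p = 2 := by subst hq; linarith
        subst hq; subst hp2; simp
      · rw [abs_zero, Real.zero_rpow (show 2 - q ≠ 0 by linarith), mul_zero]
        rw [abs_zero] at h2
        linarith
    have hW : 0 < |w| := abs_pos.2 hw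
    rcases le_total |u| (|w| ^ (q - 1)) with h | h
    · calc u ^ 2 * |w| ^ (2 - q) ≤ (|w| ^ (q - 1)) ^ 2 * |w| ^ (2 - q) := by
            rw [← sq_abs u]; gcongr
        _ = |w| ^ q := by
            rw [← Real.rpow_mul_natCast hW.le, ← Real.rpow_add hW]; congr 1; push_cast; ring
        _ ≤ _ := by linarith
    · have hU : 0 < |u| := lt_of_lt_of_le (by positivity) h
      have e : |w| ^ (2 - q) = (|w| ^ (q - 1)) ^ (p - 2) := by
        rw [← Real.rpow_mul hW.le]; congr 1; linarith
      calc u ^ 2 * |w| ^ (2 - q) ≤ u ^ 2 * |u| ^ (p - 2) := by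
            rw [e]; gcongr
        _ = |u| ^ p := by
            rw [← sq_abs, ← Real.rpow_natCast, ← Real.rpow_add hU]; congr 1; push_cast; ring
        _ ≤ _ := by linarith
  constructor
  · unfold bellmanFun
    have : |u| ^ p ≤ max (|u| ^ p) (u ^ 2 * |w| ^ (2 - q)) := le_max_left _ _
    positivity
  · unfold bellmanFun
    nlinarith

lemma continuous_bellmanFun {p q : ℝ} (hp : 2 ≤ p) (hq1 : 1 < q) (hq2 : q ≤ 2) :
    Continuous fun z : ℝ × ℝ => bellmanFun p q z.1 z.2 := by
  unfold bellmanFun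
  have h1 := Real.continuous_rpow_const (q := p) (by linarith)
  have h2 := Real.continuous_rpow_const (q := q) (by linarith)
  have h3 := Real.continuous_rpow_const (q := 2 - q) (by linarith)
  fun_prop

theorem exists_bellman {p q : ℝ} (hpq : p.HolderConjugate q) :
    ∃ Q : ℝ → ℝ → ℝ, Continuous (fun z : ℝ × ℝ => Q z.1 z.2) ∧ ∃ C : ℝ, 0 < C ∧
      (∀ u w, 0 ≤ Q u w ∧ Q u w ≤ C * (|u| ^ p + |w| ^ q)) ∧
      ∀ u u' w w', Q ((u + u') / 2) ((w + w') / 2) + |u - u'| * |w - w'| / 2 ≤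
        (Q u w + Q u' w') / 2 := by
  wlog hp : 2 ≤ p generalizing p q
  · have h2 : 2 ≤ q := by
      have h := hpq.sub_one_mul_conj
      have := hpq.lt
      have hq := hpq.symm.lt
      nlinarith
    obtain ⟨Q, hQc, C, hC, hQ, hQm⟩ := this hpq.symm h2
    refine ⟨fun u w => Q w u, hQc.comp continuous_swap, C, hC, fun u w => ?_, fun u u' w w' => ?_⟩
    · have := hQ w u
      rwa [add_comm] at this
    · have := hQm w w' u u'
      rwa [mul_comm |w - w'|] at this
  have h1 := hpq.symm.lt
  have h := hpq.symm.sub_one_mul_conj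
  have h2 : q ≤ 2 := by nlinarith
  have hK : 0 < q * (q - 1) := mul_pos (by linarith) (by linarith)
  exact ⟨bellmanFun p q, continuous_bellmanFun hp h1 h2, _, by positivity,
    bellmanFun_le hp h1 h2 h, bellmanFun_midpoint hp h1 h2 h⟩

/-- Continuous functions with compact support. -/
def IsCc {n : ℕ} (f : Evec n → ℝ) : Prop := Continuous f ∧ HasCompactSupport f

namespace IsCc

variable {n : ℕ} {f g : Evec n → ℝ}

lemma integrable (hf : IsCc f) : Integrable f := hf.1.integrable_of_hasCompactSupport hf.2

lemma comp₂ (hf : IsCc f) (hg : IsCc g) {Q : ℝ → ℝ → ℝ}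
    (hQ : Continuous fun z : ℝ × ℝ => Q z.1 z.2) (h0 : Q 0 0 = 0) :
    IsCc fun x => Q (f x) (g x) :=
  ⟨hQ.comp (hf.1.prodMk hg.1), hf.2.comp₂_left hg.2 h0⟩

lemma comp (hf : IsCc f) {Q : ℝ → ℝ} (hQ : Continuous Q) (h0 : Q 0 = 0) :
    IsCc fun x => Q (f x) :=
  ⟨hQ.comp hf.1, hf.2.comp_left h0⟩

lemma zero : IsCc (0 : Evec n → ℝ) := ⟨continuous_zero, HasCompactSupport.zero⟩

lemma add (hf : IsCc f) (hg : IsCc g) : IsCc (f + g) := ⟨hf.1.add hg.1, hf.2.add hg.2⟩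

lemma smul (hf : IsCc f) (c : ℝ) : IsCc (c • f) :=
  hf.comp (Q := fun t => c * t) (by fun_prop) (by simp)

lemma mul (hf : IsCc f) (hg : IsCc g) : IsCc fun x => f x * g x :=
  hf.comp₂ hg (Q := fun a b => a * b) (by fun_prop) (by simp)

lemma abs_mul_abs (hf : IsCc f) (hg : IsCc g) : IsCc fun x => |f x| * |g x| :=
  hf.comp₂ hg (Q := fun a b => |a| * |b|) (by fun_prop) (by simp)

lemma abs_rpow (hf : IsCc f) {p : ℝ} (hp : 0 < p) : IsCc fun x => |f x| ^ p :=
  hf.comp (Q := fun a => |a| ^ p)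
    ((Real.continuous_rpow_const hp.le).comp continuous_abs) (by simp [Real.zero_rpow hp.ne'])

lemma shift (hf : IsCc f) (y : Evec n) : IsCc fun x => f (x + y) :=
  ⟨hf.1.comp (by fun_prop), hf.2.comp_homeomorph (Homeomorph.addRight y)⟩

end IsCc

/-- The group algebra of translations of `ℝⁿ`. -/
abbrev ShiftAlg (n : ℕ) := AddMonoidAlgebra ℝ (Evec n)

/-- Translation operators acting on functions. -/
def shiftHom (n : ℕ) : Multiplicative (Evec n) →* Module.End ℝ (Evec n → ℝ) where
  toFun y :=
    { toFun := fun f x => f (x + y.toAdd)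
      map_add' := fun _ _ => rfl
      map_smul' := fun _ _ => rfl }
  map_one' := by ext f x; simp
  map_mul' y z := by
    ext f x
    simp only [toAdd_mul, LinearMap.coe_mk, AddHom.coe_mk, Module.End.mul_apply]
    congr 1; abel

/-- The action of the group algebra on functions by finite combinations of translations. -/
def act {n : ℕ} : ShiftAlg n →ₐ[ℝ] Module.End ℝ (Evec n → ℝ) :=
  AddMonoidAlgebra.lift ℝ _ _ (shiftHom n)

/-- The translation by `y` as an element of the group algebra. -/
def tr {n : ℕ} (y : Evec n) : ShiftAlg n := AddMonoidAlgebra.single y 1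

/-- The symmetric average `(τ_y + τ_{-y}) / 2`. -/
def avg {n : ℕ} (y : Evec n) : ShiftAlg n := (1 / 2 : ℝ) • (tr y + tr (-y))

/-- The centred difference `τ_y - τ_{-y}`. -/
def dif {n : ℕ} (y : Evec n) : ShiftAlg n := tr y - tr (-y)

section basic

variable {n : ℕ}

lemma act_single (y : Evec n) (c : ℝ) (f : Evec n → ℝ) (x : Evec n) :
    act (AddMonoidAlgebra.single y c) f x = c * f (x + y) := by
  rw [act, AddMonoidAlgebra.lift_single]; rfl

lemma act_tr (y : Evec n) (f : Evec n → ℝ) (x : Evec n) : act (tr y) f x = f (x + y) := by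
  rw [tr, act_single, one_mul]

lemma act_avg (y : Evec n) (f : Evec n → ℝ) (x : Evec n) :
    act (avg y) f x = (f (x + y) + f (x - y)) / 2 := by
  simp only [avg, map_smul, map_add, LinearMap.smul_apply, LinearMap.add_apply, Pi.smul_apply,
    Pi.add_apply, act_tr, smul_eq_mul, sub_eq_add_neg]
  ring

lemma act_dif (y : Evec n) (f : Evec n → ℝ) (x : Evec n) :
    act (dif y) f x = f (x + y) - f (x - y) := by
  rw [dif, map_sub, LinearMap.sub_apply, Pi.sub_apply, act_tr, act_tr, ← sub_eq_add_neg]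

lemma act_mul (r s : ShiftAlg n) (f : Evec n → ℝ) : act (r * s) f = act r (act s f) := by
  rw [map_mul]; rfl

lemma act_comm (r s : ShiftAlg n) (f : Evec n → ℝ) : act r (act s f) = act s (act r f) := by
  rw [← act_mul, ← act_mul, mul_comm]

lemma act_add (r s : ShiftAlg n) (f : Evec n → ℝ) : act (r + s) f = act r f + act s f := by
  rw [map_add]; rfl

lemma act_sub (r s : ShiftAlg n) (f : Evec n → ℝ) : act (r - s) f = act r f - act s f := by
  rw [map_sub]; rfl

lemma act_one (f : Evec n → ℝ) : act 1 f = f := by rw [map_one]; rfl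

lemma act_zero (f : Evec n → ℝ) : act 0 f = 0 := by rw [map_zero]; rfl

lemma IsCc.act {f : Evec n → ℝ} (hf : IsCc f) (r : ShiftAlg n) : IsCc (act r f) := by
  induction r using AddMonoidAlgebra.induction_linear with
  | zero => rw [act_zero]; exact IsCc.zero
  | add x y hx hy => rw [act_add]; exact hx.add hy
  | single y c =>
    have : _root_.act (AddMonoidAlgebra.single y c) f = c • fun x => f (x + y) := by
      ext x; rw [act_single]; rfl
    rw [this]; exact (hf.shift y).smul c

lemma tr_mul_tr (y z : Evec n) : tr y * tr z = tr (y + z) := by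
  rw [tr, tr, tr, AddMonoidAlgebra.single_mul_single, one_mul]

lemma tr_mul_tr_neg (y : Evec n) : tr y * tr (-y) = 1 := by
  rw [tr_mul_tr, add_neg_cancel]; rfl

/-- `L^p` boundedness of the group algebra. -/
lemma exists_integral_act_le {p : ℝ} (hp : 1 ≤ p) (r : ShiftAlg n) :
    ∃ C : ℝ, 0 ≤ C ∧ ∀ f : Evec n → ℝ, IsCc f →
      ∫ x, |act r f x| ^ p ≤ C * ∫ x, |f x| ^ p := by
  have hp0 : 0 < p := by linarith
  induction r using AddMonoidAlgebra.induction_linear with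
  | zero =>
    refine ⟨0, le_rfl, fun f _ => ?_⟩
    simp [Real.zero_rpow hp0.ne']
  | add r s hr hs =>
    obtain ⟨C, hC0, hC⟩ := hr
    obtain ⟨D, hD0, hD⟩ := hs
    refine ⟨2 ^ p * (C + D), by positivity, fun f hf => ?_⟩
    have hi1 := ((hf.act r).abs_rpow hp0).integrable
    have hi2 := ((hf.act s).abs_rpow hp0).integrable
    calc ∫ x, |act (r + s) f x| ^ p
        ≤ ∫ x, 2 ^ p * (|act r f x| ^ p + |act s f x| ^ p) := by
          refine integral_mono ((hf.act _).abs_rpow hp0).integrable ((hi1.add hi2).const_mul _) ?_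
          intro x
          simp only [act_add, Pi.add_apply]
          set a := act r f x
          set b := act s f x
          have h1 : |a + b| ≤ 2 * max |a| |b| := by
            have := abs_add_le a b
            linarith [le_max_left |a| |b|, le_max_right |a| |b|]
          calc |a + b| ^ p ≤ (2 * max |a| |b|) ^ p :=
                Real.rpow_le_rpow (abs_nonneg _) h1 hp0.le
            _ = 2 ^ p * max |a| |b| ^ p := Real.mul_rpow (by norm_num) (by positivity)
            _ ≤ 2 ^ p * (|a| ^ p + |b| ^ p) := by
                gcongr
                rcases max_choice |a| |b| with h | h <;> rw [h]
                · linarith [Real.rpow_nonneg (abs_nonneg b) p]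
                · linarith [Real.rpow_nonneg (abs_nonneg a) p]
      _ = 2 ^ p * (∫ x, |act r f x| ^ p) + 2 ^ p * (∫ x, |act s f x| ^ p) := by
          rw [integral_const_mul, integral_add hi1 hi2, mul_add]
      _ ≤ 2 ^ p * (C * ∫ x, |f x| ^ p) + 2 ^ p * (D * ∫ x, |f x| ^ p) := by
          gcongr
          · exact hC f hf
          · exact hD f hf
      _ = _ := by ring
  | single y c =>
    refine ⟨|c| ^ p, by positivity, fun f hf => ?_⟩
    simp only [act_single, abs_mul]
    simp_rw [Real.mul_rpow (abs_nonneg _) (abs_nonneg _)]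
    rw [integral_const_mul, integral_add_right_eq_self (fun x => |f x| ^ p) y]

lemma integral_act_avg_mul {f g : Evec n → ℝ} (hf : IsCc f) (hg : IsCc g) (y : Evec n) :
    ∫ x, act (avg y) f x * g x = ∫ x, f x * act (avg y) g x := by
  have h1 : ∫ x, f (x + y) * g x = ∫ x, f x * g (x - y) := by
    rw [← integral_add_right_eq_self (fun x => f x * g (x - y)) y]; simp
  have h2 : ∫ x, f (x - y) * g x = ∫ x, f x * g (x + y) := by
    rw [← integral_add_right_eq_self (fun x => f (x - y) * g x) y]; simp
  have i1 := ((hf.shift y).mul hg).integrable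
  have i2 := ((hf.shift (-y)).mul hg).integrable
  have i3 := (hf.mul (hg.shift y)).integrable
  have i4 := (hf.mul (hg.shift (-y))).integrable
  simp only [← sub_eq_add_neg] at i2 i4
  calc _ = ∫ x, (f (x + y) * g x + f (x - y) * g x) * (1 / 2) := by
        congr 1; ext x; rw [act_avg]; ring
    _ = ∫ x, (f x * g (x + y) + f x * g (x - y)) * (1 / 2) := by
        rw [integral_mul_const, integral_mul_const, integral_add i1 i2, integral_add i3 i4, h1, h2]
        ring
    _ = _ := by congr 1; ext x; rw [act_avg]; ring

lemma integral_act_dif_mul {f g : Evec n → ℝ} (hf : IsCc f) (hg : IsCc g) (y : Evec n) :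
    ∫ x, act (dif y) f x * g x = -∫ x, f x * act (dif y) g x := by
  have h1 : ∫ x, f (x + y) * g x = ∫ x, f x * g (x - y) := by
    rw [← integral_add_right_eq_self (fun x => f x * g (x - y)) y]; simp
  have h2 : ∫ x, f (x - y) * g x = ∫ x, f x * g (x + y) := by
    rw [← integral_add_right_eq_self (fun x => f (x - y) * g x) y]; simp
  have i1 := ((hf.shift y).mul hg).integrable
  have i2 := ((hf.shift (-y)).mul hg).integrable
  have i3 := (hf.mul (hg.shift y)).integrable
  have i4 := (hf.mul (hg.shift (-y))).integrable
  simp only [← sub_eq_add_neg] at i2 i4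
  calc _ = ∫ x, (f (x + y) * g x - f (x - y) * g x) := by
        congr 1; ext x; rw [act_dif]; ring
    _ = -∫ x, (f x * g (x + y) - f x * g (x - y)) := by
        rw [integral_sub i1 i2, integral_sub i3 i4, h1, h2]
        ring
    _ = _ := by congr 2; ext x; rw [act_dif]; ring

/-- Formally self-adjoint elements of the group algebra. -/
def IsSelfAdj (r : ShiftAlg n) : Prop :=
  ∀ f g : Evec n → ℝ, IsCc f → IsCc g → ∫ x, act r f x * g x = ∫ x, f x * act r g x

lemma isSelfAdj_one : IsSelfAdj (1 : ShiftAlg n) := fun f g _ _ => by rw [act_one, act_one]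

lemma IsSelfAdj.mul {r s : ShiftAlg n} (hr : IsSelfAdj r) (hs : IsSelfAdj s) :
    IsSelfAdj (r * s) := fun f g hf hg => by
  rw [act_mul, hr _ _ (hf.act s) hg, hs _ _ hf (hg.act r), ← act_mul, mul_comm]

/-- Square-contractive elements of the group algebra. -/
def IsL2Contr (r : ShiftAlg n) : Prop :=
  ∀ f : Evec n → ℝ, IsCc f → ∫ x, act r f x ^ 2 ≤ ∫ x, f x ^ 2

lemma IsCc.sq {f : Evec n → ℝ} (hf : IsCc f) : IsCc fun x => f x ^ 2 :=
  hf.comp (Q := fun t => t ^ 2) (by fun_prop) (by simp)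

lemma isL2Contr_avg (y : Evec n) : IsL2Contr (avg y) := fun f hf => by
  have i1 := (hf.sq.shift y).integrable
  have i2 := (hf.sq.shift (-y)).integrable
  calc ∫ x, act (avg y) f x ^ 2 ≤ ∫ x, (f (x + y) ^ 2 + f (x + -y) ^ 2) * (1 / 2) := by
        refine integral_mono (hf.act _).sq.integrable ((i1.add i2).mul_const _) fun x => ?_
        simp only [act_avg, sub_eq_add_neg]
        nlinarith [sq_nonneg (f (x + y) - f (x + -y))]
    _ = ∫ x, f x ^ 2 := by
        rw [integral_mul_const, integral_add i1 i2,
          integral_add_right_eq_self (fun x => f x ^ 2) y,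
          integral_add_right_eq_self (fun x => f x ^ 2) (-y)]
        ring

lemma IsL2Contr.mul {r s : ShiftAlg n} (hr : IsL2Contr r) (hs : IsL2Contr s) :
    IsL2Contr (r * s) := fun f hf => by
  rw [act_mul]; exact (hr _ (hf.act s)).trans (hs _ hf)

lemma isL2Contr_one : IsL2Contr (1 : ShiftAlg n) := fun f _ => by rw [act_one]

lemma IsL2Contr.pow {r : ShiftAlg n} (hr : IsL2Contr r) (m : ℕ) : IsL2Contr (r ^ m) := by
  induction m with
  | zero => rw [pow_zero]; exact isL2Contr_one
  | succ m ih => rw [pow_succ]; exact ih.mul hr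

end basic

section estimates

variable {n : ℕ}

/-- The standard basis vectors. -/
def bv {n : ℕ} (j : Fin n) : Evec n := EuclideanSpace.single j 1

/-- The averaging operator over the vertices of a cube. -/
def cubeAvg (n : ℕ) : ShiftAlg n := ∏ j : Fin n, avg (bv j)

/-- The directions along which `cubeAvg` gains a square function estimate. -/
def goodDir (n : ℕ) : Set (Evec n) :=
  {w | (∃ j, w = bv j) ∨ ∃ j k, j ≠ k ∧ (w = bv j + bv k ∨ w = bv j - bv k)}

/-- The ideal generated by second differences in good directions. -/
def goodIdeal (n : ℕ) : Ideal (ShiftAlg n) := Ideal.span {r | ∃ w ∈ goodDir n, r = dif w ^ 2}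

lemma isSelfAdj_cubeAvg : IsSelfAdj (cubeAvg n) := by
  unfold cubeAvg
  exact Finset.prod_induction _ IsSelfAdj (fun _ _ => IsSelfAdj.mul) isSelfAdj_one
    fun j _ f g hf hg => integral_act_avg_mul hf hg _

lemma isL2Contr_cubeAvg : IsL2Contr (cubeAvg n) := by
  unfold cubeAvg
  exact Finset.prod_induction _ IsL2Contr (fun _ _ => IsL2Contr.mul) isL2Contr_one
    fun j _ => isL2Contr_avg _

lemma avg_mul_avg (y z : Evec n) :
    avg y * avg z = (1 / 2 : ℝ) • (avg (y + z) + avg (y - z)) := by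
  unfold avg
  have e1 := tr_mul_tr y z
  have e2 := tr_mul_tr y (-z)
  have e3 := tr_mul_tr (-y) z
  have e4 := tr_mul_tr (-y) (-z)
  have h1 : -(y + z) = -y + -z := by abel
  have h2 : -(y - z) = -y + z := by abel
  rw [h1, h2, sub_eq_add_neg, ← e1, ← e2, ← e3, ← e4]
  simp only [Algebra.smul_def]
  ring

variable {Q : ℝ → ℝ → ℝ}

lemma bellman_avg_step (hQc : Continuous fun z : ℝ × ℝ => Q z.1 z.2) (h0 : Q 0 0 = 0)
    (hQ : ∀ u u' w w', Q ((u + u') / 2) ((w + w') / 2) + |u - u'| * |w - w'| / 2 ≤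
        (Q u w + Q u' w') / 2) {e G : Evec n → ℝ} (he : IsCc e) (hG : IsCc G) (y : Evec n) :
    (∫ x, Q (act (avg y) e x) (act (avg y) G x)) +
      1 / 2 * ∫ x, |act (dif y) e x| * |act (dif y) G x| ≤ ∫ x, Q (e x) (G x) := by
  have hi := he.comp₂ hG hQc h0
  have i1 := (hi.shift y).integrable
  have i2 := (hi.shift (-y)).integrable
  have i3 := ((he.act (avg y)).comp₂ (hG.act (avg y)) hQc h0).integrable
  have i4 := ((he.act (dif y)).abs_mul_abs (hG.act (dif y))).integrable
  calc _ = ∫ x, (Q (act (avg y) e x) (act (avg y) G x) +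
        1 / 2 * (|act (dif y) e x| * |act (dif y) G x|)) := by
        rw [integral_add i3 (i4.const_mul _), integral_const_mul]
    _ ≤ ∫ x, (Q (e (x + y)) (G (x + y)) + Q (e (x + -y)) (G (x + -y))) * (1 / 2) := by
        refine integral_mono (i3.add (i4.const_mul _)) ((i1.add i2).mul_const _) fun x => ?_
        have := hQ (e (x + y)) (e (x + -y)) (G (x + y)) (G (x + -y))
        simp only [act_avg, act_dif, sub_eq_add_neg] at this ⊢
        linarith
    _ = _ := by
        rw [integral_mul_const, integral_add i1 i2,
          integral_add_right_eq_self (fun x => Q (e x) (G x)) y,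
          integral_add_right_eq_self (fun x => Q (e x) (G x)) (-y)]
        ring

/-- The Bellman integral does not increase along `r`. -/
def IsBellmanContr (Q : ℝ → ℝ → ℝ) (r : ShiftAlg n) : Prop :=
  ∀ e G : Evec n → ℝ, IsCc e → IsCc G → ∫ x, Q (act r e x) (act r G x) ≤ ∫ x, Q (e x) (G x)

lemma isBellmanContr_avg (hQc : Continuous fun z : ℝ × ℝ => Q z.1 z.2) (h0 : Q 0 0 = 0)
    (hQ : ∀ u u' w w', Q ((u + u') / 2) ((w + w') / 2) + |u - u'| * |w - w'| / 2 ≤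
        (Q u w + Q u' w') / 2) (y : Evec n) : IsBellmanContr Q (avg y) := fun e G he hG => by
  have h1 := bellman_avg_step hQc h0 hQ he hG y
  have h2 : 0 ≤ ∫ x, |act (dif y) e x| * |act (dif y) G x| :=
    integral_nonneg fun x => by positivity
  linarith

lemma IsBellmanContr.mul {r s : ShiftAlg n} (hr : IsBellmanContr Q r) (hs : IsBellmanContr Q s) :
    IsBellmanContr Q (r * s) := fun e G he hG => by
  rw [act_mul, act_mul]
  exact (hr _ _ (he.act s) (hG.act s)).trans (hs _ _ he hG)

lemma isBellmanContr_one : IsBellmanContr Q (1 : ShiftAlg n) := fun e G _ _ => by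
  rw [act_one, act_one]

lemma bellman_cubeAvg_step (hQc : Continuous fun z : ℝ × ℝ => Q z.1 z.2) (h0 : Q 0 0 = 0)
    (hQ : ∀ u u' w w', Q ((u + u') / 2) ((w + w') / 2) + |u - u'| * |w - w'| / 2 ≤
        (Q u w + Q u' w') / 2) {e G : Evec n → ℝ} (he : IsCc e) (hG : IsCc G)
    {y : Evec n} (hy : y ∈ goodDir n) :
    (∫ x, Q (act (cubeAvg n) e x) (act (cubeAvg n) G x)) +
      1 / 4 * ∫ x, |act (dif y) e x| * |act (dif y) G x| ≤ ∫ x, Q (e x) (G x) := by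
  classical
  have hnn : ∀ y, 0 ≤ ∫ x, |act (dif y) e x| * |act (dif y) G x| := fun y =>
    integral_nonneg fun x => by positivity
  have hprod : ∀ s : Finset (Fin n), IsBellmanContr Q (∏ j ∈ s, avg (bv j)) := fun s =>
    Finset.prod_induction _ (IsBellmanContr Q) (fun _ _ => IsBellmanContr.mul)
      isBellmanContr_one fun j _ => isBellmanContr_avg hQc h0 hQ _
  rcases hy with ⟨j, rfl⟩ | ⟨j, k, hjk, hy⟩
  · have e1 : cubeAvg n = (∏ i ∈ Finset.univ.erase j, avg (bv i)) * avg (bv j) :=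
      (Finset.prod_erase_mul _ _ (Finset.mem_univ j)).symm
    rw [e1, act_mul, act_mul]
    have h1 := hprod (Finset.univ.erase j) _ _ (he.act (avg (bv j))) (hG.act (avg (bv j)))
    have h2 := bellman_avg_step hQc h0 hQ he hG (bv j)
    linarith [hnn (bv j)]
  · have e1 : cubeAvg n = (∏ i ∈ (Finset.univ.erase j).erase k, avg (bv i)) *
        ((1 / 2 : ℝ) • (avg (bv j + bv k) + avg (bv j - bv k))) := by
      rw [← avg_mul_avg, mul_comm (avg (bv j)), ← mul_assoc, Finset.prod_erase_mul _ _
        (Finset.mem_erase.2 ⟨hjk.symm, Finset.mem_univ k⟩),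
        Finset.prod_erase_mul _ _ (Finset.mem_univ j), cubeAvg]
    set P := bv j + bv k
    set M := bv j - bv k
    set r : ShiftAlg n := (1 / 2 : ℝ) • (avg P + avg M) with hr
    rw [e1, act_mul, act_mul]
    have h1 := hprod ((Finset.univ.erase j).erase k) _ _ (he.act r) (hG.act r)
    have h2 := bellman_avg_step hQc h0 hQ he hG P
    have h3 := bellman_avg_step hQc h0 hQ he hG M
    have h4 : ∫ x, Q (act r e x) (act r G x) ≤
        ((∫ x, Q (act (avg P) e x) (act (avg P) G x)) +
          ∫ x, Q (act (avg M) e x) (act (avg M) G x)) * (1 / 2) := by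
      have i1 := ((he.act (avg P)).comp₂ (hG.act (avg P)) hQc h0).integrable
      have i2 := ((he.act (avg M)).comp₂ (hG.act (avg M)) hQc h0).integrable
      rw [← integral_add i1 i2, ← integral_mul_const]
      refine integral_mono ((he.act r).comp₂ (hG.act r) hQc h0).integrable
        ((i1.add i2).mul_const _) fun x => ?_
      have hrf : ∀ f : Evec n → ℝ, act r f x = (act (avg P) f x + act (avg M) f x) / 2 := by
        intro f
        rw [hr, map_smul, LinearMap.smul_apply, act_add, Pi.smul_apply, Pi.add_apply, smul_eq_mul]
        ring
      have := hQ (act (avg P) e x) (act (avg M) e x) (act (avg P) G x) (act (avg M) G x)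
      have hn : 0 ≤ |act (avg P) e x - act (avg M) e x| * |act (avg P) G x - act (avg M) G x| :=
        by positivity
      simp only [hrf]
      linarith
    rcases hy with rfl | rfl <;> linarith [hnn P, hnn M]

/-- The summed bilinear estimate for the powers of `cubeAvg`. -/
def SumEst (p q : ℝ) (g : ShiftAlg n) : Prop :=
  ∃ C : ℝ, 0 ≤ C ∧ ∀ e G : Evec n → ℝ, IsCc e → IsCc G → ∀ M : ℕ,
    ∑ m ∈ Finset.range M,
      |∫ x, act (g * cubeAvg n ^ m) e x * act (cubeAvg n ^ m) G x| ≤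
      C * ((∫ x, |e x| ^ p) + ∫ x, |G x| ^ q)

lemma sumEst_dif_sq {p q : ℝ} (hpq : p.HolderConjugate q) {w : Evec n} (hw : w ∈ goodDir n) :
    SumEst p q (dif w ^ 2) := by
  obtain ⟨Q, hQc, C, hC, hQ, hQm⟩ := exists_bellman hpq
  have hp := hpq.pos
  have hq := hpq.symm.pos
  have h0 : Q 0 0 = 0 := by
    have := hQ 0 0
    simp only [abs_zero, Real.zero_rpow hp.ne', Real.zero_rpow hq.ne', add_zero, mul_zero] at this
    exact le_antisymm this.2 this.1
  refine ⟨4 * C, by positivity, fun e G he hG M => ?_⟩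
  set α := cubeAvg n
  have key : ∀ M : ℕ, (∫ x, Q (act (α ^ M) e x) (act (α ^ M) G x)) +
      1 / 4 * ∑ m ∈ Finset.range M,
        ∫ x, |act (dif w) (act (α ^ m) e) x| * |act (dif w) (act (α ^ m) G) x| ≤
      ∫ x, Q (e x) (G x) := by
    intro M
    induction M with
    | zero => simp
    | succ M ih =>
      have := bellman_cubeAvg_step hQc h0 hQm (he.act (α ^ M)) (hG.act (α ^ M)) hw
      rw [Finset.sum_range_succ, pow_succ', act_mul, act_mul]
      linarith
  have hb : ∫ x, Q (e x) (G x) ≤ C * ((∫ x, |e x| ^ p) + ∫ x, |G x| ^ q) := by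
    have i1 := (he.abs_rpow hp).integrable
    have i2 := (hG.abs_rpow hq).integrable
    rw [← integral_add i1 i2, ← integral_const_mul]
    exact integral_mono (he.comp₂ hG hQc h0).integrable ((i1.add i2).const_mul _)
      fun x => (hQ _ _).2
  have hpos : 0 ≤ ∫ x, Q (act (α ^ M) e x) (act (α ^ M) G x) :=
    integral_nonneg fun x => (hQ _ _).1
  have hterm : ∀ m, |∫ x, act (dif w ^ 2 * α ^ m) e x * act (α ^ m) G x| ≤
      ∫ x, |act (dif w) (act (α ^ m) e) x| * |act (dif w) (act (α ^ m) G) x| := by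
    intro m
    rw [pow_two, mul_assoc, act_mul, act_mul,
      integral_act_dif_mul ((he.act _).act _) (hG.act _), abs_neg]
    refine (abs_integral_le_integral_abs).trans_eq ?_
    simp only [abs_mul]
  have := Finset.sum_le_sum fun m (_ : m ∈ Finset.range M) => hterm m
  linarith [key M]

lemma sumEst_of_mem_goodIdeal {p q : ℝ} (hpq : p.HolderConjugate q) {g : ShiftAlg n}
    (hg : g ∈ goodIdeal n) : SumEst p q g := by
  unfold goodIdeal Ideal.span at hg
  induction hg using Submodule.span_induction with
  | mem x hx => obtain ⟨w, hw, rfl⟩ := hx; exact sumEst_dif_sq hpq hw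
  | zero => exact ⟨0, le_rfl, fun e G _ _ M => by simp⟩
  | add r s _ _ hr hs =>
    obtain ⟨C, hC0, hC⟩ := hr
    obtain ⟨D, hD0, hD⟩ := hs
    refine ⟨C + D, by positivity, fun e G he hG M => ?_⟩
    have h1 := hC e G he hG M
    have h2 := hD e G he hG M
    refine le_trans ?_ ((add_le_add h1 h2).trans_eq (by ring))
    rw [← Finset.sum_add_distrib]
    refine Finset.sum_le_sum fun m _ => ?_
    have i1 := ((he.act (r * cubeAvg n ^ m)).mul (hG.act (cubeAvg n ^ m))).integrable
    have i2 := ((he.act (s * cubeAvg n ^ m)).mul (hG.act (cubeAvg n ^ m))).integrable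
    refine le_trans (le_of_eq ?_) (abs_add_le _ _)
    rw [← integral_add i1 i2]
    simp only [add_mul, act_add, Pi.add_apply]
  | smul r s _ hs =>
    obtain ⟨C, hC0, hC⟩ := hs
    obtain ⟨D, hD0, hD⟩ := exists_integral_act_le hpq.lt.le r
    refine ⟨C * (D + 1), by positivity, fun e G he hG M => ?_⟩
    have h1 := hC (act r e) G (he.act r) hG M
    have e1 : ∀ m, act (r • s * cubeAvg n ^ m) e = act (s * cubeAvg n ^ m) (act r e) := by
      intro m; rw [← act_mul]; congr 2; rw [smul_eq_mul]; ring
    simp only [e1]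
    refine h1.trans ?_
    rw [mul_assoc]
    refine mul_le_mul_of_nonneg_left ?_ hC0
    have h2 := hD e he
    have h3 : 0 ≤ ∫ x, |e x| ^ p := integral_nonneg fun x => by positivity
    have h4 : 0 ≤ ∫ x, |G x| ^ q := integral_nonneg fun x => by positivity
    nlinarith

end estimates

section discrete

variable {n : ℕ}

lemma tendsto_integral_dif_cubeAvg_pow_sq {w : Evec n} (hw : w ∈ goodDir n) {f : Evec n → ℝ}
    (hf : IsCc f) :
    Tendsto (fun m => ∫ x, act (cubeAvg n ^ m) (act (dif w) f) x ^ 2) atTop (𝓝 0) := by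
  obtain ⟨C, hC0, hC⟩ := sumEst_dif_sq (p := 2) (q := 2) Real.HolderConjugate.two_two hw
  have h := hC f f hf hf
  refine Summable.tendsto_atTop_zero (summable_of_sum_range_le
    (fun m => integral_nonneg fun x => sq_nonneg _) fun M => le_trans (le_of_eq ?_) (h M))
  refine Finset.sum_congr rfl fun m _ => ?_
  rw [pow_two, mul_assoc, act_mul, act_mul,
    integral_act_dif_mul ((hf.act _).act _) (hf.act _), abs_neg, act_comm]
  rw [abs_of_nonneg]
  · congr 1; ext x; rw [act_comm (dif w)]; ring
  · refine integral_nonneg fun x => ?_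
    rw [act_comm (dif w)]
    exact mul_self_nonneg _

lemma abs_integral_mul_le {f g : Evec n → ℝ} (hf : IsCc f) (hg : IsCc g) {t : ℝ} (ht : 0 < t) :
    |∫ x, f x * g x| ≤ t * (∫ x, f x ^ 2) + t⁻¹ * ∫ x, g x ^ 2 := by
  have i1 := hf.sq.integrable
  have i2 := hg.sq.integrable
  refine abs_integral_le_integral_abs.trans ?_
  rw [← integral_const_mul, ← integral_const_mul, ← integral_add (i1.const_mul _) (i2.const_mul _)]
  refine integral_mono (hf.mul hg).integrable.abs ((i1.const_mul _).add (i2.const_mul _)) fun x =>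
      ?_
  show |f x * g x| ≤ t * f x ^ 2 + t⁻¹ * g x ^ 2
  have e : t * f x ^ 2 + t⁻¹ * g x ^ 2 = t⁻¹ * ((t * f x) ^ 2 + g x ^ 2) := by field_simp
  rw [e, inv_mul_eq_div, le_div_iff₀ ht]
  have : |f x * g x| * t = |t * f x| * |g x| := by
    rw [abs_mul, abs_mul, abs_of_pos ht]; ring
  rw [this, ← sq_abs (t * f x), ← sq_abs (g x)]
  nlinarith [sq_nonneg (|t * f x| - |g x|), sq_nonneg (|t * f x|), sq_nonneg (|g x|)]

lemma pairing_telescope (H G : Evec n → ℝ) (hH : IsCc H) (hG : IsCc G) (M : ℕ) :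
    ∫ x, H x * G x = (∑ m ∈ Finset.range M,
      ∫ x, act (cubeAvg n ^ m) (act (1 - cubeAvg n ^ 2) H) x * act (cubeAvg n ^ m) G x) +
      ∫ x, act (cubeAvg n ^ M) H x * act (cubeAvg n ^ M) G x := by
  induction M with
  | zero => simp
  | succ M ih =>
    rw [ih, Finset.sum_range_succ, add_assoc]
    congr 1
    set α := cubeAvg n
    have h1 : ∫ x, act (α ^ (M + 1)) H x * act (α ^ (M + 1)) G x =
        ∫ x, act (α ^ M) (act (α ^ 2) H) x * act (α ^ M) G x := by
      rw [pow_succ' α M, act_mul, act_mul, ← isSelfAdj_cubeAvg _ _ ((hH.act _).act _) (hG.act _),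
        ← act_mul, ← act_mul, ← act_mul]
      have e : cubeAvg n * α * α ^ M = α ^ M * α ^ 2 := by
        change α * α * α ^ M = _
        ring
      rw [e]
    rw [h1, ← integral_add (((hH.act _).act _).mul (hG.act _)).integrable
      (((hH.act _).act _).mul (hG.act _)).integrable]
    congr 1; ext x
    rw [act_sub, act_one, map_sub, Pi.sub_apply]
    ring

lemma pairing_le {p q : ℝ} (hpq : p.HolderConjugate q) {ι : Type*} [Fintype ι]
    (g : ι → ShiftAlg n) (hg : ∀ a, g a ∈ goodIdeal n) {w : Evec n} (hw : w ∈ goodDir n) :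
    ∃ C : ℝ, 0 < C ∧ ∀ (e : ι → Evec n → ℝ) (f G : Evec n → ℝ), (∀ a, IsCc (e a)) → IsCc f →
      IsCc G → act (1 - cubeAvg n ^ 2) (act (dif w) f) = ∑ a, act (g a) (e a) →
      |∫ x, act (dif w) f x * G x| ≤ C * ((∑ a, ∫ x, |e a x| ^ p) + ∫ x, |G x| ^ q) := by
  choose K hK0 hK using fun a => sumEst_of_mem_goodIdeal hpq (hg a)
  refine ⟨1 + ∑ a, K a, by have := Finset.sum_nonneg fun a (_ : a ∈ Finset.univ) => hK0 a
                           linarith, fun e f G he hf hG hrel => ?_⟩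
  set α := cubeAvg n
  set S := (∑ a, ∫ x, |e a x| ^ p) + ∫ x, |G x| ^ q
  have hint0 : ∀ a, 0 ≤ ∫ x, |e a x| ^ p := fun a => integral_nonneg fun x => by positivity
  have hG0 : 0 ≤ ∫ x, |G x| ^ q := integral_nonneg fun x => by positivity
  have hS0 : 0 ≤ S := add_nonneg (Finset.sum_nonneg fun a _ => hint0 a) hG0
  have hmain : ∀ M, |∑ m ∈ Finset.range M, ∫ x,
      act (α ^ m) (act (1 - α ^ 2) (act (dif w) f)) x * act (α ^ m) G x| ≤ (∑ a, K a) * S := by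
    intro M
    calc _ = |∑ m ∈ Finset.range M, ∑ a, ∫ x,
          act (g a * α ^ m) (e a) x * act (α ^ m) G x| := by
          congr 1
          refine Finset.sum_congr rfl fun m _ => ?_
          rw [hrel, ← integral_finsetSum _ fun a _ => (((he a).act _).mul (hG.act _)).integrable]
          congr 1; ext x
          rw [map_sum, Finset.sum_apply, Finset.sum_mul]
          refine Finset.sum_congr rfl fun a _ => ?_
          rw [act_mul, act_comm]
      _ ≤ ∑ a, ∑ m ∈ Finset.range M, |∫ x,
          act (g a * α ^ m) (e a) x * act (α ^ m) G x| := by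
          rw [Finset.sum_comm]
          refine (Finset.abs_sum_le_sum_abs _ _).trans (Finset.sum_le_sum fun a _ => ?_)
          exact Finset.abs_sum_le_sum_abs _ _
      _ ≤ ∑ a, K a * S := by
          refine Finset.sum_le_sum fun a _ => (hK a (e a) G (he a) hG M).trans ?_
          refine mul_le_mul_of_nonneg_left ?_ (hK0 a)
          exact add_le_add_left (Finset.single_le_sum (f := fun a => ∫ x, |e a x| ^ p)
            (fun a _ => hint0 a) (Finset.mem_univ a)) _
      _ = _ := by rw [Finset.sum_mul]
  have hrem : Tendsto (fun M => |∫ x, act (α ^ M) (act (dif w) f) x * act (α ^ M) G x|)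
      atTop (𝓝 0) := by
    have hlim := tendsto_integral_dif_cubeAvg_pow_sq hw hf
    set B := ∫ x, G x ^ 2
    have hB0 : 0 ≤ B := integral_nonneg fun x => sq_nonneg _
    rw [Metric.tendsto_atTop] at hlim ⊢
    intro ε hε
    set t := 2 * (B + 1) / ε with ht
    have ht0 : 0 < t := by positivity
    obtain ⟨N, hN⟩ := hlim (ε / (2 * t)) (by positivity)
    refine ⟨N, fun M hM => ?_⟩
    have h1 := hN M hM
    rw [Real.dist_eq, sub_zero] at h1 ⊢
    have h2 := abs_integral_mul_le ((hf.act (dif w)).act (α ^ M)) (hG.act (α ^ M)) ht0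
    have h3 : ∫ x, act (α ^ M) G x ^ 2 ≤ B := isL2Contr_cubeAvg.pow M G hG
    rw [abs_abs]
    have h4 := lt_of_abs_lt h1
    have h5 : t * ∫ x, act (α ^ M) (act (dif w) f) x ^ 2 < t * (ε / (2 * t)) :=
      mul_lt_mul_of_pos_left h4 ht0
    have h6 : t * (ε / (2 * t)) = ε / 2 := by field_simp
    have h7 : t⁻¹ * ∫ x, act (α ^ M) G x ^ 2 ≤ t⁻¹ * (B + 1) := by
      have : 0 < t⁻¹ := by positivity
      gcongr; linarith
    have h8 : t⁻¹ * (B + 1) = ε / 2 := by rw [ht]; field_simp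
    linarith
  have hle : ∀ M, |∫ x, act (dif w) f x * G x| ≤ (∑ a, K a) * S +
      |∫ x, act (α ^ M) (act (dif w) f) x * act (α ^ M) G x| := by
    intro M
    rw [pairing_telescope _ G (hf.act (dif w)) hG M]
    exact (abs_add_le _ _).trans (add_le_add_left (hmain M) _)
  have := ge_of_tendsto' (hrem.const_add ((∑ a, K a) * S)) hle
  linarith

theorem integral_dif_rpow_le {p : ℝ} (hp : 1 < p) {ι : Type*} [Fintype ι]
    (g : ι → ShiftAlg n) (hg : ∀ a, g a ∈ goodIdeal n) {w : Evec n} (hw : w ∈ goodDir n) :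
    ∃ C : ℝ, 0 < C ∧ ∀ (e : ι → Evec n → ℝ) (f : Evec n → ℝ), (∀ a, IsCc (e a)) → IsCc f →
      act (1 - cubeAvg n ^ 2) (act (dif w) f) = ∑ a, act (g a) (e a) →
      ∫ x, |act (dif w) f x| ^ p ≤ C * ∑ a, ∫ x, |e a x| ^ p := by
  have hpq := Real.HolderConjugate.conjExponent hp
  set q := p.conjExponent
  obtain ⟨C, hC0, hC⟩ := pairing_le hpq g hg hw
  have hq1 : 0 < q - 1 := by linarith [hpq.symm.lt]
  set l : ℝ := (1 / (2 * C)) ^ (q - 1)⁻¹ with hl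
  have hl0 : 0 < l := by positivity
  have hlq : C * l ^ q = l / 2 := by
    have : l ^ q = l ^ (q - 1) * l := by rw [← Real.rpow_add_one hl0.ne']; congr 1; ring
    rw [this, hl, ← Real.rpow_mul (by positivity), inv_mul_cancel₀ hq1.ne', Real.rpow_one]
    field_simp
  refine ⟨2 * C / l, by positivity, fun e f he hf hrel => ?_⟩
  set H := act (dif w) f with hH
  have hHc : IsCc H := hf.act _
  set Φ : ℝ → ℝ := fun t => l * (t * |t| ^ (p - 2)) with hΦ
  have habs : ∀ t : ℝ, |t * |t| ^ (p - 2)| = |t| ^ (p - 1) := by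
    intro t
    rcases eq_or_ne t 0 with rfl | ht
    · simp [Real.zero_rpow (show p - 1 ≠ 0 by linarith)]
    · rw [abs_mul, abs_of_nonneg (by positivity : 0 ≤ |t| ^ (p - 2)), mul_comm,
        ← Real.rpow_add_one (abs_pos.2 ht).ne']
      congr 1; ring
  have hΦc : Continuous Φ := by
    refine Continuous.const_mul ?_ l |>.congr fun _ => rfl
    rw [continuous_iff_continuousAt]
    intro t
    rcases eq_or_ne t 0 with rfl | ht
    · rw [ContinuousAt, zero_mul, tendsto_zero_iff_abs_tendsto_zero]
      have : Tendsto (fun t : ℝ => |t| ^ (p - 1)) (𝓝 0) (𝓝 0) := by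
        have := ((Real.continuous_rpow_const (q := p - 1) (by linarith)).comp
          continuous_abs).tendsto 0
        simpa [Function.comp_def, Real.zero_rpow (show p - 1 ≠ 0 by linarith)] using this
      exact this.congr fun t => (habs t).symm
    · exact continuousAt_id.mul ((continuous_abs.continuousAt).rpow_const
          (Or.inl (abs_pos.2 ht).ne'))
  have hGc : IsCc fun x => Φ (H x) := hHc.comp hΦc (by simp [hΦ])
  have key := hC e f _ he hf hGc hrel
  have e1 : ∫ x, H x * Φ (H x) = l * ∫ x, |H x| ^ p := by
    rw [← integral_const_mul]
    congr 1; ext x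
    rcases eq_or_ne (H x) 0 with h | h
    · simp [h, Real.zero_rpow (show p ≠ 0 by linarith)]
    · have : |H x| ^ p = |H x| ^ 2 * |H x| ^ (p - 2) := by
        rw [← Real.rpow_natCast, ← Real.rpow_add (abs_pos.2 h)]; congr 1; push_cast; ring
      rw [this, sq_abs, hΦ]; ring
  have e2 : ∫ x, |Φ (H x)| ^ q = l ^ q * ∫ x, |H x| ^ p := by
    rw [← integral_const_mul]
    congr 1; ext x
    rw [hΦ]
    simp only []
    rw [abs_mul, habs, abs_of_pos hl0, Real.mul_rpow hl0.le (by positivity),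
      ← Real.rpow_mul (abs_nonneg _), hpq.sub_one_mul_conj]
  rw [e1, e2, mul_add, ← mul_assoc C, hlq] at key
  have := le_abs_self (l * ∫ x, |H x| ^ p)
  rw [div_mul_eq_mul_div, le_div_iff₀ hl0]
  linarith

end discrete

section algebra

variable {n : ℕ}

lemma avg_sq (y : Evec n) : avg y ^ 2 = 1 - (-(1 / 4) : ℝ) • dif y ^ 2 := by
  have h := tr_mul_tr_neg y
  have h2 : (1 : ShiftAlg n) = tr y * tr (-y) := h.symm
  rw [h2, avg, dif, smul_pow, neg_smul]
  simp only [Algebra.smul_def]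
  have e1 : algebraMap ℝ (ShiftAlg n) ((1 / 2) ^ 2) = algebraMap ℝ (ShiftAlg n) (1 / 4) := by
    norm_num
  have e2 : algebraMap ℝ (ShiftAlg n) (1 / 4) * 4 = 1 := by
    rw [← map_ofNat (algebraMap ℝ (ShiftAlg n)) 4, ← map_mul, show (1 / 4 : ℝ) * 4 = 1 by norm_num,
      map_one]
  rw [e1]
  linear_combination (tr y * tr (-y)) * e2

lemma exists_one_sub_cubeAvg_sq :
    ∃ c : Fin n → ShiftAlg n, 1 - cubeAvg n ^ 2 = ∑ j, c j * dif (bv j) ^ 2 := by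
  refine ⟨fun j => (-(1 / 4) : ℝ) • ∏ i ∈ Finset.univ with i < j,
    (1 - (-(1 / 4) : ℝ) • dif (bv i) ^ 2), ?_⟩
  have h : cubeAvg n ^ 2 = ∏ j : Fin n, (1 - (-(1 / 4) : ℝ) • dif (bv j) ^ 2) := by
    rw [cubeAvg, ← Finset.prod_pow]
    exact Finset.prod_congr rfl fun j _ => avg_sq _
  rw [h, Finset.prod_one_sub_ordered, sub_sub_cancel]
  refine Finset.sum_congr rfl fun j _ => ?_
  rw [smul_mul_assoc, smul_mul_assoc, mul_comm]

lemma dif_sq_mem_goodIdeal {w : Evec n} (hw : w ∈ goodDir n) : dif w ^ 2 ∈ goodIdeal n :=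
  Ideal.subset_span ⟨w, hw, rfl⟩

lemma bv_mem_goodDir (j : Fin n) : bv j ∈ goodDir n := Or.inl ⟨j, rfl⟩

lemma avg_mul_avg_mul_dif_mul_dif (y z : Evec n) :
    avg y * avg z * (dif y * dif z) = (1 / 4 : ℝ) • (dif (y + z) ^ 2 - dif (y - z) ^ 2) := by
  unfold avg dif
  have e1 := tr_mul_tr y z
  have e2 := tr_mul_tr y (-z)
  have e3 := tr_mul_tr (-y) z
  have e4 := tr_mul_tr (-y) (-z)
  have h1 : -(y + z) = -y + -z := by abel
  have h2 : -(y - z) = -y + z := by abel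
  rw [h1, h2, sub_eq_add_neg y z, ← e1, ← e2, ← e3, ← e4]
  simp only [Algebra.smul_def]
  have e1 : algebraMap ℝ (ShiftAlg n) (1 / 4) =
      algebraMap ℝ (ShiftAlg n) (1 / 2) * algebraMap ℝ (ShiftAlg n) (1 / 2) := by
    rw [← map_mul]; norm_num
  rw [e1]
  ring

lemma cubeAvg_mul_dif_mul_dif_mem (j k : Fin n) :
    cubeAvg n * (dif (bv j) * dif (bv k)) ∈ goodIdeal n := by
  classical
  rcases eq_or_ne j k with rfl | hjk
  · rw [← pow_two]
    exact Ideal.mul_mem_left _ _ (dif_sq_mem_goodIdeal (bv_mem_goodDir j))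
  · have e1 : cubeAvg n = (∏ i ∈ (Finset.univ.erase j).erase k, avg (bv i)) *
        (avg (bv j) * avg (bv k)) := by
      rw [mul_comm (avg (bv j)), ← mul_assoc, Finset.prod_erase_mul _ _
        (Finset.mem_erase.2 ⟨hjk.symm, Finset.mem_univ k⟩),
        Finset.prod_erase_mul _ _ (Finset.mem_univ j), cubeAvg]
    rw [e1, mul_assoc, avg_mul_avg_mul_dif_mul_dif, Algebra.smul_def]
    refine Ideal.mul_mem_left _ _ (Ideal.mul_mem_left _ _ (Ideal.sub_mem _ ?_ ?_)) <;>
      refine dif_sq_mem_goodIdeal (Or.inr ⟨j, k, hjk, ?_⟩) <;> simp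

/-- Discrete symmetric gradient. -/
def discStrain (w : Fin n → Evec n → ℝ) (a b : Fin n) : Evec n → ℝ :=
  act (avg (bv a) * dif (bv b)) (w a) + act (avg (bv b) * dif (bv a)) (w b)

lemma IsCc.discStrain {w : Fin n → Evec n → ℝ} (hw : ∀ i, IsCc (w i)) (a b : Fin n) :
    IsCc (discStrain w a b) := ((hw a).act _).add ((hw b).act _)

lemma discStrain_identity (w : Fin n → Evec n → ℝ) (i j k : Fin n) (r : ShiftAlg n) :
    act (2 * (r * (dif (bv j) ^ 2 * dif (bv k) * avg (bv i)))) (w i) =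
      act (r * dif (bv j) ^ 2) (discStrain w i k) +
      act (r * (dif (bv j) * dif (bv k))) (discStrain w i j) -
      act (r * (dif (bv j) * dif (bv i))) (discStrain w j k) := by
  simp only [discStrain, map_add, ← act_mul]
  have e : (2 * (r * (dif (bv j) ^ 2 * dif (bv k) * avg (bv i)))) =
      r * dif (bv j) ^ 2 * (avg (bv i) * dif (bv k)) +
      r * (dif (bv j) * dif (bv k)) * (avg (bv i) * dif (bv j)) := by ring
  have e2 : r * dif (bv j) ^ 2 * (avg (bv k) * dif (bv i)) =
      r * (dif (bv j) * dif (bv i)) * (avg (bv k) * dif (bv j)) := by ring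
  have e3 : r * (dif (bv j) * dif (bv k)) * (avg (bv j) * dif (bv i)) =
      r * (dif (bv j) * dif (bv i)) * (avg (bv j) * dif (bv k)) := by ring
  rw [e, act_add, e2, e3]
  abel

theorem discrete_korn {p : ℝ} (hp : 1 < p) (i k : Fin n) :
    ∃ C : ℝ, 0 < C ∧ ∀ w : Fin n → Evec n → ℝ, (∀ i, IsCc (w i)) →
      ∫ x, |act (dif (bv k)) (act (cubeAvg n * avg (bv i)) (w i)) x| ^ p ≤
        C * ∑ a, ∑ b, ∫ x, |discStrain w a b x| ^ p := by
  obtain ⟨c, hc⟩ := exists_one_sub_cubeAvg_sq (n := n)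
  set α := cubeAvg n with hα
  set r : Fin n → ShiftAlg n := fun j => (1 / 2 : ℝ) • (c j * α) with hr
  have hmem : ∀ j a b, r j * (dif (bv a) * dif (bv b)) ∈ goodIdeal n := by
    intro j a b
    have : r j * (dif (bv a) * dif (bv b)) = (algebraMap ℝ (ShiftAlg n) (1 / 2) * c j) *
        (α * (dif (bv a) * dif (bv b))) := by
      simp only [hr, Algebra.smul_def]; ring
    rw [this]
    exact Ideal.mul_mem_left _ _ (cubeAvg_mul_dif_mul_dif_mem a b)
  set g : Fin n ⊕ Fin n ⊕ Fin n → ShiftAlg n := Sum.elim (fun j => r j * dif (bv j) ^ 2)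
    (Sum.elim (fun j => r j * (dif (bv j) * dif (bv k)))
      (fun j => -(r j * (dif (bv j) * dif (bv i))))) with hg
  have hgm : ∀ a, g a ∈ goodIdeal n := by
    rintro (j | j | j)
    · simp only [hg, Sum.elim_inl, pow_two]; exact hmem _ _ _
    · exact hmem _ _ _
    · exact (goodIdeal n).neg_mem (hmem _ _ _)
  obtain ⟨C, hC0, hC⟩ := integral_dif_rpow_le hp g hgm (bv_mem_goodDir k)
  refine ⟨C * (Fintype.card (Fin n ⊕ Fin n ⊕ Fin n) + 1), by positivity, fun w hw => ?_⟩
  set e : Fin n ⊕ Fin n ⊕ Fin n → Evec n → ℝ := Sum.elim (fun _ => discStrain w i k)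
    (Sum.elim (fun j => discStrain w i j) (fun j => discStrain w j k)) with he
  have hrel : act (1 - α ^ 2) (act (dif (bv k)) (act (α * avg (bv i)) (w i))) =
      ∑ a, act (g a) (e a) := by
    rw [Fintype.sum_sum_type, Fintype.sum_sum_type, ← Finset.sum_add_distrib,
      ← Finset.sum_add_distrib, ← act_mul, ← act_mul, hc, Finset.sum_mul, Finset.sum_mul, map_sum,
      LinearMap.sum_apply]
    refine Finset.sum_congr rfl fun j _ => ?_
    simp only [hg, he, Sum.elim_inl, Sum.elim_inr]
    rw [map_neg, LinearMap.neg_apply, ← add_assoc, ← sub_eq_add_neg,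
      ← discStrain_identity w i j k (r j)]
    congr 2
    have e2 : algebraMap ℝ (ShiftAlg n) (1 / 2) * 2 = 1 := by
      rw [← map_ofNat (algebraMap ℝ (ShiftAlg n)) 2, ← map_mul,
        show (1 / 2 : ℝ) * 2 = 1 by norm_num, map_one]
    simp only [hr, Algebra.smul_def]
    linear_combination -(c j * α * dif (bv j) ^ 2 * dif (bv k) * avg (bv i)) * e2
  have hcc : ∀ a, IsCc (e a) := by rintro (j | j | j) <;> exact IsCc.discStrain hw _ _
  refine (hC e _ hcc ((hw i).act _) hrel).trans ?_
  rw [mul_assoc]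
  refine mul_le_mul_of_nonneg_left ?_ hC0.le
  set T := ∑ a, ∑ b, ∫ x, |discStrain w a b x| ^ p
  have hnn : ∀ a b, 0 ≤ ∫ x, |discStrain w a b x| ^ p := fun a b =>
    integral_nonneg fun x => by positivity
  have hT : ∀ a b, ∫ x, |discStrain w a b x| ^ p ≤ T := fun a b =>
    (Finset.single_le_sum (f := fun b => ∫ x, |discStrain w a b x| ^ p)
      (fun b _ => hnn a b) (Finset.mem_univ b)).trans
    (Finset.single_le_sum (f := fun a => ∑ b, ∫ x, |discStrain w a b x| ^ p)
      (fun a _ => Finset.sum_nonneg fun b _ => hnn a b) (Finset.mem_univ a))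
  have hT0 : 0 ≤ T := Finset.sum_nonneg fun a _ => Finset.sum_nonneg fun b _ => hnn a b
  have : ∑ a, ∫ x, |e a x| ^ p ≤ ∑ _a : Fin n ⊕ Fin n ⊕ Fin n, T := by
    refine Finset.sum_le_sum fun a _ => ?_
    rcases a with j | j | j <;> exact hT _ _
  rw [Finset.sum_const, nsmul_eq_mul, Finset.card_univ] at this
  linarith

end algebra

section strain

variable {n : ℕ}

lemma epsLen_nonneg (v : Evec n → Evec n) (x : Evec n) : 0 ≤ epsLen v x := Real.sqrt_nonneg _

lemma DvLen_nonneg (v : Evec n → Evec n) (x : Evec n) : 0 ≤ DvLen v x := Real.sqrt_nonneg _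

lemma measurable_pder (v : Evec n → Evec n) (i j : Fin n) : Measurable (pder v i j) :=
  (EuclideanSpace.proj (𝕜 := ℝ) i).continuous.measurable.comp
    (measurable_fderiv_apply_const ℝ v (EuclideanSpace.single j 1))

lemma measurable_epsLen (v : Evec n → Evec n) : Measurable (epsLen v) := by
  refine Measurable.sqrt (Finset.measurable_sum _ fun i _ => Finset.measurable_sum _ fun j _ => ?_)
  exact (((measurable_pder v i j).add (measurable_pder v j i)).div_const 2).pow_const 2

lemma fderiv_apply_coord (v : Evec n → Evec n) (x h : Evec n) (i : Fin n) :
    fderiv ℝ v x h i = ∑ j, h j * pder v i j x := by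
  have e : h = ∑ j, h j • EuclideanSpace.single j (1 : ℝ) := by
    ext k; simp [Finset.sum_apply, Pi.single_apply]
  conv_lhs => rw [e]
  rw [map_sum]
  simp [pder]

lemma inner_fderiv_eq (v : Evec n → Evec n) (x h : Evec n) :
    inner ℝ (fderiv ℝ v x h) h =
      ∑ i, ∑ j, (pder v i j x + pder v j i x) / 2 * (h i * h j) := by
  have e1 : inner ℝ (fderiv ℝ v x h) h = ∑ i, ∑ j, pder v i j x * (h i * h j) := by
    rw [PiLp.inner_apply]
    refine Finset.sum_congr rfl fun i _ => ?_
    rw [fderiv_apply_coord]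
    simp only [RCLike.inner_apply, conj_trivial, Finset.mul_sum]
    exact Finset.sum_congr rfl fun j _ => by ring
  have e2 : ∑ i, ∑ j, pder v i j x * (h i * h j) = ∑ i, ∑ j, pder v j i x * (h i * h j) := by
    rw [Finset.sum_comm]
    exact Finset.sum_congr rfl fun i _ => Finset.sum_congr rfl fun j _ => by ring
  have e3 : inner ℝ (fderiv ℝ v x h) h = (∑ i, ∑ j, pder v i j x * (h i * h j) +
      ∑ i, ∑ j, pder v j i x * (h i * h j)) / 2 := by rw [← e2, e1]; ring
  rw [e3, ← Finset.sum_add_distrib, Finset.sum_div]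
  refine Finset.sum_congr rfl fun i _ => ?_
  rw [← Finset.sum_add_distrib, Finset.sum_div]
  exact Finset.sum_congr rfl fun j _ => by ring

lemma abs_inner_fderiv_le (v : Evec n → Evec n) (x h : Evec n) :
    |inner ℝ (fderiv ℝ v x h) h| ≤ epsLen v x * ‖h‖ ^ 2 := by
  rw [inner_fderiv_eq, ← Fintype.sum_prod_type' (f := fun i j =>
    (pder v i j x + pder v j i x) / 2 * (h i * h j))]
  have hcs := Finset.sum_mul_sq_le_sq_mul_sq Finset.univ
    (fun z : Fin n × Fin n => (pder v z.1 z.2 x + pder v z.2 z.1 x) / 2) fun z => h z.1 * h z.2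
  have e1 : ∑ z : Fin n × Fin n, ((pder v z.1 z.2 x + pder v z.2 z.1 x) / 2) ^ 2 =
      epsLen v x ^ 2 := by
    rw [epsLen, Real.sq_sqrt (by positivity), Fintype.sum_prod_type]
  have e2 : ∑ z : Fin n × Fin n, (h z.1 * h z.2) ^ 2 = (‖h‖ ^ 2) ^ 2 := by
    rw [EuclideanSpace.real_norm_sq_eq, Fintype.sum_prod_type, sq (∑ i, _), Finset.sum_mul_sum]
    exact Finset.sum_congr rfl fun i _ => Finset.sum_congr rfl fun j _ => by ring
  rw [e1, e2, ← mul_pow] at hcs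
  exact abs_le_of_sq_le_sq hcs (mul_nonneg (epsLen_nonneg v x) (by positivity))

lemma ofReal_abs_inner_segment_le {v : Evec n → Evec n} {x y : Evec n}
    (hd : ∀ t ∈ Icc (0 : ℝ) 1, DifferentiableAt ℝ v (x + t • (y - x))) :
    ENNReal.ofReal |inner ℝ (v y - v x) (y - x)| ≤ ENNReal.ofReal (‖y - x‖ ^ 2) *
      ∫⁻ t in Icc (0 : ℝ) 1, ENNReal.ofReal (epsLen v (x + t • (y - x))) := by
  set h := y - x with hh
  set g : ℝ → ℝ := fun t => inner ℝ (v (x + t • h)) h with hg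
  have hder : ∀ t ∈ Icc (0 : ℝ) 1, HasDerivAt g (inner ℝ (fderiv ℝ v (x + t • h) h) h) t := by
    intro t ht
    have h1 : HasDerivAt (fun t : ℝ => x + t • h) h t := by
      simpa using ((hasDerivAt_id t).smul_const h).const_add x
    have h2 := (hd t ht).hasFDerivAt.comp_hasDerivAt t h1
    have h3 := h2.inner ℝ (hasDerivAt_const t h)
    simpa using h3
  have hle : ∀ t : ℝ, ENNReal.ofReal |inner ℝ (fderiv ℝ v (x + t • h) h) h| ≤
      ENNReal.ofReal (‖h‖ ^ 2) * ENNReal.ofReal (epsLen v (x + t • h)) := fun t => by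
    rw [← ENNReal.ofReal_mul (by positivity), mul_comm]
    exact ENNReal.ofReal_le_ofReal (abs_inner_fderiv_le _ _ _)
  rw [← lintegral_const_mul' _ _ ENNReal.ofReal_ne_top]
  refine le_trans ?_ (lintegral_mono hle)
  by_cases htop : ∫⁻ t in Icc (0 : ℝ) 1,
      ENNReal.ofReal |inner ℝ (fderiv ℝ v (x + t • h) h) h| = ⊤
  · rw [htop]; exact le_top
  have hmeas : Measurable fun t : ℝ => inner ℝ (fderiv ℝ v (x + t • h) h) h :=
    (((measurable_fderiv_apply_const ℝ v h).comp (by fun_prop :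
      Measurable fun t : ℝ => x + t • h)).inner measurable_const)
  have hint : IntegrableOn (fun t : ℝ => inner ℝ (fderiv ℝ v (x + t • h) h) h) (Icc 0 1) := by
    refine ⟨hmeas.aestronglyMeasurable, ?_⟩
    rw [hasFiniteIntegral_iff_norm]
    exact lt_top_iff_ne_top.2 htop
  have hI : IntervalIntegrable (fun t : ℝ => inner ℝ (fderiv ℝ v (x + t • h) h) h) volume 0 1 :=
    (intervalIntegrable_iff_integrableOn_Icc_of_le zero_le_one).2 hint
  have hftc := intervalIntegral.integral_eq_sub_of_hasDerivAt (f := g) (a := 0) (b := 1)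
    (fun t ht => hder t (by rwa [uIcc_of_le zero_le_one] at ht)) hI
  have e : g 1 - g 0 = inner ℝ (v y - v x) h := by
    simp [hg, hh, inner_sub_left]
  rw [← e, ← hftc, intervalIntegral.integral_of_le zero_le_one, ← integral_Icc_eq_integral_Ioc]
  calc _ ≤ ENNReal.ofReal (∫ t in Icc (0 : ℝ) 1, |inner ℝ (fderiv ℝ v (x + t • h) h) h|) :=
        ENNReal.ofReal_le_ofReal abs_integral_le_integral_abs
    _ = _ := ofReal_integral_eq_lintegral_ofReal hint.norm (ae_of_all _ fun _ => abs_nonneg _)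

/-- Jensen's inequality on the unit interval. -/
lemma lintegral_Icc_rpow_le {p : ℝ} (hp : 1 ≤ p) {f : ℝ → ℝ≥0∞} (hf : Measurable f) :
    (∫⁻ t in Icc (0 : ℝ) 1, f t) ^ p ≤ ∫⁻ t in Icc (0 : ℝ) 1, f t ^ p := by
  have : IsProbabilityMeasure (volume.restrict (Icc (0 : ℝ) 1)) := ⟨by simp⟩
  have h := eLpNorm'_le_eLpNorm'_of_exponent_le (μ := volume.restrict (Icc (0 : ℝ) 1))
    zero_lt_one hp hf.aestronglyMeasurable
  simp only [eLpNorm'_eq_lintegral_enorm, enorm_eq_self, ENNReal.rpow_one, one_div, inv_one] at h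
  have h2 := ENNReal.rpow_le_rpow h (by linarith : 0 ≤ p)
  rwa [← ENNReal.rpow_mul, inv_mul_cancel₀ (by linarith), ENNReal.rpow_one] at h2

lemma ofReal_abs_inner_segment_rpow_le {p : ℝ} (hp : 1 ≤ p) {v : Evec n → Evec n} {x y : Evec n}
    (hd : ∀ t ∈ Icc (0 : ℝ) 1, DifferentiableAt ℝ v (x + t • (y - x))) :
    ENNReal.ofReal |inner ℝ (v y - v x) (y - x)| ^ p ≤ ENNReal.ofReal (‖y - x‖ ^ 2) ^ p *
      ∫⁻ t in Icc (0 : ℝ) 1, ENNReal.ofReal (epsLen v (x + t • (y - x))) ^ p := by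
  have hm : Measurable fun t : ℝ => ENNReal.ofReal (epsLen v (x + t • (y - x))) :=
    ((measurable_epsLen v).comp (by fun_prop : Measurable fun t : ℝ => x + t •
        (y - x))).ennreal_ofReal
  refine (ENNReal.rpow_le_rpow (ofReal_abs_inner_segment_le hd) (by linarith)).trans ?_
  rw [ENNReal.mul_rpow_of_nonneg _ _ (by linarith)]
  gcongr
  exact lintegral_Icc_rpow_le hp hm

end strain

section discStrainBound

variable {n : ℕ}

lemma ofReal_abs_rpow {p : ℝ} (hp : 0 ≤ p) (a : ℝ) :
    ENNReal.ofReal (|a| ^ p) = ENNReal.ofReal |a| ^ p :=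
  (ENNReal.ofReal_rpow_of_nonneg (abs_nonneg a) hp).symm

lemma ofReal_abs_add_rpow_le {p : ℝ} (hp : 1 ≤ p) (a b : ℝ) :
    ENNReal.ofReal |a + b| ^ p ≤
      2 ^ (p - 1) * (ENNReal.ofReal |a| ^ p + ENNReal.ofReal |b| ^ p) := by
  refine le_trans (ENNReal.rpow_le_rpow ?_ (by linarith))
      (ENNReal.rpow_add_le_mul_rpow_add_rpow _ _ hp)
  rw [← ENNReal.ofReal_add (abs_nonneg _) (abs_nonneg _)]
  exact ENNReal.ofReal_le_ofReal (abs_add_le a b)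

lemma discStrain_eq (w : Fin n → Evec n → ℝ) (a b : Fin n) (x : Evec n) :
    discStrain w a b x =
      (1 / 2) * (inner ℝ ((WithLp.toLp 2 fun i => w i (x + (bv a + bv b))) -
          (WithLp.toLp 2 fun i => w i (x - (bv a + bv b)))) (bv a + bv b) +
        inner ℝ ((WithLp.toLp 2 fun i => w i (x - (bv a - bv b))) -
          (WithLp.toLp 2 fun i => w i (x + (bv a - bv b)))) (bv a - bv b)) := by
  have hin : ∀ (u : Evec n) (c : Fin n), inner ℝ u (bv c) = u c := fun u c => by
    simp [bv, EuclideanSpace.inner_single_right]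
  simp only [discStrain, Pi.add_apply, act_mul, act_avg, act_dif, inner_add_right,
    inner_sub_right, hin, PiLp.sub_apply]
  simp only [sub_eq_add_neg, neg_add, neg_neg, ← add_assoc]
  rw [add_right_comm x (bv b) (bv a), add_right_comm x (bv b) (-bv a),
    add_right_comm x (-bv b) (bv a), add_right_comm x (-bv b) (-bv a)]
  ring

lemma lintegral_ofReal_abs_inner_rpow_le {p : ℝ} (hp : 1 ≤ p) {v : Evec n → Evec n}
    (hd : Differentiable ℝ v) (u : Evec n) :
    ∫⁻ x, ENNReal.ofReal |inner ℝ (v (x + u) - v (x - u)) u| ^ p ≤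
      ENNReal.ofReal (2 * ‖u‖ ^ 2) ^ p * ∫⁻ x, ENNReal.ofReal (epsLen v x) ^ p := by
  have hp0 : 0 ≤ p := by linarith
  have hm : Measurable fun x => ENNReal.ofReal (epsLen v x) ^ p :=
    (measurable_epsLen v).ennreal_ofReal.pow_const p
  have h1 : ∀ x, ENNReal.ofReal |inner ℝ (v (x + u) - v (x - u)) u| ^ p ≤
      ENNReal.ofReal (2 * ‖u‖ ^ 2) ^ p * ∫⁻ t in Icc (0 : ℝ) 1,
        ENNReal.ofReal (epsLen v (x - u + t • (2 • u))) ^ p := by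
    intro x
    have h := ofReal_abs_inner_segment_rpow_le (x := x - u) (y := x + u) hp (v := v)
      fun t _ => hd _
    have e : x + u - (x - u) = (2 : ℝ) • u := by rw [two_smul]; abel
    have e' : (2 : ℕ) • u = (2 : ℝ) • u := by rw [two_smul, two_smul]
    rw [e, inner_smul_right, norm_smul, abs_mul, abs_two, Real.norm_two, mul_pow,
      ENNReal.ofReal_mul (by norm_num), ENNReal.mul_rpow_of_nonneg _ _ hp0] at h
    rw [e']
    have h2 : ENNReal.ofReal 2 ^ p ≠ 0 := by
      simp [ENNReal.rpow_eq_zero_iff]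
    have h2' : ENNReal.ofReal 2 ^ p ≠ ⊤ := ENNReal.rpow_ne_top_of_nonneg hp0 ENNReal.ofReal_ne_top
    have h3 : ENNReal.ofReal 2 ^ p * ENNReal.ofReal (2 * ‖u‖ ^ 2) ^ p =
        ENNReal.ofReal (2 ^ 2 * ‖u‖ ^ 2) ^ p := by
      rw [← ENNReal.mul_rpow_of_nonneg _ _ hp0, ← ENNReal.ofReal_mul (by norm_num)]
      ring_nf
    rw [← ENNReal.mul_le_mul_iff_right h2 h2', ← mul_assoc, h3]
    exact h
  calc _ ≤ ∫⁻ x, ENNReal.ofReal (2 * ‖u‖ ^ 2) ^ p * ∫⁻ t in Icc (0 : ℝ) 1,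
        ENNReal.ofReal (epsLen v (x - u + t • (2 • u))) ^ p := lintegral_mono h1
    _ = ENNReal.ofReal (2 * ‖u‖ ^ 2) ^ p * ∫⁻ x, ∫⁻ t in Icc (0 : ℝ) 1,
        ENNReal.ofReal (epsLen v (x - u + t • (2 • u))) ^ p :=
        lintegral_const_mul' _ _ (ENNReal.rpow_ne_top_of_nonneg hp0 ENNReal.ofReal_ne_top)
    _ = ENNReal.ofReal (2 * ‖u‖ ^ 2) ^ p * ∫⁻ t in Icc (0 : ℝ) 1, ∫⁻ x,
        ENNReal.ofReal (epsLen v (x - u + t • (2 • u))) ^ p := by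
        rw [lintegral_lintegral_swap]
        exact (hm.comp (by fun_prop : Measurable fun z : Evec n × ℝ =>
          z.1 - u + z.2 • (2 • u))).aemeasurable
    _ = _ := by
        congr 1
        have : ∀ t : ℝ, ∫⁻ x, ENNReal.ofReal (epsLen v (x - u + t • (2 • u))) ^ p =
            ∫⁻ x, ENNReal.ofReal (epsLen v x) ^ p := fun t => by
          simp_rw [sub_add_eq_add_sub, add_sub_assoc]
          exact lintegral_add_right_eq_self (fun x => ENNReal.ofReal (epsLen v x) ^ p) _
        simp [this]

lemma exists_lintegral_discStrain_le {p : ℝ} (hp : 1 ≤ p) (a b : Fin n) :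
    ∃ C : ℝ, 0 ≤ C ∧ ∀ v : Evec n → Evec n, Differentiable ℝ v →
      ∫⁻ x, ENNReal.ofReal |discStrain (fun i x => v x i) a b x| ^ p ≤
        ENNReal.ofReal C * ∫⁻ x, ENNReal.ofReal (epsLen v x) ^ p := by
  have hp0 : 0 ≤ p := by linarith
  set C : ℝ≥0∞ := 2 ^ (p - 1) * (ENNReal.ofReal (2 * ‖(bv a + bv b : Evec n)‖ ^ 2) ^ p +
    ENNReal.ofReal (2 * ‖(bv a - bv b : Evec n)‖ ^ 2) ^ p) with hC
  have hCt : C ≠ ⊤ := by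
    refine ENNReal.mul_ne_top (ENNReal.rpow_ne_top_of_nonneg (by linarith) (by norm_num))
      (ENNReal.add_ne_top.2 ⟨?_, ?_⟩) <;>
    exact ENNReal.rpow_ne_top_of_nonneg hp0 ENNReal.ofReal_ne_top
  refine ⟨C.toReal, ENNReal.toReal_nonneg, fun v hd => ?_⟩
  rw [ENNReal.ofReal_toReal hCt]
  have hv : Continuous v := hd.continuous
  have h1 : ∀ x, ENNReal.ofReal |discStrain (fun i x => v x i) a b x| ^ p ≤
      2 ^ (p - 1) * (ENNReal.ofReal |inner ℝ (v (x + (bv a + bv b)) - v (x - (bv a + bv b)))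
        (bv a + bv b)| ^ p + ENNReal.ofReal |inner ℝ (v (x + (bv a - bv b)) -
          v (x - (bv a - bv b))) (bv a - bv b)| ^ p) := by
    intro x
    have e := discStrain_eq (fun i x => v x i) a b x
    simp only [WithLp.toLp_ofLp] at e
    set A := inner ℝ (v (x + (bv a + bv b)) - v (x - (bv a + bv b))) (bv a + bv b)
    set B := inner ℝ (v (x + (bv a - bv b)) - v (x - (bv a - bv b))) (bv a - bv b) with hB
    have e2 : inner ℝ (v (x - (bv a - bv b)) - v (x + (bv a - bv b))) (bv a - bv b) = -B := by
      rw [hB, ← neg_sub (v (x + _)), inner_neg_left]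
    rw [e2] at e
    refine le_trans (ENNReal.rpow_le_rpow (ENNReal.ofReal_le_ofReal ?_) hp0)
      (le_of_le_of_eq (ofReal_abs_add_rpow_le hp A (-B)) (by rw [abs_neg]))
    rw [e, abs_mul, abs_of_pos (by norm_num : (0 : ℝ) < 1 / 2)]
    linarith [abs_nonneg (A + -B)]
  refine (lintegral_mono h1).trans ?_
  rw [lintegral_const_mul' _ _ (ENNReal.rpow_ne_top_of_nonneg (by linarith) (by norm_num)),
    lintegral_add_left, hC, mul_assoc, add_mul]
  · gcongr <;> exact lintegral_ofReal_abs_inner_rpow_le hp hd _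
  · have : Continuous fun x => inner ℝ (v (x + (bv a + bv b)) - v (x - (bv a + bv b)))
        (bv a + bv b) := by fun_prop
    exact this.abs.measurable.ennreal_ofReal.pow_const p

/-- Discrete Korn inequality bounding differences by the symmetric gradient. -/
lemma exists_lintegral_dif_le {p : ℝ} (hp : 1 < p) (i k : Fin n) :
    ∃ C : ℝ, 0 ≤ C ∧ ∀ v : Evec n → Evec n, Differentiable ℝ v → HasCompactSupport v →
      ∫⁻ x, ENNReal.ofReal |act (dif (bv k) * (cubeAvg n * avg (bv i))) (fun x => v x i) x| ^ p ≤
        ENNReal.ofReal C * ∫⁻ x, ENNReal.ofReal (epsLen v x) ^ p := by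
  have hp0 : 0 < p := by linarith
  obtain ⟨C, hC0, hC⟩ := discrete_korn hp i k
  choose D hD0 hD using fun a b => exists_lintegral_discStrain_le (n := n) hp.le a b
  refine ⟨C * ∑ a, ∑ b, D a b, mul_nonneg hC0.le
    (Finset.sum_nonneg fun a _ => Finset.sum_nonneg fun b _ => hD0 a b), fun v hd hs => ?_⟩
  have hcc : ∀ i, IsCc fun x => v x i := fun i =>
    ⟨(EuclideanSpace.proj (𝕜 := ℝ) i).continuous.comp hd.continuous,
      hs.comp_left (g := fun y : Evec n => y i) rfl⟩
  have conv : ∀ f : Evec n → ℝ, IsCc f → ∫⁻ x, ENNReal.ofReal |f x| ^ p =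
      ENNReal.ofReal (∫ x, |f x| ^ p) := fun f hf => by
    simp_rw [← ofReal_abs_rpow hp0.le]
    exact (ofReal_integral_eq_lintegral_ofReal (hf.abs_rpow hp0).integrable
      (ae_of_all _ fun _ => by positivity)).symm
  rw [conv _ ((hcc i).act _)]
  have h := hC (fun i x => v x i) hcc
  rw [← act_mul] at h
  refine (ENNReal.ofReal_le_ofReal h).trans ?_
  rw [ENNReal.ofReal_mul hC0.le, ENNReal.ofReal_mul hC0.le, mul_assoc]
  gcongr
  have hn : ∀ a b, 0 ≤ ∫ x, |discStrain (fun i x => v x i) a b x| ^ p := fun a b =>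
    integral_nonneg fun _ => by positivity
  rw [ENNReal.ofReal_sum_of_nonneg fun a _ => Finset.sum_nonneg fun b _ => hn a b,
    ENNReal.ofReal_sum_of_nonneg fun a _ => Finset.sum_nonneg fun b _ => hD0 a b, Finset.sum_mul]
  refine Finset.sum_le_sum fun a _ => ?_
  rw [ENNReal.ofReal_sum_of_nonneg fun b _ => hn a b,
    ENNReal.ofReal_sum_of_nonneg fun b _ => hD0 a b, Finset.sum_mul]
  refine Finset.sum_le_sum fun b _ => ?_
  rw [← conv _ (IsCc.discStrain hcc a b)]
  exact hD a b v hd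

end discStrainBound

section compactKorn

variable {n : ℕ}

lemma lintegral_comp_smul' (f : Evec n → ℝ≥0∞) {h : ℝ} (hh : h ≠ 0) :
    ∫⁻ x, f (h • x) = ENNReal.ofReal |(h ^ n)⁻¹| * ∫⁻ x, f x := by
  have e := lintegral_map_equiv (μ := (volume : Measure (Evec n))) f
    (Homeomorph.smulOfNeZero h hh).toMeasurableEquiv
  have e2 : Measure.map (Homeomorph.smulOfNeZero h hh).toMeasurableEquiv
      (volume : Measure (Evec n)) = ENNReal.ofReal |(h ^ n)⁻¹| • volume := by
    have := Measure.map_addHaar_smul (volume : Measure (Evec n)) hh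
    rw [finrank_euclideanSpace_fin] at this
    exact this
  rw [e2, lintegral_smul_measure] at e
  exact e.symm

lemma hasDerivAt_act (r : ShiftAlg n) {f : Evec n → ℝ} {x : Evec n}
    (hf : DifferentiableAt ℝ f x) :
    HasDerivAt (fun h : ℝ => act r (fun y => f (x + h • y)) 0)
      (act r (fun y => fderiv ℝ f x y) 0) 0 := by
  induction r using AddMonoidAlgebra.induction_linear with
  | zero => simp only [act_zero, Pi.zero_apply]; exact hasDerivAt_const _ _
  | add r s hr hs => simp only [act_add, Pi.add_apply]; exact hr.add hs
  | single y c =>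
    simp only [act_single, zero_add]
    refine HasDerivAt.const_mul c ?_
    have h1 : HasDerivAt (fun h : ℝ => x + h • y) y 0 := by
      simpa using ((hasDerivAt_id (0 : ℝ)).smul_const y).const_add x
    have h2 : HasFDerivAt f (fderiv ℝ f x) (x + (0 : ℝ) • y) := by simpa using hf.hasFDerivAt
    exact h2.comp_hasDerivAt 0 h1

lemma act_avg_linear (y : Evec n) (l : Evec n →L[ℝ] ℝ) : act (avg y) (fun x => l x) = fun x =>
    l x := by
  ext x; rw [act_avg, map_add, map_sub]; ring

lemma act_cubeAvg_linear (l : Evec n →L[ℝ] ℝ) : act (cubeAvg n) (fun x => l x) = fun x => l x := by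
  rw [cubeAvg]
  refine Finset.prod_induction _ (fun r => act r (fun x => l x) = fun x => l x) ?_ (act_one _) ?_
  · intro r s hr hs; rw [act_mul, hs, hr]
  · intro j _; exact act_avg_linear _ l

lemma act_shift_smul (r : ShiftAlg n) (f : Evec n → ℝ) (h : ℝ) (z : Evec n) :
    act r (fun y => f (h • y)) z = act r (fun y => f (h • z + h • y)) 0 := by
  induction r using AddMonoidAlgebra.induction_linear with
  | zero => simp
  | add r s hr hs => simp only [act_add, Pi.add_apply, hr, hs]
  | single y c => simp only [act_single, zero_add, smul_add]

lemma act_const_mul (r : ShiftAlg n) (c : ℝ) (f : Evec n → ℝ) (z : Evec n) :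
    act r (fun y => c * f y) z = c * act r f z := by
  have : (fun y => c * f y) = c • f := rfl
  rw [this, map_smul]; rfl

lemma fderiv_coord (v : Evec n → Evec n) (x h : Evec n) (i : Fin n) (hv : DifferentiableAt ℝ v x) :
    fderiv ℝ (fun x => v x i) x h = fderiv ℝ v x h i := by
  have := ((EuclideanSpace.proj (𝕜 := ℝ) i).hasFDerivAt.comp x hv.hasFDerivAt).fderiv
  have e : (fun x => v x i) = (EuclideanSpace.proj (𝕜 := ℝ) i : Evec n →L[ℝ] ℝ) ∘ v := rfl
  rw [e, this]; rfl

lemma pder_scale {v : Evec n → Evec n} (hd : Differentiable ℝ v) {h : ℝ} (hh : h ≠ 0)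
    (i j : Fin n) (x : Evec n) : pder (fun y => h⁻¹ • v (h • y)) i j x = pder v i j (h • x) := by
  have h1 : HasFDerivAt (fun y : Evec n => h • y) (h • ContinuousLinearMap.id ℝ (Evec n)) x :=
    (h • ContinuousLinearMap.id ℝ (Evec n)).hasFDerivAt
  have h2 := ((hd (h • x)).hasFDerivAt.comp x h1).const_smul h⁻¹
  have h3 : HasFDerivAt (fun y => h⁻¹ • v (h • y)) (fderiv ℝ v (h • x)) x := by
    have e : h⁻¹ • (fderiv ℝ v (h • x)).comp (h • ContinuousLinearMap.id ℝ (Evec n)) =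
        fderiv ℝ v (h • x) := by
      ext1 z; simp [smul_smul, hh]
    rw [e] at h2
    exact h2
  rw [pder, h3.fderiv, pder]

lemma epsLen_scale {v : Evec n → Evec n} (hd : Differentiable ℝ v) {h : ℝ} (hh : h ≠ 0)
    (x : Evec n) : epsLen (fun y => h⁻¹ • v (h • y)) x = epsLen v (h • x) := by
  simp only [epsLen, pder_scale hd hh]

lemma exists_lintegral_pder_le {p : ℝ} (hp : 1 < p) (i k : Fin n) :
    ∃ C : ℝ, 0 ≤ C ∧ ∀ v : Evec n → Evec n, Differentiable ℝ v → HasCompactSupport v →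
      ∫⁻ x, ENNReal.ofReal |pder v i k x| ^ p ≤
        ENNReal.ofReal C * ∫⁻ x, ENNReal.ofReal (epsLen v x) ^ p := by
  obtain ⟨C, hC0, hC⟩ := exists_lintegral_dif_le (n := n) hp i k
  refine ⟨C, hC0, fun v hd hs => ?_⟩
  have hp0 : 0 < p := by linarith
  set r : ShiftAlg n := dif (bv k) * (cubeAvg n * avg (bv i)) with hr
  have hscale : ∀ h : ℝ, h ≠ 0 →
      ∫⁻ x, ENNReal.ofReal |h⁻¹ * act r (fun y => v (x + h • y) i) 0| ^ p ≤
        ENNReal.ofReal C * ∫⁻ x, ENNReal.ofReal (epsLen v x) ^ p := by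
    intro h hh
    have h1 := hC (fun y => h⁻¹ • v (h • y)) (by fun_prop)
      ((hs.comp_homeomorph (Homeomorph.smulOfNeZero h hh)).comp_left (g := fun y => h⁻¹ • y)
        (smul_zero _))
    simp only [PiLp.smul_apply, smul_eq_mul, act_const_mul, epsLen_scale hd hh] at h1
    simp only [act_shift_smul _ (fun y => v y i)] at h1
    rw [lintegral_comp_smul' (fun x => ENNReal.ofReal |h⁻¹ * act r
        (fun y => v (x + h • y) i) 0| ^ p)
      hh, lintegral_comp_smul' (fun x => ENNReal.ofReal (epsLen v x) ^ p) hh, mul_left_comm] at h1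
    exact (ENNReal.mul_le_mul_iff_right (by simp [hh]) ENNReal.ofReal_ne_top).1 h1
  set hm : ℕ → ℝ := fun m => 1 / ((m : ℝ) + 1) with hhm
  have hmpos : ∀ m, 0 < hm m := fun m => by positivity
  have hlim : ∀ x, Tendsto (fun m => ENNReal.ofReal
      |(hm m)⁻¹ * act r (fun y => v (x + hm m • y) i) 0| ^ p) atTop
      (𝓝 (ENNReal.ofReal |2 * pder v i k x| ^ p)) := by
    intro x
    have hdi : DifferentiableAt ℝ (fun x => v x i) x :=
      (EuclideanSpace.proj (𝕜 := ℝ) i).differentiableAt.comp x (hd x)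
    have hder := hasDerivAt_act r hdi
    have e0 : act r (fun y => fderiv ℝ (fun x => v x i) x y) 0 = 2 * pder v i k x := by
      rw [hr, act_mul, act_mul, act_avg_linear, act_cubeAvg_linear, act_dif, zero_add, zero_sub,
        map_neg, fderiv_coord v x _ i (hd x)]
      simp only [pder, bv]; ring
    have e1 : act r (fun y => v (x + (0 : ℝ) • y) i) 0 = 0 := by
      simp only [zero_smul, add_zero]
      rw [hr, mul_comm, act_mul]
      have : act (dif (bv k)) (fun _ : Evec n => v x i) = 0 := by
        ext z; rw [act_dif]; simp
      rw [this, map_zero]; rfl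
    rw [e0, hasDerivAt_iff_tendsto_slope_zero] at hder
    have ht : Tendsto hm atTop (𝓝[≠] 0) :=
      tendsto_nhdsWithin_of_tendsto_nhds_of_eventually_within _
        tendsto_one_div_add_atTop_nhds_zero_nat (Eventually.of_forall fun m => (hmpos m).ne')
    have h3 := hder.comp ht
    simp only [Function.comp_def, e1, zero_add, sub_zero, smul_eq_mul] at h3
    exact ((ENNReal.continuous_rpow_const.tendsto _).comp
      (ENNReal.tendsto_ofReal h3.abs))
  have hcont : ∀ m, Measurable fun x => ENNReal.ofReal
      |(hm m)⁻¹ * act r (fun y => v (x + hm m • y) i) 0| ^ p := by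
    intro m
    have hc : ∀ r : ShiftAlg n, Continuous fun x => act r (fun y => v (x + hm m • y) i) 0 := by
      intro r
      induction r using AddMonoidAlgebra.induction_linear with
      | zero => simp only [act_zero, Pi.zero_apply]; exact continuous_const
      | add r s hr hs => simp only [act_add, Pi.add_apply]; exact hr.add hs
      | single y c =>
        simp only [act_single]
        have := hd.continuous
        fun_prop
    exact ((continuous_const.mul (hc r)).abs.measurable.ennreal_ofReal).pow_const p
  calc ∫⁻ x, ENNReal.ofReal |pder v i k x| ^ p
      ≤ ∫⁻ x, liminf (fun m => ENNReal.ofReal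
          |(hm m)⁻¹ * act r (fun y => v (x + hm m • y) i) 0| ^ p) atTop := by
        refine lintegral_mono fun x => ?_
        rw [(hlim x).liminf_eq]
        refine ENNReal.rpow_le_rpow (ENNReal.ofReal_le_ofReal ?_) hp0.le
        rw [abs_mul, abs_two]; linarith [abs_nonneg (pder v i k x)]
    _ ≤ liminf (fun m => ∫⁻ x, ENNReal.ofReal
          |(hm m)⁻¹ * act r (fun y => v (x + hm m • y) i) 0| ^ p) atTop :=
        lintegral_liminf_le hcont
    _ ≤ liminf (fun _ : ℕ => ENNReal.ofReal C * ∫⁻ x, ENNReal.ofReal (epsLen v x) ^ p) atTop :=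
        liminf_le_liminf (Eventually.of_forall fun m => hscale _ (hmpos m).ne')
    _ = _ := liminf_const _

lemma DvLen_le_sum (v : Evec n → Evec n) (x : Evec n) : DvLen v x ≤ ∑ i, ∑ j, |pder v i j x| := by
  have hn : ∀ i, 0 ≤ ∑ j, |pder v i j x| := fun i => Finset.sum_nonneg fun j _ => abs_nonneg _
  refine Real.sqrt_le_iff.2 ⟨Finset.sum_nonneg fun i _ => hn i, ?_⟩
  refine le_trans (Finset.sum_le_sum fun i _ => ?_)
    (Finset.sum_sq_le_sq_sum_of_nonneg fun i _ => hn i)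
  refine le_trans (le_of_eq ?_) (Finset.sum_sq_le_sq_sum_of_nonneg fun j _ => abs_nonneg _)
  exact Finset.sum_congr rfl fun j _ => (sq_abs _).symm

lemma ofReal_DvLen_rpow_le {p : ℝ} (hp : 1 ≤ p) (v : Evec n → Evec n) (x : Evec n) :
    ENNReal.ofReal (DvLen v x) ^ p ≤ ((n * n : ℕ) : ℝ≥0∞) ^ (p - 1) *
      ∑ i, ∑ j, ENNReal.ofReal |pder v i j x| ^ p := by
  have h := ENNReal.rpow_sum_le_const_mul_sum_rpow (Finset.univ : Finset (Fin n × Fin n))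
    (fun z => ENNReal.ofReal |pder v z.1 z.2 x|) hp
  rw [Fintype.sum_prod_type, Fintype.sum_prod_type] at h
  simp only [Finset.card_univ, Fintype.card_prod, Fintype.card_fin] at h
  refine le_trans (ENNReal.rpow_le_rpow ?_ (by linarith)) h
  rw [← Fintype.sum_prod_type' (f := fun i j => ENNReal.ofReal |pder v i j x|),
    ← ENNReal.ofReal_sum_of_nonneg fun _ _ => abs_nonneg _, Fintype.sum_prod_type]
  exact ENNReal.ofReal_le_ofReal (DvLen_le_sum v x)

/-- Korn's first inequality for compactly supported differentiable vector fields. -/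
theorem compact_korn (n : ℕ) {p : ℝ} (hp : 1 < p) : ∃ C : ℝ≥0∞, C ≠ ⊤ ∧
    ∀ v : Evec n → Evec n, Differentiable ℝ v → HasCompactSupport v →
      ∫⁻ x, ENNReal.ofReal (DvLen v x) ^ p ≤ C * ∫⁻ x, ENNReal.ofReal (epsLen v x) ^ p := by
  choose D hD0 hD using fun a b => exists_lintegral_pder_le (n := n) hp a b
  refine ⟨((n * n : ℕ) : ℝ≥0∞) ^ (p - 1) * ∑ i, ∑ j, ENNReal.ofReal (D i j), ?_, fun v hd hs => ?_⟩
  · refine ENNReal.mul_ne_top (ENNReal.rpow_ne_top_of_nonneg (by linarith)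
        (ENNReal.natCast_ne_top _)) ?_
    exact ENNReal.sum_ne_top.2 fun i _ => ENNReal.sum_ne_top.2 fun j _ => ENNReal.ofReal_ne_top
  refine (lintegral_mono fun x => ofReal_DvLen_rpow_le hp.le v x).trans ?_
  have hm : ∀ i j, Measurable fun x => ENNReal.ofReal |pder v i j x| ^ p := fun i j =>
    ((measurable_pder v i j).abs.ennreal_ofReal).pow_const p
  rw [lintegral_const_mul' _ _ (ENNReal.rpow_ne_top_of_nonneg (by linarith)
      (ENNReal.natCast_ne_top _)),
    lintegral_finsetSum _ fun i _ => Finset.measurable_sum _ fun j _ => hm i j, mul_assoc,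
    Finset.sum_mul]
  gcongr with i
  rw [lintegral_finsetSum _ fun j _ => hm i j, Finset.sum_mul]
  gcongr with j
  exact hD i j v hd hs

end compactKorn

section localRepresentation

variable {n : ℕ}

/-- Jensen's inequality on a set. -/
lemma setLIntegral_rpow_le {α : Type*} [MeasurableSpace α] {μ : Measure α} {p : ℝ} (hp : 1 ≤ p)
    (s : Set α) {f : α → ℝ≥0∞} (hf : AEMeasurable f (μ.restrict s)) :
    (∫⁻ x in s, f x ∂μ) ^ p ≤ μ s ^ (p - 1) * ∫⁻ x in s, f x ^ p ∂μ := by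
  have h := eLpNorm'_le_eLpNorm'_mul_rpow_measure_univ (μ := μ.restrict s)
    zero_lt_one hp hf.aestronglyMeasurable
  simp only [eLpNorm'_eq_lintegral_enorm, enorm_eq_self, ENNReal.rpow_one, one_div, inv_one,
    Measure.restrict_apply_univ] at h
  have h2 := ENNReal.rpow_le_rpow h (by linarith : 0 ≤ p)
  rw [ENNReal.mul_rpow_of_nonneg _ _ (by linarith), ← ENNReal.rpow_mul, ← ENNReal.rpow_mul,
    inv_mul_cancel₀ (by linarith), ENNReal.rpow_one, mul_comm] at h2
  convert h2 using 3
  field_simp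

lemma exists_moment_functions (n : ℕ) : ∃ φ : Fin n → Evec n → ℝ, (∀ k, Continuous (φ k)) ∧
    (∀ k, HasCompactSupport (φ k)) ∧ (∀ k, tsupport (φ k) ⊆ Metric.ball 0 1) ∧
    (∀ k, ∫ y, φ k y = 0) ∧ ∀ j k, ∫ y, y j * φ k y = if j = k then 1 else 0 := by
  let f : ContDiffBump (0 : Evec n) := ⟨1 / 4, 1 / 2, by norm_num, by norm_num⟩
  set η := f.normed volume with hη
  have hd : ContDiff ℝ 1 η := f.contDiff_normed
  have hs : HasCompactSupport η := f.hasCompactSupport_normed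
  have hcf : ∀ k, Continuous fun y => fderiv ℝ η y (bv k) := fun k =>
    (hd.continuous_fderiv one_ne_zero).clm_apply continuous_const
  have hsf : ∀ k, HasCompactSupport fun y => fderiv ℝ η y (bv k) := fun k =>
    hs.fderiv_apply (𝕜 := ℝ) (bv k)
  have hts : tsupport η = Metric.closedBall 0 (1 / 2) := f.tsupport_normed_eq
  have hparts : ∀ (g : Evec n → ℝ) (k : Fin n), Differentiable ℝ g → Continuous
      (fun y => fderiv ℝ g y (bv k)) →
      ∫ y, g y * -fderiv ℝ η y (bv k) = ∫ y, fderiv ℝ g y (bv k) * η y := by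
    intro g k hg hg'
    have := integral_mul_fderiv_eq_neg_fderiv_mul_of_integrable (μ := volume) (f := g) (g := η)
      (v := bv k) ((hg'.mul hd.continuous).integrable_of_hasCompactSupport hs.mul_left)
      ((hg.continuous.mul (hcf k)).integrable_of_hasCompactSupport (hsf k).mul_left)
      ((hg.continuous.mul hd.continuous).integrable_of_hasCompactSupport hs.mul_left)
      (fun x _ => hg x) (fun x _ => hd.differentiable one_ne_zero x)
    simp only [mul_neg, integral_neg, this, neg_neg]
  refine ⟨fun k y => -fderiv ℝ η y (bv k), fun k => (hcf k).neg, fun k => (hsf k).neg, fun k => ?_,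
    fun k => ?_, fun j k => ?_⟩
  · have e : tsupport (fun y => -fderiv ℝ η y (bv k)) = tsupport fun y => fderiv ℝ η y (bv k) := by
      rw [tsupport, Function.support_fun_neg, tsupport]
    rw [e]
    exact (tsupport_fderiv_apply_subset ℝ (bv k)).trans (hts.subset.trans
      (Metric.closedBall_subset_ball (by norm_num)))
  · have := hparts (fun _ => 1) k (differentiable_const _) (by simp [continuous_const])
    simpa using this
  · have e : ∀ y, fderiv ℝ (fun y : Evec n => y j) y (bv k) = if j = k then 1 else 0 := fun y => by
      have : (fun y : Evec n => y j) = (EuclideanSpace.proj (𝕜 := ℝ) j : Evec n →L[ℝ] ℝ) := rfl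
      rw [this, ContinuousLinearMap.fderiv]
      simp [bv]
    have := hparts (fun y => y j) k (by fun_prop) (by simp only [e]; exact continuous_const)
    rw [this]
    simp only [e]
    rw [integral_const_mul, f.integral_normed, mul_one]

lemma integrable_mul_of_tsupport_subset {φ g : Evec n → ℝ} (hφ : Continuous φ)
    (hs : HasCompactSupport φ) {U : Set (Evec n)} (hU : IsOpen U) (hsub : tsupport φ ⊆ U)
    (hg : ContinuousOn g U) : Integrable fun y => g y * φ y := by
  refine Continuous.integrable_of_hasCompactSupport (continuous_of_tsupport fun x hx => ?_)
    hs.mul_left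
  have hx' : x ∈ U := hsub (closure_mono (Function.support_mul_subset_right _ _) hx)
  exact (hg.continuousAt (hU.mem_nhds hx')).mul hφ.continuousAt

/-- The strain along the segment from `y` to `x`. -/
def strainE (v : Evec n → Evec n) (x y : Evec n) : ℝ := inner ℝ (v x - v y) (x - y)

lemma strain_moment_eq {φ : Fin n → Evec n → ℝ} (hc : ∀ k, Continuous (φ k))
    (hs : ∀ k, HasCompactSupport (φ k)) (hsub : ∀ k, tsupport (φ k) ⊆ Metric.ball 0 1)
    (h0 : ∀ k, ∫ y, φ k y = 0) (h1 : ∀ j k, ∫ y, y j * φ k y = if j = k then 1 else 0)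
    {v : Evec n → Evec n} (hv : ContinuousOn v (Metric.ball 0 2)) (x : Evec n) (k : Fin n) :
    ∫ y, strainE v x y * φ k y = (∫ y, inner ℝ (v y) y * φ k y) -
      ∑ j, x j * (∫ y, v y j * φ k y) - v x k := by
  have hball : Metric.ball (0 : Evec n) 1 ⊆ Metric.ball 0 2 :=
    Metric.ball_subset_ball (by norm_num)
  have hvj : ∀ j, ContinuousOn (fun y => v y j) (Metric.ball 0 2) := fun j =>
    (EuclideanSpace.proj (𝕜 := ℝ) j).continuous.comp_continuousOn hv
  have hI : ∀ g : Evec n → ℝ, ContinuousOn g (Metric.ball 0 2) → Integrable fun y => g y * φ k y :=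
    fun g hg => integrable_mul_of_tsupport_subset (hc k) (hs k) Metric.isOpen_ball
      ((hsub k).trans hball) hg
  have hIy : ∀ j, Integrable fun y : Evec n => y j * φ k y := fun j =>
    hI _ (by fun_prop)
  have hin : ContinuousOn (fun y => inner ℝ (v y) y) (Metric.ball 0 2) := hv.inner continuousOn_id
  have e : ∀ y, strainE v x y * φ k y = inner ℝ (v x) x * φ k y - ∑ j, v x j * (y j * φ k y) -
      ∑ j, x j * (v y j * φ k y) + inner ℝ (v y) y * φ k y := by
    intro y
    have e1 : inner ℝ (v x) y = ∑ j, v x j * y j := by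
      rw [PiLp.inner_apply]; exact Finset.sum_congr rfl fun j _ => by simp [mul_comm]
    have e2 : inner ℝ (v y) x = ∑ j, x j * v y j := by
      rw [PiLp.inner_apply]; exact Finset.sum_congr rfl fun j _ => by simp
    rw [strainE, inner_sub_left, inner_sub_right, inner_sub_right, e1, e2]
    simp only [← mul_assoc, ← Finset.sum_mul]
    ring
  simp only [e]
  have i0 : Integrable fun y => inner ℝ (v x) x * φ k y := hI _ continuousOn_const
  have i1 : Integrable fun y => ∑ j, v x j * (y j * φ k y) :=
    integrable_finsetSum _ fun j _ => (hIy j).const_mul _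
  have i2 : Integrable fun y => ∑ j, x j * (v y j * φ k y) :=
    integrable_finsetSum _ fun j _ => (hI _ (hvj j)).const_mul _
  have i01 : Integrable fun y => inner ℝ (v x) x * φ k y - ∑ j, v x j * (y j * φ k y) := i0.sub i1
  have i012 : Integrable fun y => inner ℝ (v x) x * φ k y - ∑ j, v x j * (y j * φ k y) -
      ∑ j, x j * (v y j * φ k y) := i01.sub i2
  rw [integral_add i012 (hI _ hin), integral_sub i01 i2, integral_sub i0 i1,
    integral_const_mul, h0 k, integral_finsetSum _ fun j _ => (hIy j).const_mul _,
    integral_finsetSum _ fun j _ => (hI _ (hvj j)).const_mul _]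
  simp only [integral_const_mul, h1]
  simp
  ring

/-- The local representation of a vector field by its strain, up to a rigid motion. -/
lemma sub_rigid_eq {φ : Fin n → Evec n → ℝ} (hc : ∀ k, Continuous (φ k))
    (hs : ∀ k, HasCompactSupport (φ k)) (hsub : ∀ k, tsupport (φ k) ⊆ Metric.ball 0 1)
    (h0 : ∀ k, ∫ y, φ k y = 0) (h1 : ∀ j k, ∫ y, y j * φ k y = if j = k then 1 else 0)
    {v : Evec n → Evec n} (hv : ContinuousOn v (Metric.ball 0 2)) (x : Evec n) (k : Fin n) :
    v x k - ((∫ y, inner ℝ (v y) y * φ k y) -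
      ∑ j, x j * (((∫ y, v y j * φ k y) - ∫ y, v y k * φ j y) / 2)) =
    (∑ j, x j * (∫ z, (∫ y, strainE v z y * φ j y) * φ k z)) / 2 -
      ∫ y, strainE v x y * φ k y := by
  have hball : Metric.ball (0 : Evec n) 1 ⊆ Metric.ball 0 2 :=
    Metric.ball_subset_ball (by norm_num)
  have hvj : ∀ j, ContinuousOn (fun y => v y j) (Metric.ball 0 2) := fun j =>
    (EuclideanSpace.proj (𝕜 := ℝ) j).continuous.comp_continuousOn hv
  have hI : ∀ k, ∀ g : Evec n → ℝ, ContinuousOn g (Metric.ball 0 2) →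
      Integrable fun y => g y * φ k y :=
    fun k g hg => integrable_mul_of_tsupport_subset (hc k) (hs k) Metric.isOpen_ball
      ((hsub k).trans hball) hg
  have hsym : ∀ j, ∫ z, (∫ y, strainE v z y * φ j y) * φ k z =
      -((∫ y, v y j * φ k y) + ∫ y, v y k * φ j y) := by
    intro j
    have e : ∀ z, (∫ y, strainE v z y * φ j y) * φ k z =
        (∫ y, inner ℝ (v y) y * φ j y) * φ k z -
          ∑ l, (∫ y, v y l * φ j y) * (z l * φ k z) - v z j * φ k z := by
      intro z
      rw [strain_moment_eq hc hs hsub h0 h1 hv, sub_mul, sub_mul, Finset.sum_mul]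
      congr 2
      exact Finset.sum_congr rfl fun l _ => by ring
    have hIy : ∀ j, Integrable fun y : Evec n => y j * φ k y := fun j =>
      hI k _ (by fun_prop)
    have i0 : Integrable fun y => (∫ y, inner ℝ (v y) y * φ j y) * φ k y :=
        hI k _ continuousOn_const
    have i1 : Integrable fun z => ∑ l, (∫ y, v y l * φ j y) * (z l * φ k z) :=
      integrable_finsetSum _ fun j _ => (hIy j).const_mul _
    simp only [e]
    have i01 : Integrable fun z => (∫ y, inner ℝ (v y) y * φ j y) * φ k z -
        ∑ l, (∫ y, v y l * φ j y) * (z l * φ k z) := i0.sub i1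
    rw [integral_sub i01 (hI k _ (hvj j)), integral_sub i0 i1, integral_const_mul, h0 k,
      integral_finsetSum _ fun j _ => (hIy j).const_mul _]
    simp only [integral_const_mul, h1]
    simp
    ring
  simp only [hsym]
  rw [strain_moment_eq hc hs hsub h0 h1 hv]
  have : ∑ j, x j * (∫ y, v y j * φ k y) = ∑ j, x j * (((∫ y, v y j * φ k y) -
      ∫ y, v y k * φ j y) / 2) - (∑ j, x j * -((∫ y, v y j * φ k y) + ∫ y, v y k * φ j y)) / 2 := by
    rw [Finset.sum_div, ← Finset.sum_sub_distrib]
    exact Finset.sum_congr rfl fun j _ => by ring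
  rw [this]; ring

end localRepresentation

section strainIntegral

variable {n : ℕ}

lemma lintegral_comp_add_smul (g : Evec n → ℝ≥0∞) (a : Evec n) {t : ℝ} (ht : t ≠ 0) :
    ∫⁻ x, g (a + t • x) = ENNReal.ofReal |(t ^ n)⁻¹| * ∫⁻ x, g x := by
  rw [lintegral_comp_smul' (fun x => g (a + x)) ht, lintegral_add_left_eq_self]

lemma ofReal_abs_inv_pow_le {t : ℝ} (ht : 1 / 2 ≤ t) :
    ENNReal.ofReal |(t ^ n)⁻¹| ≤ 2 ^ n := by
  rw [abs_of_pos (by positivity), ← inv_pow]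
  have : ENNReal.ofReal (2 ^ n) = 2 ^ n := by
    rw [ENNReal.ofReal_pow (by norm_num)]; simp
  rw [← this]
  refine ENNReal.ofReal_le_ofReal (pow_le_pow_left₀ (by positivity) ?_ n)
  rw [inv_le_comm₀ (by linarith) (by norm_num)]; linarith

lemma lintegral_segment_le {g : Evec n → ℝ≥0∞} (hg : Measurable g) (B : Set (Evec n)) (t : ℝ) :
    ∫⁻ x in B, ∫⁻ y in B, g (y + t • (x - y)) ≤ volume B * 2 ^ n * ∫⁻ x, g x := by
  have key : ∀ s : ℝ, 1 / 2 ≤ s → ∀ f : Evec n → Evec n,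
      ∫⁻ x in B, ∫⁻ y in B, g (f x + s • y) ≤ volume B * 2 ^ n * ∫⁻ x, g x := by
    intro s hs f
    calc _ ≤ ∫⁻ x in B, 2 ^ n * ∫⁻ y, g y := by
          refine lintegral_mono fun x => (setLIntegral_le_lintegral _ _).trans ?_
          rw [lintegral_comp_add_smul g _ (by linarith)]
          gcongr
          exact ofReal_abs_inv_pow_le hs
      _ = _ := by rw [lintegral_const, Measure.restrict_apply_univ]; ring
  rcases le_total (1 / 2) t with h | h
  · rw [lintegral_lintegral_swap (by
      exact (hg.comp (by fun_prop :
        Measurable fun z : Evec n × Evec n => z.2 + t • (z.1 - z.2))).aemeasurable)]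
    refine le_of_eq_of_le ?_ (key t h fun y => y - t • y)
    exact lintegral_congr fun y => lintegral_congr fun x => by congr 1; module
  · refine le_of_eq_of_le ?_ (key (1 - t) (by linarith) fun x => t • x)
    exact lintegral_congr fun x => lintegral_congr fun y => by congr 1; module

lemma lintegral_strainE_le {p : ℝ} (hp : 1 ≤ p) {v : Evec n → Evec n}
    (hd : ∀ x ∈ Metric.ball (0 : Evec n) 2, DifferentiableAt ℝ v x) :
    ∫⁻ x in Metric.ball 0 2, ∫⁻ y in Metric.ball 0 1, ENNReal.ofReal |strainE v x y| ^ p ≤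
      ENNReal.ofReal 16 ^ p * (volume (Metric.ball (0 : Evec n) 2) * 2 ^ n) *
        ∫⁻ x in Metric.ball 0 2, ENNReal.ofReal (epsLen v x) ^ p := by
  have hp0 : 0 ≤ p := by linarith
  set B := Metric.ball (0 : Evec n) 2 with hB
  have hBm : MeasurableSet B := Metric.isOpen_ball.measurableSet
  set g : Evec n → ℝ≥0∞ := B.indicator fun x => ENNReal.ofReal (epsLen v x) ^ p with hgdef
  have hg : Measurable g := ((measurable_epsLen v).ennreal_ofReal.pow_const p).indicator hBm
  have h16 : ENNReal.ofReal 16 ^ p ≠ ⊤ := ENNReal.rpow_ne_top_of_nonneg hp0 ENNReal.ofReal_ne_top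
  have hpt : ∀ x ∈ B, ∀ y ∈ B, ENNReal.ofReal |strainE v x y| ^ p ≤
      ENNReal.ofReal 16 ^ p * ∫⁻ t in Icc (0 : ℝ) 1, g (y + t • (x - y)) := by
    intro x hx y hy
    have hmem : ∀ t ∈ Icc (0 : ℝ) 1, y + t • (x - y) ∈ B := fun t ht =>
      (convex_ball (0 : Evec n) 2).add_smul_sub_mem hy hx ht
    refine (ofReal_abs_inner_segment_rpow_le hp fun t ht => hd _ (hmem t ht)).trans ?_
    refine mul_le_mul' (ENNReal.rpow_le_rpow (ENNReal.ofReal_le_ofReal ?_) hp0) ?_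
    · have h1 : ‖x - y‖ ≤ 4 := by
        have := norm_sub_le x y
        rw [hB, mem_ball_zero_iff] at hx hy
        linarith
      nlinarith [norm_nonneg (x - y)]
    · refine setLIntegral_mono' measurableSet_Icc fun t ht => ?_
      rw [hgdef, indicator_of_mem (hmem t ht)]
  calc _ ≤ ∫⁻ x in B, ∫⁻ y in B, ENNReal.ofReal |strainE v x y| ^ p := by
        refine lintegral_mono fun x => lintegral_mono_set (Metric.ball_subset_ball (by norm_num))
    _ ≤ ∫⁻ x in B, ∫⁻ y in B, ENNReal.ofReal 16 ^ p *
          ∫⁻ t in Icc (0 : ℝ) 1, g (y + t • (x - y)) :=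
        setLIntegral_mono' hBm fun x hx => setLIntegral_mono' hBm fun y hy => hpt x hx y hy
    _ = ENNReal.ofReal 16 ^ p * ∫⁻ t in Icc (0 : ℝ) 1, ∫⁻ x in B, ∫⁻ y in B,
          g (y + t • (x - y)) := by
        simp_rw [lintegral_const_mul' _ _ h16]
        congr 1
        have hm : Measurable fun z : (Evec n × ℝ) × Evec n => g (z.2 + z.1.2 • (z.1.1 - z.2)) :=
          hg.comp (by fun_prop)
        calc _ = ∫⁻ x in B, ∫⁻ t in Icc (0 : ℝ) 1, ∫⁻ y in B, g (y + t • (x - y)) := by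
              refine lintegral_congr fun x => ?_
              rw [lintegral_lintegral_swap]
              exact (hg.comp (by fun_prop :
                Measurable fun z : Evec n × ℝ => z.1 + z.2 • (x - z.1))).aemeasurable
          _ = _ := by
              rw [lintegral_lintegral_swap]
              exact hm.lintegral_prod_right'.aemeasurable
    _ ≤ ENNReal.ofReal 16 ^ p * ∫⁻ t in Icc (0 : ℝ) 1, volume B * 2 ^ n * ∫⁻ x, g x := by
        gcongr with t
        exact lintegral_segment_le hg B t
    _ = _ := by
        rw [lintegral_const, Measure.restrict_apply_univ, Real.volume_Icc, sub_zero,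
          ENNReal.ofReal_one, mul_one, hgdef, lintegral_indicator hBm, mul_assoc
              (ENNReal.ofReal 16 ^ p)]

lemma ofReal_abs_integral_mul_le {φ g : Evec n → ℝ} {Φ : ℝ} (hΦ : ∀ y, |φ y| ≤ Φ)
    (hsub : tsupport φ ⊆ Metric.ball 0 1) :
    ENNReal.ofReal |∫ y, g y * φ y| ≤
      ENNReal.ofReal Φ * ∫⁻ y in Metric.ball 0 1, ENNReal.ofReal |g y| := by
  have h1 : ∫ y, g y * φ y = ∫ y in Metric.ball 0 1, g y * φ y := by
    rw [setIntegral_eq_integral_of_forall_compl_eq_zero]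
    intro y hy
    rw [image_eq_zero_of_notMem_tsupport fun h => hy (hsub h), mul_zero]
  rw [h1, ← lintegral_const_mul' _ _ ENNReal.ofReal_ne_top]
  have h2 := enorm_integral_le_lintegral_enorm (μ := volume.restrict (Metric.ball (0 : Evec n) 1))
    fun y => g y * φ y
  rw [Real.enorm_eq_ofReal_abs] at h2
  refine h2.trans (lintegral_mono fun y => ?_)
  rw [Real.enorm_eq_ofReal_abs, abs_mul, mul_comm,
    ← ENNReal.ofReal_mul ((abs_nonneg _).trans (hΦ y))]
  exact ENNReal.ofReal_le_ofReal (mul_le_mul_of_nonneg_right (hΦ y) (abs_nonneg _))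

/-- The linear map with prescribed matrix entries. -/
def entryCLM (a : Fin n → Fin n → ℝ) : Evec n →L[ℝ] Evec n :=
  ∑ j, ∑ k, a j k • (EuclideanSpace.proj (𝕜 := ℝ) j : Evec n →L[ℝ] ℝ).smulRight (bv k)

lemma entryCLM_apply (a : Fin n → Fin n → ℝ) (x : Evec n) (i : Fin n) :
    entryCLM a x i = ∑ j, x j * a j i := by
  simp only [entryCLM, sum_apply, smul_apply,
    ContinuousLinearMap.smulRight_apply, bv, PiLp.proj_apply, WithLp.ofLp_sum, Finset.sum_apply,
    PiLp.smul_apply, smul_eq_mul]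
  refine Finset.sum_congr rfl fun j _ => ?_
  simp [mul_comm]

lemma norm_entryCLM_le (a : Fin n → Fin n → ℝ) : ‖entryCLM a‖ ≤ ∑ j, ∑ k, |a j k| := by
  refine (norm_sum_le _ _).trans (Finset.sum_le_sum fun j _ => (norm_sum_le _ _).trans
    (Finset.sum_le_sum fun k _ => ?_))
  rw [norm_smul, Real.norm_eq_abs]
  refine mul_le_of_le_one_right (abs_nonneg _) ?_
  refine ContinuousLinearMap.opNorm_le_bound _ zero_le_one fun x => ?_
  rw [ContinuousLinearMap.smulRight_apply, norm_smul, one_mul]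
  simp only [bv, PiLp.norm_single, norm_one, mul_one]
  exact PiLp.norm_apply_le x j

lemma norm_le_sum_abs (x : Evec n) : ‖x‖ ≤ ∑ i, |x i| := by
  rw [EuclideanSpace.norm_eq]
  refine Real.sqrt_le_iff.2 ⟨Finset.sum_nonneg fun i _ => abs_nonneg _, ?_⟩
  exact Finset.sum_sq_le_sq_sum_of_nonneg fun j _ => abs_nonneg _

lemma ofReal_norm_le_sum_abs (x : Evec n) :
    ENNReal.ofReal ‖x‖ ≤ ∑ i, ENNReal.ofReal |x i| := by
  rw [← ENNReal.ofReal_sum_of_nonneg fun _ _ => abs_nonneg _]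
  exact ENNReal.ofReal_le_ofReal (norm_le_sum_abs x)

/-- Approximation of a vector field by a rigid motion on a ball, in terms of its strain. -/
theorem exists_rigid_approx (n : ℕ) {p : ℝ} (hp : 1 ≤ p) : ∃ K : ℝ≥0∞, K ≠ ⊤ ∧
    ∀ v : Evec n → Evec n, (∀ x ∈ Metric.ball (0 : Evec n) 2, DifferentiableAt ℝ v x) →
      ∃ (c : Evec n) (L : Evec n →L[ℝ] Evec n), (∀ i j, L (bv i) j = -L (bv j) i) ∧
        ENNReal.ofReal ‖L‖ ^ p ≤ K * ∫⁻ x in Metric.ball 0 2, ENNReal.ofReal ‖v x‖ ^ p ∧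
        ∫⁻ x in Metric.ball 0 2, ENNReal.ofReal ‖v x - (c + L x)‖ ^ p ≤
          K * ∫⁻ x in Metric.ball 0 2, ENNReal.ofReal (epsLen v x) ^ p := by
  have hp0 : 0 ≤ p := by linarith
  have htop : ∀ a : ℝ≥0∞, a ≠ ⊤ → a ^ p ≠ ⊤ := fun a ha => ENNReal.rpow_ne_top_of_nonneg hp0 ha
  have htop1 : ∀ a : ℝ≥0∞, a ≠ ⊤ → a ^ (p - 1) ≠ ⊤ := fun a ha =>
    ENNReal.rpow_ne_top_of_nonneg (by linarith) ha
  obtain ⟨φ, hc, hs, hsub, h0, h1⟩ := exists_moment_functions n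
  obtain ⟨Φ, hΦ⟩ : ∃ Φ : ℝ, ∀ k y, |φ k y| ≤ Φ := by
    choose B hB using fun k => (hs k).exists_bound_of_continuous (hc k)
    refine ⟨∑ k, |B k|, fun k y => ?_⟩
    exact ((hB k y).trans (le_abs_self _)).trans
      (Finset.single_le_sum (f := fun k => |B k|) (fun _ _ => abs_nonneg _) (Finset.mem_univ k))
  set B₁ := Metric.ball (0 : Evec n) 1 with hB₁
  set B₂ := Metric.ball (0 : Evec n) 2 with hB₂
  have hV1 : volume B₁ ≠ ⊤ := measure_ball_lt_top.ne
  have hV2 : volume B₂ ≠ ⊤ := measure_ball_lt_top.ne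
  have hB12 : B₁ ⊆ B₂ := Metric.ball_subset_ball (by norm_num)
  set F : ℝ≥0∞ := ENNReal.ofReal Φ
  have hF : F ≠ ⊤ := ENNReal.ofReal_ne_top
  set G : ℝ → ℝ≥0∞ := fun q => ENNReal.ofReal 16 ^ q * (volume B₂ * 2 ^ n) with hG
  have hGt : ∀ q, 0 ≤ q → G q ≠ ⊤ := fun q hq => ENNReal.mul_ne_top
    (ENNReal.rpow_ne_top_of_nonneg hq ENNReal.ofReal_ne_top)
    (ENNReal.mul_ne_top hV2 (by simp))
  set K₁ : ℝ≥0∞ := (n * n * F) ^ p * volume B₁ ^ (p - 1) with hK₁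
  have hK₁t : K₁ ≠ ⊤ := ENNReal.mul_ne_top
    (htop _ (ENNReal.mul_ne_top (ENNReal.mul_ne_top (by simp) (by simp)) hF)) (htop1 _ hV1)
  set K₂ : ℝ≥0∞ := 2 ^ (p - 1) * ((n * F) ^ p * (volume B₁ ^ (p - 1) * G p) +
    volume B₂ * ((n * n * F * F) ^ p * (G 1 ^ p * volume B₂ ^ (p - 1)))) with hK₂
  have hK₂t : K₂ ≠ ⊤ := by
    refine ENNReal.mul_ne_top (htop1 _ (by simp)) (ENNReal.add_ne_top.2 ⟨?_, ?_⟩)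
    · exact ENNReal.mul_ne_top (htop _ (ENNReal.mul_ne_top (by simp) hF))
        (ENNReal.mul_ne_top (htop1 _ hV1) (hGt p hp0))
    · refine ENNReal.mul_ne_top hV2 (ENNReal.mul_ne_top (htop _ ?_) (ENNReal.mul_ne_top
        (htop _ (hGt 1 zero_le_one)) (htop1 _ hV2)))
      exact ENNReal.mul_ne_top (ENNReal.mul_ne_top (ENNReal.mul_ne_top (by simp) (by simp)) hF) hF
  refine ⟨K₁ + K₂, ENNReal.add_ne_top.2 ⟨hK₁t, hK₂t⟩, fun v hd => ?_⟩
  have hv : ContinuousOn v B₂ := fun x hx => (hd x hx).continuousAt.continuousWithinAt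
  have hB₁m : MeasurableSet B₁ := Metric.isOpen_ball.measurableSet
  have hB₂m : MeasurableSet B₂ := Metric.isOpen_ball.measurableSet
  set M : Fin n → Fin n → ℝ := fun j k => ∫ y, v y j * φ k y with hM
  set L := entryCLM fun j k => -((M j k - M k j) / 2) with hL
  refine ⟨WithLp.toLp 2 fun k => ∫ y, inner ℝ (v y) y * φ k y, L, fun i j => ?_, ?_, ?_⟩
  · simp only [hL, entryCLM_apply, bv]
    simp
    ring
  · have hMle : ∀ j k, ENNReal.ofReal |M j k| ≤ F * ∫⁻ y in B₁, ENNReal.ofReal ‖v y‖ := fun j k =>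
        by
      refine (ofReal_abs_integral_mul_le (hΦ k) (hsub k)).trans ?_
      gcongr with y
      exact PiLp.norm_apply_le (v y) j
    have hLle : ENNReal.ofReal ‖L‖ ≤ n * n * F * ∫⁻ y in B₁, ENNReal.ofReal ‖v y‖ := by
      refine (ENNReal.ofReal_le_ofReal (norm_entryCLM_le _)).trans ?_
      rw [ENNReal.ofReal_sum_of_nonneg fun _ _ => Finset.sum_nonneg fun _ _ => abs_nonneg _]
      have : ∀ j, ENNReal.ofReal (∑ k, |-((M j k - M k j) / 2)|) ≤
          n * (F * ∫⁻ y in B₁, ENNReal.ofReal ‖v y‖) := by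
        intro j
        rw [ENNReal.ofReal_sum_of_nonneg fun _ _ => abs_nonneg _]
        refine (Finset.sum_le_card_nsmul _ _ (F * ∫⁻ y in B₁, ENNReal.ofReal ‖v y‖)
          fun k _ => ?_).trans (le_of_eq (by simp))
        have h2 : |-((M j k - M k j) / 2)| ≤ max |M j k| |M k j| := by
          rw [abs_neg, abs_div, abs_two]
          have := abs_sub (M j k) (M k j)
          linarith [le_max_left |M j k| |M k j|, le_max_right |M j k| |M k j|]
        refine (ENNReal.ofReal_le_ofReal h2).trans ?_
        rcases max_choice |M j k| |M k j| with h | h <;> rw [h] <;> exact hMle _ _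
      refine (Finset.sum_le_card_nsmul _ _ _ fun j _ => this j).trans (le_of_eq ?_)
      simp [mul_assoc]
    calc ENNReal.ofReal ‖L‖ ^ p ≤ (n * n * F * ∫⁻ y in B₁, ENNReal.ofReal ‖v y‖) ^ p :=
          ENNReal.rpow_le_rpow hLle hp0
      _ = (n * n * F) ^ p * (∫⁻ y in B₁, ENNReal.ofReal ‖v y‖) ^ p :=
          ENNReal.mul_rpow_of_nonneg _ _ hp0
      _ ≤ (n * n * F) ^ p * (volume B₁ ^ (p - 1) * ∫⁻ y in B₁, ENNReal.ofReal ‖v y‖ ^ p) := by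
          gcongr
          exact setLIntegral_rpow_le hp _
            (((hv.mono hB12).norm.aemeasurable hB₁m).ennreal_ofReal)
      _ ≤ (n * n * F) ^ p * (volume B₁ ^ (p - 1) * ∫⁻ y in B₂, ENNReal.ofReal ‖v y‖ ^ p) := by
          gcongr
      _ ≤ (K₁ + K₂) * ∫⁻ y in B₂, ENNReal.ofReal ‖v y‖ ^ p := by
          rw [← mul_assoc]; gcongr; exact le_self_add
  · set τ : Evec n → ℝ≥0∞ := fun x => ∫⁻ y in B₁, ENNReal.ofReal |strainE v x y| with hτ
    set T : Fin n → Evec n → ℝ := fun k x => ∫ y, strainE v x y * φ k y with hT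
    have hTle : ∀ k x, ENNReal.ofReal |T k x| ≤ F * τ x := fun k x =>
      ofReal_abs_integral_mul_le (hΦ k) (hsub k)
    set I := ∫⁻ z in B₁, τ z with hI
    have hTT : ∀ j k, ENNReal.ofReal |∫ z, T j z * φ k z| ≤ F * (F * I) := fun j k => by
      refine (ofReal_abs_integral_mul_le (hΦ k) (hsub k)).trans ?_
      gcongr
      rw [hI, ← lintegral_const_mul' _ _ hF]
      exact lintegral_mono fun z => hTle j z
    have hpt : ∀ x ∈ B₂, ENNReal.ofReal ‖v x - ((WithLp.toLp 2 fun k =>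
        ∫ y, inner ℝ (v y) y * φ k y) + L x)‖ ≤ n * F * τ x + n * n * F * F * I := by
      intro x hx
      refine (ofReal_norm_le_sum_abs _).trans ?_
      have : ∀ k, ENNReal.ofReal |(v x - ((WithLp.toLp 2 fun k =>
          ∫ y, inner ℝ (v y) y * φ k y) + L x)) k| ≤ F * τ x + n * (F * (F * I)) := by
        intro k
        have e := sub_rigid_eq hc hs hsub h0 h1 hv x k
        have e2 : (v x - ((WithLp.toLp 2 fun k => ∫ y, inner ℝ (v y) y * φ k y) + L x)) k =
            (∑ j, x j * (∫ z, T j z * φ k z)) / 2 - T k x := by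
          rw [← e]
          simp only [PiLp.sub_apply, PiLp.add_apply, hL, entryCLM_apply, hM, mul_neg,
            Finset.sum_neg_distrib]
          ring
        have h3 : |(∑ j, x j * (∫ z, T j z * φ k z)) / 2 - T k x| ≤
            |T k x| + ∑ j, |∫ z, T j z * φ k z| := by
          refine (abs_sub _ _).trans ?_
          rw [add_comm]
          gcongr
          rw [abs_div, abs_two, div_le_iff₀ two_pos, Finset.sum_mul]
          refine (Finset.abs_sum_le_sum_abs _ _).trans (Finset.sum_le_sum fun j _ => ?_)
          rw [abs_mul, mul_comm]
          gcongr
          exact (PiLp.norm_apply_le x j).trans (mem_ball_zero_iff.1 hx).le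
        rw [e2]
        refine (ENNReal.ofReal_le_ofReal h3).trans ?_
        rw [ENNReal.ofReal_add (abs_nonneg _) (Finset.sum_nonneg fun _ _ => abs_nonneg _),
          ENNReal.ofReal_sum_of_nonneg fun _ _ => abs_nonneg _]
        refine add_le_add (hTle k x) ?_
        exact (Finset.sum_le_card_nsmul _ _ _ fun j _ => hTT j k).trans (le_of_eq (by simp))
      refine (Finset.sum_le_card_nsmul _ _ _ fun k _ => this k).trans (le_of_eq ?_)
      simp only [Finset.card_univ, Fintype.card_fin, nsmul_eq_mul]
      ring
    set E := ∫⁻ x in B₂, ENNReal.ofReal (epsLen v x) ^ p with hE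
    have hτp : ∫⁻ x in B₂, τ x ^ p ≤ volume B₁ ^ (p - 1) * (G p * E) := by
      calc _ ≤ ∫⁻ x in B₂, volume B₁ ^ (p - 1) *
            ∫⁻ y in B₁, ENNReal.ofReal |strainE v x y| ^ p := by
            refine setLIntegral_mono' hB₂m fun x _ => setLIntegral_rpow_le hp _ ?_
            have : ContinuousOn (fun y => |strainE v x y|) B₁ :=
              ((continuousOn_const.sub (hv.mono hB12)).inner
                (continuousOn_const.sub continuousOn_id)).abs
            exact (this.aemeasurable hB₁m).ennreal_ofReal
        _ = volume B₁ ^ (p - 1) * ∫⁻ x in B₂, ∫⁻ y in B₁, ENNReal.ofReal |strainE v x y| ^ p :=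
            lintegral_const_mul' _ _ (htop1 _ hV1)
        _ ≤ _ := by gcongr; exact lintegral_strainE_le hp hd
    have hIp : I ^ p ≤ G 1 ^ p * (volume B₂ ^ (p - 1) * E) := by
      have h4 : I ≤ G 1 * ∫⁻ x in B₂, ENNReal.ofReal (epsLen v x) := by
        have := lintegral_strainE_le le_rfl hd
        simp only [ENNReal.rpow_one] at this
        refine (lintegral_mono_set hB12).trans (this.trans (le_of_eq ?_))
        simp only [hG, ENNReal.rpow_one]; rfl
      calc I ^ p ≤ (G 1 * ∫⁻ x in B₂, ENNReal.ofReal (epsLen v x)) ^ p :=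
            ENNReal.rpow_le_rpow h4 hp0
        _ = G 1 ^ p * (∫⁻ x in B₂, ENNReal.ofReal (epsLen v x)) ^ p :=
            ENNReal.mul_rpow_of_nonneg _ _ hp0
        _ ≤ _ := by
            gcongr
            exact setLIntegral_rpow_le hp _ (measurable_epsLen v).ennreal_ofReal.aemeasurable
    calc _ ≤ ∫⁻ x in B₂, 2 ^ (p - 1) * ((n * F) ^ p * τ x ^ p +
          (n * n * F * F) ^ p * I ^ p) := by
          refine setLIntegral_mono' hB₂m fun x hx =>
            (ENNReal.rpow_le_rpow (hpt x hx) hp0).trans ?_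
          rw [← ENNReal.mul_rpow_of_nonneg _ _ hp0, ← ENNReal.mul_rpow_of_nonneg _ _ hp0]
          exact ENNReal.rpow_add_le_mul_rpow_add_rpow _ _ hp
      _ = 2 ^ (p - 1) * ((n * F) ^ p * (∫⁻ x in B₂, τ x ^ p) +
          volume B₂ * ((n * n * F * F) ^ p * I ^ p)) := by
          rw [lintegral_const_mul' _ _ (htop1 _ (by simp)), lintegral_add_right _ measurable_const,
            lintegral_const_mul' _ _ (htop _ (ENNReal.mul_ne_top (by simp) hF)), lintegral_const,
            Measure.restrict_apply_univ, mul_comm (volume B₂)]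
      _ ≤ 2 ^ (p - 1) * ((n * F) ^ p * (volume B₁ ^ (p - 1) * (G p * E)) +
          volume B₂ * ((n * n * F * F) ^ p * (G 1 ^ p * (volume B₂ ^ (p - 1) * E)))) := by
          gcongr
      _ = K₂ * E := by rw [hK₂]; ring
      _ ≤ (K₁ + K₂) * E := by gcongr; exact le_add_self

end strainIntegral

section localKorn

variable {n : ℕ}

lemma abs_pder_le_DvLen (v : Evec n → Evec n) (i j : Fin n) (x : Evec n) :
    |pder v i j x| ≤ DvLen v x := by
  refine Real.abs_le_sqrt (le_trans ?_ (Finset.single_le_sum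
    (f := fun i => ∑ j, pder v i j x ^ 2) (fun i _ => Finset.sum_nonneg fun j _ => sq_nonneg _)
    (Finset.mem_univ i)))
  exact Finset.single_le_sum (f := fun j => pder v i j x ^ 2) (fun _ _ => sq_nonneg _)
    (Finset.mem_univ j)

lemma abs_sym_pder_le_epsLen (v : Evec n → Evec n) (i j : Fin n) (x : Evec n) :
    |(pder v i j x + pder v j i x) / 2| ≤ epsLen v x := by
  refine Real.abs_le_sqrt (le_trans ?_ (Finset.single_le_sum
    (f := fun i => ∑ j, ((pder v i j x + pder v j i x) / 2) ^ 2)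
    (fun i _ => Finset.sum_nonneg fun j _ => sq_nonneg _) (Finset.mem_univ i)))
  exact Finset.single_le_sum (f := fun j => ((pder v i j x + pder v j i x) / 2) ^ 2)
    (fun _ _ => sq_nonneg _) (Finset.mem_univ j)

lemma epsLen_le_sum (v : Evec n → Evec n) (x : Evec n) :
    epsLen v x ≤ ∑ i, ∑ j, |(pder v i j x + pder v j i x) / 2| := by
  have hn : ∀ i, 0 ≤ ∑ j, |(pder v i j x + pder v j i x) / 2| :=
    fun i => Finset.sum_nonneg fun j _ => abs_nonneg _
  refine Real.sqrt_le_iff.2 ⟨Finset.sum_nonneg fun i _ => hn i, ?_⟩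
  refine le_trans (Finset.sum_le_sum fun i _ => ?_)
    (Finset.sum_sq_le_sq_sum_of_nonneg fun i _ => hn i)
  refine le_trans (le_of_eq ?_) (Finset.sum_sq_le_sq_sum_of_nonneg fun j _ => abs_nonneg _)
  exact Finset.sum_congr rfl fun j _ => (sq_abs _).symm

lemma norm_fderiv_le_DvLen (v : Evec n → Evec n) (x : Evec n) :
    ‖fderiv ℝ v x‖ ≤ (n * n : ℝ) * DvLen v x := by
  refine ContinuousLinearMap.opNorm_le_bound _ (mul_nonneg (by positivity) (DvLen_nonneg v x))
    fun h => ?_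
  refine (norm_le_sum_abs _).trans ?_
  have : ∀ i, |fderiv ℝ v x h i| ≤ n * (‖h‖ * DvLen v x) := by
    intro i
    rw [fderiv_apply_coord]
    refine (Finset.abs_sum_le_sum_abs _ _).trans ?_
    refine (Finset.sum_le_card_nsmul _ _ (‖h‖ * DvLen v x) fun j _ => ?_).trans_eq (by simp)
    rw [abs_mul]
    exact mul_le_mul (PiLp.norm_apply_le h j) (abs_pder_le_DvLen v i j x) (abs_nonneg _)
      (norm_nonneg _)
  refine (Finset.sum_le_card_nsmul _ _ _ fun i _ => this i).trans_eq ?_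
  simp; ring

lemma DvLen_le_norm_fderiv (v : Evec n → Evec n) (x : Evec n) :
    DvLen v x ≤ (n * n : ℝ) * ‖fderiv ℝ v x‖ := by
  refine (DvLen_le_sum v x).trans ?_
  have : ∀ i j, |pder v i j x| ≤ ‖fderiv ℝ v x‖ := by
    intro i j
    refine (PiLp.norm_apply_le (fderiv ℝ v x (EuclideanSpace.single j 1)) i).trans ?_
    refine (ContinuousLinearMap.le_opNorm _ _).trans_eq ?_
    simp
  refine (Finset.sum_le_sum fun i _ => (Finset.sum_le_card_nsmul _ _ _ fun j _ =>
      this i j)).trans_eq ?_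
  simp; ring

/-- Local Korn inequality on the unit ball, up to an infinitesimal rotation. -/
theorem exists_local_korn_unit (n : ℕ) {p : ℝ} (hp : 1 < p) : ∃ K : ℝ≥0∞, K ≠ ⊤ ∧
    ∀ v : Evec n → Evec n, (∀ x ∈ Metric.ball (0 : Evec n) 2, DifferentiableAt ℝ v x) →
      ∃ L : Evec n →L[ℝ] Evec n,
        ∫⁻ x in Metric.ball 0 1, ENNReal.ofReal ‖fderiv ℝ v x - L‖ ^ p ≤
          K * ∫⁻ x in Metric.ball 0 2, ENNReal.ofReal (epsLen v x) ^ p ∧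
        ENNReal.ofReal ‖L‖ ^ p ≤ K * ∫⁻ x in Metric.ball 0 2, ENNReal.ofReal ‖v x‖ ^ p := by
  have hp0 : 0 ≤ p := by linarith
  have htop : ∀ a : ℝ≥0∞, a ≠ ⊤ → a ^ p ≠ ⊤ := fun a ha => ENNReal.rpow_ne_top_of_nonneg hp0 ha
  obtain ⟨C, hC, hkorn⟩ := compact_korn n hp
  obtain ⟨K, hK, happ⟩ := exists_rigid_approx n hp.le
  let χ : ContDiffBump (0 : Evec n) := ⟨1, 3 / 2, one_pos, by norm_num⟩
  have hχd : Differentiable ℝ χ := (χ.contDiff (n := 1)).differentiable one_ne_zero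
  have hχs : tsupport χ ⊆ Metric.ball (0 : Evec n) 2 := by
    rw [χ.tsupport_eq]
    exact Metric.closedBall_subset_ball (by change (3 / 2 : ℝ) < 2; norm_num)
  obtain ⟨M, hM⟩ : ∃ M : ℝ, ∀ x, ‖fderiv ℝ χ x‖ ≤ M :=
    (χ.hasCompactSupport.fderiv (𝕜 := ℝ)).exists_bound_of_continuous
      ((χ.contDiff (n := 1)).continuous_fderiv one_ne_zero)
  have hM0 : 0 ≤ M := (norm_nonneg _).trans (hM 0)
  set N : ℝ≥0∞ := ENNReal.ofReal (n * n : ℝ) ^ p with hN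
  have hNt : N ≠ ⊤ := htop _ ENNReal.ofReal_ne_top
  set A : ℝ≥0∞ := N * (2 ^ (p - 1) * (1 + ENNReal.ofReal M ^ p * K)) with hA
  have h2t : (2 : ℝ≥0∞) ^ (p - 1) ≠ ⊤ := ENNReal.rpow_ne_top_of_nonneg (by linarith) (by simp)
  have hAt : A ≠ ⊤ := ENNReal.mul_ne_top hNt (ENNReal.mul_ne_top h2t
    (ENNReal.add_ne_top.2 ⟨ENNReal.one_ne_top, ENNReal.mul_ne_top
        (htop _ ENNReal.ofReal_ne_top) hK⟩))
  refine ⟨N * (C * A) + K, ENNReal.add_ne_top.2 ⟨ENNReal.mul_ne_top hNt (ENNReal.mul_ne_top hC hAt),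
    hK⟩, fun v hd => ?_⟩
  obtain ⟨c, L, hL, hLv, hu⟩ := happ v hd
  refine ⟨L, ?_, hLv.trans (by gcongr; exact le_add_self)⟩
  set u : Evec n → Evec n := fun x => v x - (c + L x) with hu'
  have hud : ∀ x ∈ Metric.ball (0 : Evec n) 2, HasFDerivAt u (fderiv ℝ v x - L) x := fun x hx =>
    (hd x hx).hasFDerivAt.sub (L.hasFDerivAt.const_add c)
  set w : Evec n → Evec n := fun x => χ x • u x with hw
  have hout : ∀ x ∉ Metric.ball (0 : Evec n) 2, w =ᶠ[𝓝 x] 0 := by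
    intro x hx
    filter_upwards [notMem_tsupport_iff_eventuallyEq.1 fun h => hx (hχs h)] with y hy
    simp [hw, hy]
  have hwF : ∀ x ∈ Metric.ball (0 : Evec n) 2, HasFDerivAt w
      (χ x • (fderiv ℝ v x - L) + (fderiv ℝ χ x).smulRight (u x)) x := fun x hx =>
    (hχd x).hasFDerivAt.smul (hud x hx)
  have hwd : Differentiable ℝ w := by
    intro x
    by_cases hx : x ∈ Metric.ball (0 : Evec n) 2
    · exact (hwF x hx).differentiableAt
    · exact (hout x hx).differentiableAt_iff.2 (differentiableAt_const _)
  have hws : HasCompactSupport w := χ.hasCompactSupport.smul_right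
  have hpw : ∀ x ∈ Metric.ball (0 : Evec n) 2, ∀ i j, pder w i j x =
      χ x * (pder v i j x - L (bv j) i) + fderiv ℝ χ x (bv j) * u x i := by
    intro x hx i j
    rw [pder, (hwF x hx).fderiv]
    simp [pder, bv]
  have hbv : ∀ x (j : Fin n), |fderiv ℝ χ x (bv j)| ≤ M := fun x j => by
    refine ((fderiv ℝ χ x).le_opNorm (bv j)).trans ?_
    simpa [bv] using hM x
  have hew : ∀ x ∈ Metric.ball (0 : Evec n) 2, epsLen w x ≤ (n * n : ℝ) *
      (epsLen v x + M * ‖u x‖) := by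
    intro x hx
    refine (epsLen_le_sum w x).trans ?_
    have : ∀ i j, |(pder w i j x + pder w j i x) / 2| ≤ epsLen v x + M * ‖u x‖ := by
      intro i j
      rw [hpw x hx, hpw x hx, hL i j]
      have e : (χ x * (pder v i j x - L (bv j) i) + fderiv ℝ χ x (bv j) * u x i +
          (χ x * (pder v j i x - -L (bv j) i) + fderiv ℝ χ x (bv i) * u x j)) / 2 =
          χ x * ((pder v i j x + pder v j i x) / 2) +
          (fderiv ℝ χ x (bv j) * u x i + fderiv ℝ χ x (bv i) * u x j) / 2 := by ring
      rw [e]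
      refine (abs_add_le _ _).trans (add_le_add ?_ ?_)
      · rw [abs_mul, abs_of_nonneg χ.nonneg]
        exact (mul_le_of_le_one_left (abs_nonneg _) χ.le_one).trans (abs_sym_pder_le_epsLen v i j x)
      · have h1 : |fderiv ℝ χ x (bv j) * u x i| ≤ M * ‖u x‖ := by
          rw [abs_mul]; exact mul_le_mul (hbv x j) (PiLp.norm_apply_le (u x) i) (abs_nonneg _) hM0
        have h2 : |fderiv ℝ χ x (bv i) * u x j| ≤ M * ‖u x‖ := by
          rw [abs_mul]; exact mul_le_mul (hbv x i) (PiLp.norm_apply_le (u x) j) (abs_nonneg _) hM0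
        rw [abs_le] at *
        constructor <;> linarith [h1.1, h1.2, h2.1, h2.2]
    refine (Finset.sum_le_sum fun i _ => (Finset.sum_le_card_nsmul _ _ _ fun j _ =>
        this i j)).trans_eq ?_
    simp; ring
  set E := ∫⁻ x in Metric.ball 0 2, ENNReal.ofReal (epsLen v x) ^ p with hE
  have hB2 : MeasurableSet (Metric.ball (0 : Evec n) 2) := Metric.isOpen_ball.measurableSet
  have heps : ∫⁻ x, ENNReal.ofReal (epsLen w x) ^ p ≤ A * E := by
    calc _ = ∫⁻ x in Metric.ball 0 2, ENNReal.ofReal (epsLen w x) ^ p := by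
          rw [setLIntegral_eq_of_support_subset]
          intro x hx
          by_contra hxb
          apply hx
          have : ∀ i j, pder w i j x = 0 := fun i j => by
            rw [pder, (hout x hxb).fderiv_eq]; simp
          simp [epsLen, this, show 0 < p by linarith]
      _ ≤ ∫⁻ x in Metric.ball 0 2, N * (2 ^ (p - 1) * (ENNReal.ofReal (epsLen v x) ^ p +
            ENNReal.ofReal M ^ p * ENNReal.ofReal ‖u x‖ ^ p)) := by
          refine setLIntegral_mono' hB2 fun x hx => ?_
          refine (ENNReal.rpow_le_rpow (ENNReal.ofReal_le_ofReal (hew x hx)) hp0).trans ?_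
          rw [ENNReal.ofReal_mul (by positivity), ENNReal.mul_rpow_of_nonneg _ _ hp0,
            ENNReal.ofReal_add (epsLen_nonneg v x) (by positivity), ENNReal.ofReal_mul hM0,
            ← ENNReal.mul_rpow_of_nonneg (ENNReal.ofReal M) (ENNReal.ofReal ‖u x‖) hp0]
          exact mul_le_mul' le_rfl (ENNReal.rpow_add_le_mul_rpow_add_rpow _ _ hp.le)
      _ = N * (2 ^ (p - 1) * (E + ENNReal.ofReal M ^ p *
            ∫⁻ x in Metric.ball 0 2, ENNReal.ofReal ‖u x‖ ^ p)) := by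
          rw [lintegral_const_mul' _ _ hNt, lintegral_const_mul' _ _ h2t,
            lintegral_add_left ((measurable_epsLen v).ennreal_ofReal.pow_const p),
            lintegral_const_mul' _ _ (htop _ ENNReal.ofReal_ne_top)]
      _ ≤ N * (2 ^ (p - 1) * (E + ENNReal.ofReal M ^ p * (K * E))) := by gcongr
      _ = A * E := by rw [hA]; ring
  calc ∫⁻ x in Metric.ball 0 1, ENNReal.ofReal ‖fderiv ℝ v x - L‖ ^ p
      ≤ ∫⁻ x in Metric.ball (0 : Evec n) 1, N * ENNReal.ofReal (DvLen w x) ^ p := by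
        refine setLIntegral_mono' Metric.isOpen_ball.measurableSet fun x hx => ?_
        have hx2 : x ∈ Metric.ball (0 : Evec n) 2 := Metric.ball_subset_ball (by norm_num) hx
        have e : fderiv ℝ w x = fderiv ℝ v x - L := by
          have : w =ᶠ[𝓝 x] u := by
            filter_upwards [χ.eventuallyEq_one_of_mem_ball hx] with y hy
            simp [hw, hy]
          rw [this.fderiv_eq, (hud x hx2).fderiv]
        rw [← e, hN, ← ENNReal.mul_rpow_of_nonneg _ _ hp0, ← ENNReal.ofReal_mul (by positivity)]
        exact ENNReal.rpow_le_rpow (ENNReal.ofReal_le_ofReal (norm_fderiv_le_DvLen w x)) hp0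
    _ = N * ∫⁻ x in Metric.ball (0 : Evec n) 1, ENNReal.ofReal (DvLen w x) ^ p :=
        lintegral_const_mul' _ _ hNt
    _ ≤ N * (C * (A * E)) := by
        gcongr
        exact (setLIntegral_le_lintegral _ _).trans ((hkorn w hwd hws).trans (by gcongr))
    _ ≤ (N * (C * A) + K) * E := by
        rw [add_mul]
        refine le_trans (le_of_eq ?_) le_self_add
        ring

end localKorn

section localKornScaled

variable {n : ℕ}

lemma setLIntegral_ball_comp_add_smul (g : Evec n → ℝ≥0∞) (z : Evec n) {r : ℝ} (hr : 0 < r)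
    (s : ℝ) :
    ∫⁻ y in Metric.ball 0 s, g (z + r • y) =
      ENNReal.ofReal |(r ^ n)⁻¹| * ∫⁻ x in Metric.ball z (r * s), g x := by
  rw [← lintegral_indicator Metric.isOpen_ball.measurableSet,
    ← lintegral_indicator Metric.isOpen_ball.measurableSet, ← lintegral_comp_add_smul _ z hr.ne']
  congr 1
  ext y
  have : y ∈ Metric.ball (0 : Evec n) s ↔ z + r • y ∈ Metric.ball z (r * s) := by
    rw [mem_ball_zero_iff, mem_ball_iff_norm, add_sub_cancel_left, norm_smul,
        Real.norm_of_nonneg hr.le,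
      mul_lt_mul_iff_right₀ hr]
  by_cases h : y ∈ Metric.ball (0 : Evec n) s
  · rw [indicator_of_mem h, indicator_of_mem (this.1 h)]
  · rw [indicator_of_notMem h, indicator_of_notMem fun h' => h (this.2 h')]

/-- Local Korn inequality on a ball, up to an infinitesimal rotation. -/
theorem exists_local_korn (n : ℕ) {p : ℝ} (hp : 1 < p) : ∃ K : ℝ≥0∞, K ≠ ⊤ ∧
    ∀ (v : Evec n → Evec n) (z : Evec n) (r : ℝ), 0 < r →
      (∀ x ∈ Metric.ball z (2 * r), DifferentiableAt ℝ v x) → ∃ L : Evec n →L[ℝ] Evec n,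
        ∫⁻ x in Metric.ball z r, ENNReal.ofReal ‖fderiv ℝ v x - L‖ ^ p ≤
          K * ∫⁻ x in Metric.ball z (2 * r), ENNReal.ofReal (epsLen v x) ^ p ∧
        ENNReal.ofReal ‖L‖ ^ p ≤ K * (ENNReal.ofReal r⁻¹ ^ p * ENNReal.ofReal |(r ^ n)⁻¹|) *
          ∫⁻ x in Metric.ball z (2 * r), ENNReal.ofReal ‖v x‖ ^ p := by
  have hp0 : 0 ≤ p := by linarith
  obtain ⟨K, hK, h⟩ := exists_local_korn_unit n hp
  refine ⟨K, hK, fun v z r hr hd => ?_⟩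
  set V : Evec n → Evec n := fun y => r⁻¹ • v (z + r • y) with hV
  have hVF : ∀ y ∈ Metric.ball (0 : Evec n) 2, HasFDerivAt V (fderiv ℝ v (z + r • y)) y := by
    intro y hy
    have hmem : z + r • y ∈ Metric.ball z (2 * r) := by
      rw [mem_ball_iff_norm, add_sub_cancel_left, norm_smul, Real.norm_of_nonneg hr.le, mul_comm]
      exact mul_lt_mul_of_pos_right (mem_ball_zero_iff.1 hy) hr
    have h1 : HasFDerivAt (fun y : Evec n => z + r • y) (r • ContinuousLinearMap.id ℝ (Evec n)) y :=
      (r • ContinuousLinearMap.id ℝ (Evec n)).hasFDerivAt.const_add z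
    have h2 := ((hd _ hmem).hasFDerivAt.comp y h1).const_smul r⁻¹
    have e : r⁻¹ • (fderiv ℝ v (z + r • y)).comp (r • ContinuousLinearMap.id ℝ (Evec n)) =
        fderiv ℝ v (z + r • y) := by
      ext1 z; simp [smul_smul, hr.ne']
    rw [e] at h2
    exact h2
  obtain ⟨L, h1, h2⟩ := h V fun y hy => (hVF y hy).differentiableAt
  have hB : ∀ s, MeasurableSet (Metric.ball (0 : Evec n) s) := fun s =>
      Metric.isOpen_ball.measurableSet
  have hc0 : ENNReal.ofReal |(r ^ n)⁻¹| ≠ 0 := by simp [hr.ne']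
  have e1 : ∫⁻ y in Metric.ball 0 1, ENNReal.ofReal ‖fderiv ℝ V y - L‖ ^ p =
      ENNReal.ofReal |(r ^ n)⁻¹| * ∫⁻ x in Metric.ball z r, ENNReal.ofReal ‖fderiv ℝ v x - L‖ ^ p :=
          by
    have := setLIntegral_ball_comp_add_smul (fun x => ENNReal.ofReal ‖fderiv ℝ v x - L‖ ^ p) z hr 1
    rw [mul_one] at this
    rw [← this]
    refine setLIntegral_congr_fun (hB 1) fun y hy => ?_
    simp only [(hVF y (Metric.ball_subset_ball (by norm_num) hy)).fderiv]
  have e2 : ∫⁻ y in Metric.ball 0 2, ENNReal.ofReal (epsLen V y) ^ p =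
      ENNReal.ofReal |(r ^ n)⁻¹| * ∫⁻ x in Metric.ball z (2 * r), ENNReal.ofReal (epsLen v x) ^ p :=
          by
    rw [mul_comm 2 r, ← setLIntegral_ball_comp_add_smul (fun x => ENNReal.ofReal
        (epsLen v x) ^ p) z hr 2]
    refine setLIntegral_congr_fun (hB 2) fun y hy => ?_
    simp only [epsLen, pder, (hVF y hy).fderiv]
  have e3 : ∫⁻ y in Metric.ball 0 2, ENNReal.ofReal ‖V y‖ ^ p =
      ENNReal.ofReal r⁻¹ ^ p * (ENNReal.ofReal |(r ^ n)⁻¹| *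
        ∫⁻ x in Metric.ball z (2 * r), ENNReal.ofReal ‖v x‖ ^ p) := by
    rw [mul_comm 2 r, ← setLIntegral_ball_comp_add_smul (fun x => ENNReal.ofReal ‖v x‖ ^ p) z hr 2,
      ← lintegral_const_mul' _ _ (ENNReal.rpow_ne_top_of_nonneg hp0 ENNReal.ofReal_ne_top)]
    refine setLIntegral_congr_fun (hB 2) fun y hy => ?_
    simp only [hV]
    rw [norm_smul, Real.norm_of_nonneg (inv_nonneg.2 hr.le), ENNReal.ofReal_mul
        (inv_nonneg.2 hr.le),
      ENNReal.mul_rpow_of_nonneg _ _ hp0]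
  rw [e1, e2, mul_left_comm] at h1
  refine ⟨L, (ENNReal.mul_le_mul_iff_right hc0 ENNReal.ofReal_ne_top).1 h1, ?_⟩
  rw [e3] at h2
  refine h2.trans_eq ?_
  ring

end localKornScaled

section bdistFacts

variable {n : ℕ} {Ω : Set (Evec n)}

lemma bdist_nonneg (Ω : Set (Evec n)) (x : Evec n) : 0 ≤ bdist Ω x := Metric.infDist_nonneg

lemma continuous_bdist (Ω : Set (Evec n)) : Continuous (bdist Ω) := Metric.continuous_infDist_pt _

lemma bdist_le_add_dist (Ω : Set (Evec n)) (x y : Evec n) : bdist Ω x ≤ bdist Ω y + dist x y :=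
  Metric.infDist_le_infDist_add_dist

lemma frontier_nonempty_of_isBoundedDomain (h : IsBoundedDomain Ω) (hu : Ω ≠ univ) :
    (frontier Ω).Nonempty :=
  nonempty_frontier_iff.2 ⟨h.2.1.nonempty, hu⟩

lemma bdist_pos (h : IsBoundedDomain Ω) (hu : Ω ≠ univ) {x : Evec n} (hx : x ∈ Ω) :
    0 < bdist Ω x := by
  refine (isClosed_frontier.notMem_iff_infDist_pos (frontier_nonempty_of_isBoundedDomain h hu)).1 ?_
  exact fun hf => (disjoint_frontier_iff_isOpen.2 h.1).le_bot ⟨hf, hx⟩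

lemma ball_bdist_subset (h : IsBoundedDomain Ω) {x : Evec n} (hx : x ∈ Ω) :
    Metric.ball x (bdist Ω x) ⊆ Ω := by
  rcases le_or_gt (bdist Ω x) 0 with h0 | h0
  · rw [Metric.ball_eq_empty.2 h0]; exact empty_subset _
  refine (convex_ball x _).isPreconnected.subset_left_of_subset_union h.1
    isClosed_closure.isOpen_compl (disjoint_compl_right.mono_left subset_closure |>.mono_right le_rfl)
    (fun y hy => ?_) ⟨x, Metric.mem_ball_self h0, hx⟩
  by_contra hy'
  simp only [mem_union, mem_compl_iff, not_or, not_not] at hy'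
  have : y ∈ frontier Ω := by
    rw [frontier, h.1.interior_eq]; exact ⟨hy'.2, hy'.1⟩
  have h1 : bdist Ω x ≤ dist x y := Metric.infDist_le_dist_of_mem this
  rw [Metric.mem_ball, dist_comm] at hy
  linarith

lemma exists_bdist_le (h : IsBoundedDomain Ω) (hu : Ω ≠ univ) :
    ∃ R : ℝ, 1 ≤ R ∧ ∀ x ∈ Ω, bdist Ω x ≤ R := by
  obtain ⟨y, hy⟩ := frontier_nonempty_of_isBoundedDomain h hu
  obtain ⟨R, hR⟩ := h.2.2.subset_closedBall y
  refine ⟨max 1 R, le_max_left _ _, fun x hx => ?_⟩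
  exact ((Metric.infDist_le_dist_of_mem hy).trans (hR hx)).trans (le_max_right _ _)

end bdistFacts

section curves

variable {n : ℕ}

/-- The length of a Lipschitz curve bounds the distance between its end points. -/
lemma ofReal_dist_le_lintegral_deriv {γ : ℝ → Evec n} {K : ℝ≥0} {s t : ℝ} (hst : s ≤ t)
    (hγ : LipschitzOnWith K γ (Icc s t)) :
    ENNReal.ofReal (dist (γ s) (γ t)) ≤ ∫⁻ u in Icc s t, ENNReal.ofReal ‖deriv γ u‖ := by
  rcases eq_or_ne (γ t) (γ s) with h0 | h0
  · simp [h0]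
  set w : Evec n := ‖γ t - γ s‖⁻¹ • (γ t - γ s) with hw
  have hpos : 0 < ‖γ t - γ s‖ := norm_pos_iff.2 (sub_ne_zero.2 h0)
  have hwn : ‖w‖ = 1 := by rw [hw, norm_smul, norm_inv, norm_norm, inv_mul_cancel₀ hpos.ne']
  have hsw : inner ℝ w (γ t) - inner ℝ w (γ s) = dist (γ s) (γ t) := by
    rw [← inner_sub_right, hw, real_inner_smul_left, real_inner_self_eq_norm_sq, dist_comm,
      dist_eq_norm]
    field_simp
  have hγ' : LipschitzOnWith K γ (uIcc s t) := by rwa [uIcc_of_le hst]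
  have hac := hγ'.absolutelyContinuousOnInterval
  have hacw : AbsolutelyContinuousOnInterval (fun u => inner ℝ w (γ u)) s t :=
    (((innerSL ℝ w).lipschitz.lipschitzOnWith (s := univ)).comp hγ'
      (mapsTo_univ _ _)).absolutelyContinuousOnInterval
  have hint := hacw.integral_deriv_eq_sub
  rw [hsw, intervalIntegral.integral_of_le hst, ← integral_Icc_eq_integral_Ioc] at hint
  rw [← hint]
  have h1 := enorm_integral_le_lintegral_enorm (μ := volume.restrict (Icc s t))
    (deriv fun u => inner ℝ w (γ u))
  refine (ENNReal.ofReal_le_ofReal (le_abs_self _)).trans ?_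
  rw [← Real.enorm_eq_ofReal_abs]
  refine h1.trans (setLIntegral_mono_ae' measurableSet_Icc ?_)
  filter_upwards [hac.boundedVariationOn.ae_differentiableAt_of_mem_uIcc] with u hu hmem
  rw [uIcc_of_le hst] at hu
  have h2 : HasDerivAt (fun u => inner ℝ w (γ u)) (inner ℝ w (deriv γ u)) u := by
    simpa using (hasDerivAt_const u w).inner ℝ (hu hmem).hasDerivAt
  rw [h2.deriv, Real.enorm_eq_ofReal_abs]
  refine ENNReal.ofReal_le_ofReal ((abs_real_inner_le_norm _ _).trans ?_)
  rw [hwn, one_mul]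

/-- The quasihyperbolic cost of a curve over a parameter interval ending at `1`. -/
def qhCost (Ω : Set (Evec n)) (γ : ℝ → Evec n) (s : ℝ) : ℝ≥0∞ :=
  ∫⁻ t in Icc s 1, ENNReal.ofReal (‖deriv γ t‖ / bdist Ω (γ t))

/-- The quasihyperbolic costs of the Lipschitz curves from `x` to `x₀` in `Ω`. -/
def qhCosts (Ω : Set (Evec n)) (x₀ x : Evec n) : Set ℝ≥0∞ :=
  {c | ∃ (γ : ℝ → Evec n) (K : ℝ≥0) (s : ℝ), s ≤ 1 ∧ LipschitzOnWith K γ (Icc s 1) ∧ γ s = x ∧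
    γ 1 = x₀ ∧ (∀ t ∈ Icc s 1, γ t ∈ Ω) ∧ c = qhCost Ω γ s}

lemma exists_point_on_curve {Ω : Set (Evec n)} (hΩ : IsBoundedDomain Ω) (hu : Ω ≠ univ)
    {γ : ℝ → Evec n} {K : ℝ≥0} {s δ : ℝ} (hδ : 0 < δ) (hs : s ≤ 1)
    (hγ : LipschitzOnWith K γ (Icc s 1)) (hmem : ∀ t ∈ Icc s 1, γ t ∈ Ω)
    (hfar : δ * bdist Ω (γ s) < dist (γ s) (γ 1)) :
    ∃ t ∈ Icc s 1, dist (γ s) (γ t) ≤ δ * bdist Ω (γ s) ∧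
      qhCost Ω γ t + ENNReal.ofReal (δ / (1 + δ)) ≤ qhCost Ω γ s := by
  set ρ := bdist Ω (γ s) with hρ
  have hρ0 : 0 < ρ := bdist_pos hΩ hu (hmem s ⟨le_rfl, hs⟩)
  have hcont : ContinuousOn (fun t => dist (γ s) (γ t)) (Icc s 1) :=
    (Continuous.dist continuous_const continuous_id).comp_continuousOn hγ.continuousOn
  set A : Set ℝ := Icc s 1 ∩ (fun t => dist (γ s) (γ t)) ⁻¹' Ici (δ * ρ) with hA
  have hAc : IsCompact A :=
    isCompact_Icc.of_isClosed_subset (hcont.preimage_isClosed_of_isClosed isClosed_Icc isClosed_Ici)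
      inter_subset_left
  obtain ⟨t, ht, hmin⟩ := hAc.exists_isLeast ⟨1, ⟨hs, le_rfl⟩, hfar.le⟩
  have hle : ∀ u ∈ Icc s t, dist (γ s) (γ u) ≤ δ * ρ := by
    have hIco : ∀ u ∈ Ico s t, dist (γ s) (γ u) < δ * ρ := by
      intro u hu
      by_contra hcon
      exact absurd (hmin ⟨⟨hu.1, hu.2.le.trans ht.1.2⟩, not_lt.1 hcon⟩) (not_le.2 hu.2)
    have hteq : dist (γ s) (γ t) = δ * ρ := by
      obtain ⟨u, hu, hu'⟩ := intermediate_value_Icc ht.1.1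
        (hcont.mono (Icc_subset_Icc_right ht.1.2))
        (show δ * ρ ∈ Icc (dist (γ s) (γ s)) (dist (γ s) (γ t)) from
          ⟨by rw [dist_self]; positivity, ht.2⟩)
      have : t ≤ u := hmin ⟨⟨hu.1, hu.2.trans ht.1.2⟩, hu'.ge⟩
      rwa [le_antisymm hu.2 this] at hu'
    intro u hu
    rcases hu.2.eq_or_lt with h | h
    · rw [h, hteq]
    · exact (hIco u ⟨hu.1, h⟩).le
  refine ⟨t, ht.1, hle t ⟨ht.1.1, le_rfl⟩, ?_⟩
  have hlow : ENNReal.ofReal (δ / (1 + δ)) ≤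
      ∫⁻ u in Ico s t, ENNReal.ofReal (‖deriv γ u‖ / bdist Ω (γ u)) := by
    have h1 := ofReal_dist_le_lintegral_deriv ht.1.1 (hγ.mono (Icc_subset_Icc_right ht.1.2))
    rw [← restrict_Ico_eq_restrict_Icc] at h1
    have hD : 0 < (1 + δ) * ρ := by positivity
    calc ENNReal.ofReal (δ / (1 + δ)) = ENNReal.ofReal (((1 + δ) * ρ)⁻¹) * ENNReal.ofReal (δ * ρ) :=
        by
          rw [← ENNReal.ofReal_mul (by positivity)]
          congr 1; field_simp
      _ ≤ ENNReal.ofReal (((1 + δ) * ρ)⁻¹) * ∫⁻ u in Ico s t, ENNReal.ofReal ‖deriv γ u‖ :=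
          mul_le_mul' le_rfl ((ENNReal.ofReal_le_ofReal ht.2).trans h1)
      _ = ∫⁻ u in Ico s t, ENNReal.ofReal (((1 + δ) * ρ)⁻¹) * ENNReal.ofReal ‖deriv γ u‖ :=
          (lintegral_const_mul' _ _ ENNReal.ofReal_ne_top).symm
      _ ≤ _ := by
          refine setLIntegral_mono' measurableSet_Ico fun u hu' => ?_
          rw [← ENNReal.ofReal_mul (by positivity), mul_comm, ← div_eq_mul_inv]
          refine ENNReal.ofReal_le_ofReal (div_le_div_of_nonneg_left (norm_nonneg _)
            (bdist_pos hΩ hu (hmem u ⟨hu'.1, hu'.2.le.trans ht.1.2⟩)) ?_)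
          have := bdist_le_add_dist Ω (γ u) (γ s)
          rw [dist_comm] at this
          have := hle u (Ico_subset_Icc_self hu')
          linarith
  have hsplit : Ico s t ∪ Icc t 1 = Icc s 1 := Ico_union_Icc_eq_Icc ht.1.1 ht.1.2
  have hdisj : Disjoint (Ico s t) (Icc t 1) :=
    Set.disjoint_left.2 fun u h1 h2 => absurd h2.1 (not_le.2 h1.2)
  rw [qhCost, qhCost, ← hsplit, lintegral_union measurableSet_Icc hdisj, add_comm]
  exact add_le_add hlow le_rfl

end curves

section potential

variable {n : ℕ} {Ω : Set (Evec n)}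

/-- A discrete version of the quasihyperbolic distance to the base point, together with its
descent property. -/
lemma exists_descent_function (hΩ : IsBoundedDomain Ω) (hu : Ω ≠ univ) {β : ℝ} (hβ : 0 < β)
    (hq : QHBC Ω β) {δ : ℝ} (hδ : 0 < δ) :
    ∃ x₀ ∈ Ω, ∃ (k : Evec n → ℝ) (C : ℝ), (∀ x ∈ Ω, 0 ≤ k x) ∧
      (∀ x ∈ Ω, k x ≤ 1 / β * Real.log (bdist Ω x₀ / bdist Ω x) + C) ∧
      ∀ x ∈ Ω, x ≠ x₀ → ∃ y ∈ Ω, dist x y ≤ δ * bdist Ω x ∧ k y + δ / (1 + 2 * δ) ≤ k x := by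
  obtain ⟨x₀, hx₀, C₀, hC₀⟩ := hq
  obtain ⟨R, hR1, hR⟩ := exists_bdist_le hΩ hu
  have hρ₀ := bdist_pos hΩ hu hx₀
  set κ := δ / (1 + 2 * δ) with hκ
  have hκ0 : 0 < κ := by positivity
  set κ' := δ / (1 + δ) with hκ'
  have hκκ : κ < κ' := div_lt_div_of_pos_left hδ (by positivity) (by linarith)
  set 𝒦 : Evec n → ℝ≥0∞ := fun x => sInf (qhCosts Ω x₀ x) with h𝒦
  have hub : ∀ x ∈ Ω, 𝒦 x ≤ ENNReal.ofReal (1 / β * Real.log (bdist Ω x₀ / bdist Ω x) + C₀ + 1) :=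
      by
    intro x hx
    obtain ⟨γ, K, h1, h2, h3, h4, h5⟩ := hC₀ x hx 1 one_pos
    have hmem : qhCost Ω γ 0 ∈ qhCosts Ω x₀ x := ⟨γ, K, 0, zero_le_one, h1, h2, h3, h4, rfl⟩
    exact (sInf_le hmem).trans h5
  have hfin : ∀ x ∈ Ω, 𝒦 x ≠ ⊤ := fun x hx => ne_top_of_le_ne_top ENNReal.ofReal_ne_top (hub x hx)
  classical
  set k : Evec n → ℝ := fun x => if x = x₀ then 0 else (𝒦 x).toReal + κ with hk
  refine ⟨x₀, hx₀, k, |C₀| + 1 + κ + |1 / β * Real.log (bdist Ω x₀ / R)|, fun x _ => ?_,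
    fun x hx => ?_, fun x hx hne => ?_⟩
  · simp only [hk]; split_ifs
    · exact le_rfl
    · positivity
  · have hρ := bdist_pos hΩ hu hx
    have hlog : 1 / β * Real.log (bdist Ω x₀ / R) ≤ 1 / β * Real.log (bdist Ω x₀ / bdist Ω x) := by
      refine mul_le_mul_of_nonneg_left (Real.log_le_log (by positivity) ?_) (by positivity)
      exact div_le_div_of_nonneg_left hρ₀.le hρ (hR x hx)
    have h1 := neg_abs_le (1 / β * Real.log (bdist Ω x₀ / R))
    have h2 := le_abs_self C₀
    have h3 := abs_nonneg C₀
    simp only [hk]; split_ifs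
    · linarith
    · have h4 := ENNReal.toReal_mono ENNReal.ofReal_ne_top (hub x hx)
      rw [ENNReal.toReal_ofReal'] at h4
      have h5 : max (1 / β * Real.log (bdist Ω x₀ / bdist Ω x) + C₀ + 1) 0 ≤
          1 / β * Real.log (bdist Ω x₀ / bdist Ω x) + (|C₀| + 1 + |1 / β * Real.log
              (bdist Ω x₀ / R)|) := by
        have := abs_nonneg (1 / β * Real.log (bdist Ω x₀ / R))
        exact max_le (by linarith) (by linarith)
      linarith
  · have hkx : k x = (𝒦 x).toReal + κ := by simp only [hk, if_neg hne]
    have hkx₀ : k x₀ = 0 := by simp only [hk, if_true]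
    by_cases hfar : δ * bdist Ω x < dist x x₀
    · have hlt : 𝒦 x < 𝒦 x + ENNReal.ofReal (κ' - κ) :=
        ENNReal.lt_add_right (hfin x hx) (by simpa using hκκ)
      obtain ⟨c, ⟨γ, K, s, hs, hγ, hγs, hγ1, hmem, rfl⟩, hc⟩ := sInf_lt_iff.1 hlt
      rw [← hγs, ← hγ1] at hfar
      obtain ⟨t, ht, hd, hcost⟩ := exists_point_on_curve hΩ hu hδ hs hγ hmem hfar
      rw [hγs] at hd
      refine ⟨γ t, hmem t ht, hd, ?_⟩
      by_cases hy : γ t = x₀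
      · rw [hy, hkx₀, hkx]
        have : 0 ≤ (𝒦 x).toReal := ENNReal.toReal_nonneg
        linarith
      · have h1 : 𝒦 (γ t) ≤ qhCost Ω γ t :=
          sInf_le ⟨γ, K, t, ht.2, hγ.mono (Icc_subset_Icc_left ht.1), rfl, hγ1,
            fun u hu => hmem u ⟨ht.1.trans hu.1, hu.2⟩, rfl⟩
        have h2 : 𝒦 (γ t) + ENNReal.ofReal κ' ≤ 𝒦 x + ENNReal.ofReal (κ' - κ) :=
          (add_le_add_left h1 _).trans (hcost.trans hc.le)
        have h3 := ENNReal.toReal_mono (ENNReal.add_ne_top.2 ⟨hfin x hx, ENNReal.ofReal_ne_top⟩) h2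
        rw [ENNReal.toReal_add (hfin _ (hmem t ht)) ENNReal.ofReal_ne_top,
          ENNReal.toReal_add (hfin x hx) ENNReal.ofReal_ne_top,
          ENNReal.toReal_ofReal (hκ0.trans hκκ).le, ENNReal.toReal_ofReal (by linarith)] at h3
        have hky : k (γ t) = (𝒦 (γ t)).toReal + κ := by simp only [hk, if_neg hy]
        rw [hky, hkx]
        linarith
    · refine ⟨x₀, hx₀, not_lt.1 hfar, ?_⟩
      rw [hkx₀, hkx]
      have : 0 ≤ (𝒦 x).toReal := ENNReal.toReal_nonneg
      linarith

end potential

section chains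

variable {n : ℕ} {Ω : Set (Evec n)}

lemma sum_pow_sub_le {r : ℝ} (h0 : 0 ≤ r) (h1 : r < 1) (N : ℕ) :
    ∑ l ∈ Finset.range (N + 1), r ^ (N - l) ≤ (1 - r)⁻¹ := by
  have h := Finset.sum_range_reflect (fun j => r ^ j) (N + 1)
  simp only [Nat.add_sub_cancel] at h
  rw [h, ← tsum_geometric_of_lt_one h0 h1]
  exact (summable_geometric_of_lt_one h0 h1).sum_le_tsum _ fun _ _ => pow_nonneg h0 _

lemma exists_descent_chain {x₀ : Evec n} {k : Evec n → ℝ} {δ κ : ℝ} (hκ : 0 < κ)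
    (hk0 : ∀ x ∈ Ω, 0 ≤ k x)
    (hstep : ∀ x ∈ Ω, x ≠ x₀ → ∃ y ∈ Ω, dist x y ≤ δ * bdist Ω x ∧ k y + κ ≤ k x)
    {x : Evec n} (hx : x ∈ Ω) : ∃ (N : ℕ) (y : ℕ → Evec n), y 0 = x ∧ y N = x₀ ∧
      (∀ i ≤ N, y i ∈ Ω) ∧ (∀ i < N, dist (y i) (y (i + 1)) ≤ δ * bdist Ω (y i)) ∧
      ∀ i < N, k (y (i + 1)) + κ ≤ k (y i) := by
  have main : ∀ (m : ℕ), ∀ x ∈ Ω, k x ≤ m * κ → ∃ (N : ℕ) (y : ℕ → Evec n), y 0 = x ∧ y N = x₀ ∧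
      (∀ i ≤ N, y i ∈ Ω) ∧ (∀ i < N, dist (y i) (y (i + 1)) ≤ δ * bdist Ω (y i)) ∧
      ∀ i < N, k (y (i + 1)) + κ ≤ k (y i) := by
    intro m
    induction m with
    | zero =>
      intro x hx hkx
      by_cases hne : x = x₀
      · exact ⟨0, fun _ => x, rfl, hne, fun _ _ => hx, by simp, by simp⟩
      · obtain ⟨y, hy, -, h2⟩ := hstep x hx hne
        have := hk0 y hy
        simp only [Nat.cast_zero, zero_mul] at hkx
        linarith
    | succ m ih =>
      intro x hx hkx
      by_cases hne : x = x₀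
      · exact ⟨0, fun _ => x, rfl, hne, fun _ _ => hx, by simp, by simp⟩
      · obtain ⟨z, hz, h1, h2⟩ := hstep x hx hne
        push_cast at hkx
        obtain ⟨N, y, hy0, hyN, hyΩ, hyd, hyk⟩ := ih z hz (by linarith)
        refine ⟨N + 1, fun i => Nat.casesOn i x y, rfl, hyN, ?_, ?_, ?_⟩
        · rintro (_ | i) hi
          · exact hx
          · exact hyΩ i (by omega)
        · rintro (_ | i) hi
          · simpa [hy0] using h1
          · exact hyd i (by omega)
        · rintro (_ | i) hi
          · simpa [hy0] using h2
          · exact hyk i (by omega)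
  obtain ⟨m, hm⟩ := exists_nat_ge (k x / κ)
  exact main m x hx ((div_le_iff₀ hκ).1 hm)

/-- Under the quasihyperbolic boundary condition every point is joined to a fixed one by a chain
of points whose boundary distances decay geometrically, and the part of the chain before a given
point stays in a controlled neighbourhood. -/
theorem exists_chain (hΩ : IsBoundedDomain Ω) (hu : Ω ≠ univ) {β : ℝ} (hβ : 0 < β)
    (hq : QHBC Ω β) {δ l : ℝ} (hδ : 0 < δ) (hδ1 : δ < 1) (hl0 : 0 ≤ l) (hl1 : l ≤ 1)
    (hτ : l * (δ / (1 - δ)) < (1 - l) * (β * (δ / (1 + 2 * δ)))) :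
    ∃ x₀ ∈ Ω, ∃ C > 0, ∃ q : ℝ, 0 < q ∧ q < 1 ∧ ∀ x ∈ Ω, ∃ (N : ℕ) (y : ℕ → Evec n),
      y 0 = x ∧ y N = x₀ ∧ (∀ i ≤ N, y i ∈ Ω) ∧
      (∀ i < N, dist (y i) (y (i + 1)) ≤ δ * bdist Ω (y i)) ∧
      (∀ i ≤ N, dist x (y i) ≤ C * bdist Ω (y i) ^ (l + (1 - l) * (β * (1 / (1 + 2 * δ))))) ∧
      ∀ i ≤ N, bdist Ω (y i) ≤ C * q ^ (N - i) := by
  obtain ⟨x₀, hx₀, k, C₀, hk0, hkub, hstep⟩ := exists_descent_function hΩ hu hβ hq hδ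
  set κ := δ / (1 + 2 * δ) with hκ
  have hκ0 : 0 < κ := by positivity
  set θ := 1 / (1 + 2 * δ) with hθ
  have hθ0 : 0 < θ := by positivity
  have hκθ : κ = θ * δ := by rw [hκ, hθ]; ring
  set s := l + (1 - l) * (β * θ) with hs
  set ω := (1 - l) * (β * κ) - l * (δ / (1 - δ)) with hω
  have hω0 : 0 < ω := sub_pos.2 hτ
  set L₀ := Real.log (bdist Ω x₀) with hL₀
  set A₁ := L₀ + β * C₀ with hA₁
  set A₂ := (1 - l) * (A₁ - β * θ * L₀) with hA₂
  have hr1 : Real.exp (-ω) < 1 := Real.exp_lt_one_iff.2 (by linarith)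
  have hr0 : 0 < 1 - Real.exp (-ω) := by linarith
  set C₁ := δ * (Real.exp A₂ * (1 - Real.exp (-ω))⁻¹) with hC₁
  have hC₁0 : 0 < C₁ := by positivity
  refine ⟨x₀, hx₀, max C₁ (Real.exp A₁), lt_max_of_lt_left hC₁0, Real.exp (-(β * κ)),
    Real.exp_pos _, Real.exp_lt_one_iff.2 (by nlinarith [mul_pos hβ hκ0]), fun x hx => ?_⟩
  obtain ⟨N, y, hy0, hyN, hyΩ, hyd, hyk⟩ := exists_descent_chain hκ0 hk0 hstep hx
  have hρ : ∀ i ≤ N, 0 < bdist Ω (y i) := fun i hi => bdist_pos hΩ hu (hyΩ i hi)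
  set L : ℕ → ℝ := fun i => Real.log (bdist Ω (y i)) with hL
  have hLN : L N = L₀ := by simp only [hL, hyN, hL₀]
  have ha : ∀ i ≤ N, L i ≤ A₁ - β * k (y i) := by
    intro i hi
    have h := hkub _ (hyΩ i hi)
    rw [Real.log_div (bdist_pos hΩ hu hx₀).ne' (hρ i hi).ne'] at h
    have h2 := mul_le_mul_of_nonneg_left h hβ.le
    have e : β * (1 / β * (L₀ - L i) + C₀) = L₀ - L i + β * C₀ := by field_simp
    have h3 : β * k (y i) ≤ L₀ - L i + β * C₀ := h2.trans_eq e
    rw [hA₁]; linarith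
  have hb : ∀ i < N, L (i + 1) ≤ L i + δ := by
    intro i hi
    have h1 := bdist_le_add_dist Ω (y (i + 1)) (y i)
    rw [dist_comm] at h1
    have h2 : bdist Ω (y (i + 1)) ≤ Real.exp δ * bdist Ω (y i) := by
      nlinarith [hyd i hi, Real.add_one_le_exp δ, hρ i hi.le]
    have h3 := Real.log_le_log (hρ (i + 1) hi) h2
    rw [Real.log_mul (Real.exp_pos _).ne' (hρ i hi.le).ne', Real.log_exp] at h3
    simp only [hL]; linarith
  have hc : ∀ i < N, L i ≤ L (i + 1) + δ / (1 - δ) := by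
    intro i hi
    have h1 := bdist_le_add_dist Ω (y i) (y (i + 1))
    have h1δ : 0 < 1 - δ := by linarith
    have h2 : (1 - δ) * bdist Ω (y i) ≤ bdist Ω (y (i + 1)) := by linarith [hyd i hi]
    have h3 := Real.log_le_log (mul_pos h1δ (hρ i hi.le)) h2
    rw [Real.log_mul h1δ.ne' (hρ i hi.le).ne'] at h3
    have h4 := Real.log_le_sub_one_of_pos (inv_pos.2 h1δ)
    rw [Real.log_inv] at h4
    have h5 : (1 - δ)⁻¹ - 1 = δ / (1 - δ) := by field_simp; ring
    simp only [hL]; linarith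
  have hk' : ∀ j i, i + j ≤ N → k (y (i + j)) + κ * j ≤ k (y i) := by
    intro j
    induction j with
    | zero => intro i _; simp
    | succ j ih =>
      intro i hi
      have h1 := ih i (by omega)
      have h2 := hyk (i + j) (by omega)
      push_cast
      rw [← add_assoc]
      linarith
  have hb' : ∀ j i, i + j ≤ N → L (i + j) ≤ L i + δ * j := by
    intro j
    induction j with
    | zero => intro i _; simp
    | succ j ih =>
      intro i hi
      have h1 := ih i (by omega)
      have h2 := hb (i + j) (by omega)
      push_cast
      rw [← add_assoc]
      linarith
  have hc' : ∀ j i, i + j ≤ N → L i ≤ L (i + j) + δ / (1 - δ) * j := by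
    intro j
    induction j with
    | zero => intro i _; simp
    | succ j ih =>
      intro i hi
      have h1 := ih i (by omega)
      have h2 := hc (i + j) (by omega)
      push_cast
      rw [← add_assoc]
      linarith
  have hkN : ∀ i ≤ N, κ * (N - i : ℕ) ≤ k (y i) := by
    intro i hi
    have h := hk' (N - i) i (by omega)
    have := hk0 _ (hyΩ (i + (N - i)) (by omega))
    linarith
  have hkθ : ∀ i ≤ N, θ * (L₀ - L i) ≤ k (y i) := by
    intro i hi
    refine le_trans ?_ (hkN i hi)
    have h := hb' (N - i) i (by omega)
    rw [show i + (N - i) = N by omega, hLN] at h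
    rw [hκθ, mul_assoc]
    exact mul_le_mul_of_nonneg_left (by linarith) hθ0.le
  have hkey : ∀ i ≤ N, ∀ m ≤ i, bdist Ω (y m) ≤
      Real.exp A₂ * bdist Ω (y i) ^ s * Real.exp (-ω) ^ (i - m) := by
    intro i hi m hm
    have h1 := hc' (i - m) m (by omega)
    have h2 := hk' (i - m) m (by omega)
    rw [show m + (i - m) = i by omega] at h1 h2
    have h3 := ha m (by omega)
    have h4 := hkθ i hi
    have h5 : L m ≤ A₂ + s * L i + (i - m : ℕ) * -ω := by
      have e1 : l * L m ≤ l * (L i + δ / (1 - δ) * (i - m : ℕ)) := mul_le_mul_of_nonneg_left h1 hl0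
      have e2 : (1 - l) * L m ≤
          (1 - l) * (A₁ - β * (θ * (L₀ - L i) + κ * (i - m : ℕ))) := by
        refine mul_le_mul_of_nonneg_left (h3.trans ?_) (by linarith)
        have := mul_le_mul_of_nonneg_left (show θ * (L₀ - L i) + κ * (i - m : ℕ) ≤ k
            (y m) by linarith)
          hβ.le
        linarith
      have e3 : l * (L i + δ / (1 - δ) * (i - m : ℕ)) +
          (1 - l) * (A₁ - β * (θ * (L₀ - L i) + κ * (i - m : ℕ))) =
          A₂ + s * L i + (i - m : ℕ) * -ω := by
        rw [hA₂, hs, hω]; ring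
      linarith
    have h6 := Real.exp_le_exp.2 h5
    rw [Real.exp_add, Real.exp_add, Real.exp_nat_mul] at h6
    have h7 : Real.exp (L m) = bdist Ω (y m) := Real.exp_log (hρ m (by omega))
    rw [h7] at h6
    rwa [Real.rpow_def_of_pos (hρ i hi), mul_comm (Real.log _)]
  refine ⟨N, y, hy0, hyN, hyΩ, hyd, fun i hi => ?_, fun i hi => ?_⟩
  · have hsum : dist x (y i) ≤ ∑ m ∈ Finset.range i, dist (y m) (y (m + 1)) := by
      rw [← hy0]; exact dist_le_range_sum_dist y i
    refine hsum.trans ((Finset.sum_le_sum (g := fun m => δ * (Real.exp A₂ * bdist Ω (y i) ^ s) *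
      Real.exp (-ω) ^ (i - m)) fun m hm => ?_).trans ?_)
    · have hm' := Finset.mem_range.1 hm
      refine (hyd m (by omega)).trans ?_
      rw [mul_assoc]
      exact mul_le_mul_of_nonneg_left (hkey i hi m hm'.le) hδ.le
    · rw [← Finset.mul_sum]
      have hρs : 0 ≤ bdist Ω (y i) ^ s := Real.rpow_nonneg (hρ i hi).le _
      have h1 : ∑ m ∈ Finset.range i, Real.exp (-ω) ^ (i - m) ≤ (1 - Real.exp (-ω))⁻¹ := by
        refine le_trans ?_ (sum_pow_sub_le (Real.exp_pos (-ω)).le hr1 i)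
        rw [Finset.sum_range_succ]
        exact le_add_of_nonneg_right (by positivity)
      calc _ ≤ δ * (Real.exp A₂ * bdist Ω (y i) ^ s) * (1 - Real.exp (-ω))⁻¹ :=
            mul_le_mul_of_nonneg_left h1 (by positivity)
        _ = C₁ * bdist Ω (y i) ^ s := by rw [hC₁]; ring
        _ ≤ _ := mul_le_mul_of_nonneg_right (le_max_left _ _) hρs
  · have h1 : L i ≤ A₁ + (N - i : ℕ) * -(β * κ) := by
      have := mul_le_mul_of_nonneg_left (hkN i hi) hβ.le
      have := ha i hi
      linarith
    have h2 := Real.exp_le_exp.2 h1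
    rw [Real.exp_add, Real.exp_nat_mul, show Real.exp (L i) = bdist Ω (y i) from
      Real.exp_log (hρ i hi)] at h2
    exact h2.trans (mul_le_mul_of_nonneg_right (le_max_right _ _) (by positivity))

end chains

theorem exists_exponents {β p A c : ℝ} (hβ0 : 0 < β) (hβ : β ≤ 1) (hp : 0 < p)
    (h : c < A * (2 * β / (1 + β))) :
    ∃ δ l s σ : ℝ, 0 < δ ∧ δ ≤ 1 / 32 ∧ 0 ≤ l ∧ l ≤ 1 ∧
      l * (δ / (1 - δ)) < (1 - l) * (β * (δ / (1 + 2 * δ))) ∧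
      s = l + (1 - l) * (β * (1 / (1 + 2 * δ))) ∧ 0 < s ∧ s ≤ 1 ∧ 0 < σ ∧
      c + σ * p ≤ s * A := by
  set l : ℝ → ℝ := fun δ => β * (1 - 4 * δ) / (1 + β * (1 - 4 * δ)) with hl
  set s : ℝ → ℝ := fun δ => l δ + (1 - l δ) * (β * (1 / (1 + 2 * δ))) with hs
  have hs0 : s 0 = 2 * β / (1 + β) := by
    simp only [hs, hl]
    have : (1 + β) ≠ 0 := by positivity
    field_simp
    ring
  have hlc : ContinuousAt l 0 := by
    refine ContinuousAt.div (by fun_prop) (by fun_prop) ?_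
    simp only [mul_zero, sub_zero, mul_one]
    positivity
  have hsc : ContinuousAt s 0 := by
    refine hlc.add ((continuousAt_const.sub hlc).mul (continuousAt_const.mul ?_))
    exact ContinuousAt.div (by fun_prop) (by fun_prop) (by norm_num)
  have hev : ∀ᶠ δ in 𝓝[>] (0 : ℝ), c < s δ * A := by
    have h1 : Tendsto (fun δ => s δ * A) (𝓝[>] 0) (𝓝 (s 0 * A)) :=
      (hsc.tendsto.mono_left nhdsWithin_le_nhds).mul_const A
    refine h1.eventually_const_lt ?_
    rw [hs0]
    linarith
  have hev2 : ∀ᶠ δ in 𝓝[>] (0 : ℝ), δ ∈ Ioc (0 : ℝ) (1 / 32) :=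
    Ioc_mem_nhdsGT (by norm_num)
  obtain ⟨δ, hδA, hδ0, hδ⟩ := (hev.and hev2).exists
  have hβ' : 0 < β * (1 - 4 * δ) := mul_pos hβ0 (by linarith)
  have h1l : 1 - l δ = 1 / (1 + β * (1 - 4 * δ)) := by
    simp only [hl]
    field_simp
    ring
  have hl0 : 0 < l δ := by simp only [hl]; positivity
  have hl1 : 0 < 1 - l δ := by rw [h1l]; positivity
  have hx0 : 0 < β * (1 / (1 + 2 * δ)) := by positivity
  have hx1 : β * (1 / (1 + 2 * δ)) ≤ 1 := by
    rw [mul_one_div, div_le_one (by positivity)]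
    linarith
  refine ⟨δ, l δ, s δ, (s δ * A - c) / p, hδ0, hδ, hl0.le, by linarith, ?_, rfl, ?_, ?_,
    div_pos (by linarith) hp, ?_⟩
  · rw [h1l]
    simp only [hl]
    rw [div_mul_div_comm, one_div_mul_eq_div, mul_div_assoc', div_div,
      mul_comm (1 + 2 * δ), ← div_div, ← div_div _ (1 + _)]
    rw [div_div, div_div, div_lt_div_iff₀ (by nlinarith) (by positivity)]
    have : (1 - 4 * δ) * (1 + 2 * δ) < 1 - δ := by nlinarith
    have h2 : 0 < β * δ * (1 + β * (1 - 4 * δ)) := by positivity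
    nlinarith [mul_lt_mul_of_pos_left this h2]
  · simp only [hs]; positivity
  · simp only [hs]
    nlinarith
  · rw [div_mul_cancel₀ _ hp.ne']
    linarith

theorem exists_holder_chain {n : ℕ} {Ω : Set (Evec n)} (hΩ : IsBoundedDomain Ω) (hu : Ω ≠ univ)
    {β p A c : ℝ} (hβ0 : 0 < β) (hβ : β ≤ 1) (hq : QHBC Ω β) (hp : 0 < p)
    (h : c < A * (2 * β / (1 + β))) :
    ∃ s σ : ℝ, 0 < s ∧ s ≤ 1 ∧ 0 < σ ∧ c + σ * p ≤ s * A ∧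
      ∃ x₀ ∈ Ω, ∃ C > 0, ∃ q : ℝ, 0 < q ∧ q < 1 ∧ ∀ x ∈ Ω, ∃ N : ℕ, ∃ y : ℕ → Evec n,
        y 0 = x ∧ y N = x₀ ∧ (∀ i ≤ N, y i ∈ Ω) ∧
        (∀ i < N, dist (y i) (y (i + 1)) ≤ 1 / 32 * bdist Ω (y i)) ∧
        (∀ i ≤ N, dist x (y i) ≤ C * bdist Ω (y i) ^ s) ∧
        ∀ i ≤ N, bdist Ω (y i) ≤ C * q ^ (N - i) := by
  obtain ⟨δ, l, s, σ, hδ0, hδ, hl0, hl1, hτ, hs, hs0, hs1, hσ, hc⟩ :=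
    exists_exponents hβ0 hβ hp h
  obtain ⟨x₀, hx₀, C, hC, q, hq0, hq1, H⟩ :=
    exists_chain hΩ hu hβ0 hq hδ0 (by linarith) hl0 hl1 hτ
  refine ⟨s, σ, hs0, hs1, hσ, hc, x₀, hx₀, C, hC, q, hq0, hq1, fun x hx => ?_⟩
  obtain ⟨N, y, hy0, hyN, hyΩ, hyd, hyx, hyq⟩ := H x hx
  refine ⟨N, y, hy0, hyN, hyΩ, fun i hi => (hyd i hi).trans ?_, fun i hi => ?_, hyq⟩
  · exact mul_le_mul_of_nonneg_right hδ (bdist_nonneg _ _)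
  · rw [hs]; exact hyx i hi

theorem ofReal_norm_sub_rpow_le {E : Type*} [SeminormedAddCommGroup E] {p : ℝ} (hp : 1 ≤ p)
    (a b c : E) :
    ENNReal.ofReal ‖a - c‖ ^ p ≤
      2 ^ (p - 1) * (ENNReal.ofReal ‖b - a‖ ^ p + ENNReal.ofReal ‖b - c‖ ^ p) := by
  refine le_trans ?_ (ENNReal.rpow_add_le_mul_rpow_add_rpow _ _ hp)
  refine ENNReal.rpow_le_rpow ?_ (by linarith)
  rw [← ENNReal.ofReal_add (norm_nonneg _) (norm_nonneg _)]
  refine ENNReal.ofReal_le_ofReal ?_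
  rw [norm_sub_rev b a]
  exact norm_sub_le_norm_sub_add_norm_sub a b c

theorem ofReal_norm_sub_rpow_mul_measure_le {α E : Type*} [MeasurableSpace α]
    [NormedAddCommGroup E] [MeasurableSpace E] [BorelSpace E]
    {μ : Measure α} {p : ℝ} (hp : 1 ≤ p) {f : α → E} (a c : E) (S : Set α)
    (hfa : Measurable fun x => f x - a) :
    ENNReal.ofReal ‖a - c‖ ^ p * μ S ≤
      2 ^ (p - 1) * ((∫⁻ x in S, ENNReal.ofReal ‖f x - a‖ ^ p ∂μ) +
        ∫⁻ x in S, ENNReal.ofReal ‖f x - c‖ ^ p ∂μ) := by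
  rw [← lintegral_add_left ((hfa.norm.ennreal_ofReal).pow_const _),
    ← lintegral_const_mul' _ _ (by finiteness), ← setLIntegral_const]
  exact lintegral_mono fun x => ofReal_norm_sub_rpow_le hp a (f x) c

section rotations

variable {n : ℕ} {Ω : Set (Evec n)} (hΩ : IsBoundedDomain Ω) (hu : Ω ≠ univ)
include hΩ hu

theorem ofReal_norm_sub_rpow_mul_volume_le {p : ℝ} (hp : 1 ≤ p) {v : Evec n → Evec n}
    {e : Evec n → ℝ≥0∞} {L : Evec n → Evec n →L[ℝ] Evec n}
    (hL : ∀ z ∈ Ω, ∫⁻ x in Metric.ball z (bdist Ω z / 8), ENNReal.ofReal ‖fderiv ℝ v x - L z‖ ^ p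
      ≤ e z)
    {z z' : Evec n} (hz : z ∈ Ω) (hz' : z' ∈ Ω) (hd : dist z z' ≤ 1 / 32 * bdist Ω z) :
    ENNReal.ofReal ‖L z - L z'‖ ^ p * volume (Metric.ball z (bdist Ω z / 16)) ≤
      2 ^ (p - 1) * (e z + e z') := by
  have hρ := bdist_pos hΩ hu hz
  have h1 : Metric.ball z (bdist Ω z / 16) ⊆ Metric.ball z (bdist Ω z / 8) :=
    Metric.ball_subset_ball (by linarith)
  have h2 : Metric.ball z (bdist Ω z / 16) ⊆ Metric.ball z' (bdist Ω z' / 8) := by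
    refine Metric.ball_subset_ball' ?_
    have := bdist_le_add_dist Ω z z'
    linarith
  refine (ofReal_norm_sub_rpow_mul_measure_le hp _ _ _
    ((measurable_fderiv ℝ v).sub_const _)).trans ?_
  gcongr
  · exact (lintegral_mono_set h1).trans (hL z hz)
  · exact (lintegral_mono_set h2).trans (hL z' hz')

end rotations

/-- The potential `∫ F ρ^{-m}` over the points `y ∈ Ω` with `|x - y| ≤ C ρ(y)^s`. -/
def conePotential {n : ℕ} (Ω : Set (Evec n)) (F : Evec n → ℝ≥0∞) (m s C : ℝ) (x : Evec n) :
    ℝ≥0∞ :=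
  ∫⁻ y in Ω ∩ {y | dist x y ≤ C * bdist Ω y ^ s}, F y * ENNReal.ofReal (bdist Ω y ^ (-m))

theorem le_mul_rpow_of_le {t R s : ℝ} (ht : 0 < t) (htR : t ≤ R) (hR : 1 ≤ R) (hs0 : 0 ≤ s)
    (hs1 : s ≤ 1) : t ≤ R * t ^ s := by
  have h : t ^ (1 - s) ≤ R := by
    calc t ^ (1 - s) ≤ R ^ (1 - s) := Real.rpow_le_rpow ht.le htR (by linarith)
      _ ≤ R ^ (1 : ℝ) := Real.rpow_le_rpow_of_exponent_le hR (by linarith)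
      _ = R := Real.rpow_one _
  calc t = t ^ (1 - s) * t ^ s := by rw [← Real.rpow_add ht]; simp
    _ ≤ R * t ^ s := by gcongr

theorem setLIntegral_le_conePotential {n : ℕ} {Ω : Set (Evec n)} (hΩ : IsBoundedDomain Ω)
    (hu : Ω ≠ univ) (F : Evec n → ℝ≥0∞) {m s C R : ℝ} (hm : 0 ≤ m) (hs0 : 0 < s) (hs1 : s ≤ 1)
    (hC : 0 < C) (hR1 : 1 ≤ R) (hR : ∀ x ∈ Ω, bdist Ω x ≤ R) {x z : Evec n} (hz : z ∈ Ω)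
    (hxz : dist x z ≤ C * bdist Ω z ^ s) :
    ∫⁻ y in Metric.ball z (bdist Ω z / 4), F y ≤
      ENNReal.ofReal (2 ^ m * bdist Ω z ^ m) * conePotential Ω F m s (2 * (C + R)) x := by
  have hρ := bdist_pos hΩ hu hz
  have hsub : Metric.ball z (bdist Ω z / 4) ⊆ Ω :=
    (Metric.ball_subset_ball (by linarith)).trans (ball_bdist_subset hΩ hz)
  have hsub2 : Metric.ball z (bdist Ω z / 4) ⊆
      Ω ∩ {y | dist x y ≤ 2 * (C + R) * bdist Ω y ^ s} := by
    intro y hy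
    refine ⟨hsub hy, ?_⟩
    have hyz : dist z y < bdist Ω z / 4 := by rw [dist_comm]; exact hy
    have h1 := bdist_le_add_dist Ω z y
    have h2 : bdist Ω z ≤ 2 * bdist Ω y := by linarith
    have hρy : 0 < bdist Ω y := by linarith
    have h3 : bdist Ω z ^ s ≤ 2 * bdist Ω y ^ s := by
      calc bdist Ω z ^ s ≤ (2 * bdist Ω y) ^ s := Real.rpow_le_rpow hρ.le h2 hs0.le
        _ = 2 ^ s * bdist Ω y ^ s := Real.mul_rpow (by norm_num) hρy.le
        _ ≤ 2 ^ (1 : ℝ) * bdist Ω y ^ s := by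
            gcongr
            norm_num
        _ = 2 * bdist Ω y ^ s := by rw [Real.rpow_one]
    have h4 : bdist Ω z ≤ R * bdist Ω z ^ s := le_mul_rpow_of_le hρ (hR z hz) hR1 hs0.le hs1
    have h6 := dist_triangle x z y
    calc dist x y ≤ C * bdist Ω z ^ s + R * bdist Ω z ^ s := by linarith
      _ = (C + R) * bdist Ω z ^ s := by ring
      _ ≤ (C + R) * (2 * bdist Ω y ^ s) := by gcongr
      _ = 2 * (C + R) * bdist Ω y ^ s := by ring
  rw [conePotential, ← lintegral_const_mul' _ _ ENNReal.ofReal_ne_top]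
  refine le_trans ?_ (lintegral_mono_set hsub2)
  refine setLIntegral_mono' measurableSet_ball fun y hy => ?_
  have hyz : dist y z < bdist Ω z / 4 := hy
  have h1 := bdist_le_add_dist Ω y z
  have hρy : 0 < bdist Ω y := bdist_pos hΩ hu (hsub hy)
  have h2 : 1 ≤ 2 ^ m * bdist Ω z ^ m * bdist Ω y ^ (-m) := by
    rw [Real.rpow_neg hρy.le, ← div_eq_mul_inv, one_le_div (by positivity),
      ← Real.mul_rpow (by norm_num) hρ.le]
    exact Real.rpow_le_rpow hρy.le (by linarith) hm
  calc F y = F y * 1 := (mul_one _).symm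
    _ ≤ F y * ENNReal.ofReal (2 ^ m * bdist Ω z ^ m * bdist Ω y ^ (-m)) := by
        gcongr
        exact ENNReal.one_le_ofReal.2 h2
    _ = _ := by
        rw [ENNReal.ofReal_mul (by positivity)]
        ring

theorem ofReal_norm_sub_rpow_le_of_chain {E : Type*} [SeminormedAddCommGroup E] {p : ℝ}
    (hp : 0 < p) {M : ℝ≥0∞} {σ C q : ℝ} (hσ : 0 < σ) (hC : 0 < C) (hq0 : 0 < q) (hq1 : q < 1)
    {N : ℕ} {w : ℕ → E} {ρ : ℕ → ℝ} (hρ0 : ∀ i ≤ N, 0 ≤ ρ i)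
    (hρ : ∀ i ≤ N, ρ i ≤ C * q ^ (N - i))
    (hw : ∀ i < N, ENNReal.ofReal ‖w i - w (i + 1)‖ ^ p ≤ M * ENNReal.ofReal (ρ i ^ (σ * p))) :
    ENNReal.ofReal ‖w 0 - w N‖ ^ p ≤
      ENNReal.ofReal (C ^ σ * (1 - q ^ σ)⁻¹) ^ p * M := by
  have hpi : p * p⁻¹ = 1 := mul_inv_cancel₀ hp.ne'
  have hqσ : q ^ σ < 1 := Real.rpow_lt_one hq0.le hq1 hσ
  have hstep : ∀ i < N, ENNReal.ofReal ‖w i - w (i + 1)‖ ≤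
      M ^ p⁻¹ * ENNReal.ofReal (C ^ σ * (q ^ σ) ^ (N - i)) := by
    intro i hi
    have h := ENNReal.rpow_le_rpow (hw i hi) (inv_nonneg.2 hp.le)
    rw [← ENNReal.rpow_mul, hpi, ENNReal.rpow_one,
      ENNReal.mul_rpow_of_nonneg _ _ (inv_nonneg.2 hp.le),
      ENNReal.ofReal_rpow_of_nonneg (Real.rpow_nonneg (hρ0 i hi.le) _) (inv_nonneg.2 hp.le),
      ← Real.rpow_mul (hρ0 i hi.le), mul_assoc, hpi, mul_one] at h
    refine h.trans ?_
    gcongr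
    calc ρ i ^ σ ≤ (C * q ^ (N - i)) ^ σ :=
          Real.rpow_le_rpow (hρ0 i hi.le) (hρ i hi.le) hσ.le
      _ = C ^ σ * (q ^ σ) ^ (N - i) := by
          rw [Real.mul_rpow hC.le (by positivity), ← Real.rpow_natCast, ← Real.rpow_natCast,
            ← Real.rpow_mul hq0.le, ← Real.rpow_mul hq0.le, mul_comm (_ : ℝ) σ]
  have htri : ‖w 0 - w N‖ ≤ ∑ i ∈ Finset.range N, ‖w i - w (i + 1)‖ := by
    have h := dist_le_range_sum_dist w N
    simpa only [dist_eq_norm] using h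
  have hsum : ENNReal.ofReal ‖w 0 - w N‖ ≤
      M ^ p⁻¹ * ENNReal.ofReal (C ^ σ * (1 - q ^ σ)⁻¹) := by
    calc ENNReal.ofReal ‖w 0 - w N‖
        ≤ ENNReal.ofReal (∑ i ∈ Finset.range N, ‖w i - w (i + 1)‖) :=
          ENNReal.ofReal_le_ofReal htri
      _ = ∑ i ∈ Finset.range N, ENNReal.ofReal ‖w i - w (i + 1)‖ :=
          ENNReal.ofReal_sum_of_nonneg fun _ _ => norm_nonneg _
      _ ≤ ∑ i ∈ Finset.range N, M ^ p⁻¹ * ENNReal.ofReal (C ^ σ * (q ^ σ) ^ (N - i)) :=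
          Finset.sum_le_sum fun i hi => hstep i (Finset.mem_range.1 hi)
      _ = M ^ p⁻¹ * ENNReal.ofReal (C ^ σ * ∑ i ∈ Finset.range N, (q ^ σ) ^ (N - i)) := by
          rw [← Finset.mul_sum, Finset.mul_sum _ _ (C ^ σ), ENNReal.ofReal_sum_of_nonneg]
          intro i _
          positivity
      _ ≤ M ^ p⁻¹ * ENNReal.ofReal (C ^ σ * (1 - q ^ σ)⁻¹) := by
          gcongr
          refine le_trans ?_ (sum_pow_sub_le (Real.rpow_nonneg hq0.le σ) hqσ N)
          refine Finset.sum_le_sum_of_subset_of_nonneg (Finset.range_mono (Nat.le_succ N)) ?_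
          intro i _ _
          positivity
  refine (ENNReal.rpow_le_rpow hsum hp.le).trans ?_
  rw [ENNReal.mul_rpow_of_nonneg _ _ hp.le, ← ENNReal.rpow_mul, mul_comm p⁻¹, hpi,
    ENNReal.rpow_one, mul_comm]

theorem volume_ball_ne_top_and_ne_zero {n : ℕ} :
    volume (Metric.ball (0 : Evec n) 1) ≠ 0 ∧ volume (Metric.ball (0 : Evec n) 1) ≠ ⊤ :=
  ⟨(Metric.measure_ball_pos _ _ one_pos).ne', measure_ball_lt_top.ne⟩

theorem volume_ball_eq {n : ℕ} (z : Evec n) {r : ℝ} (hr : 0 < r) :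
    volume (Metric.ball z r) = ENNReal.ofReal (r ^ n) * volume (Metric.ball (0 : Evec n) 1) := by
  rw [Measure.addHaar_ball_of_pos _ _ hr, finrank_euclideanSpace_fin]

section rotations

variable {n : ℕ} {Ω : Set (Evec n)} (hΩ : IsBoundedDomain Ω) (hu : Ω ≠ univ)
include hΩ hu

theorem exists_ofReal_norm_sub_step_le {p σ s C R : ℝ} (hp : 1 ≤ p) (hσ : 0 < σ)
    (hs0 : 0 < s) (hs1 : s ≤ 1) (hC : 0 < C) (hR1 : 1 ≤ R) (hR : ∀ x ∈ Ω, bdist Ω x ≤ R)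
    {K : ℝ≥0∞} (hK : K ≠ ⊤) :
    ∃ M : ℝ≥0∞, M ≠ ⊤ ∧ ∀ (v : Evec n → Evec n) (F : Evec n → ℝ≥0∞)
      (L : Evec n → Evec n →L[ℝ] Evec n),
      (∀ z ∈ Ω, ∫⁻ x in Metric.ball z (bdist Ω z / 8), ENNReal.ofReal ‖fderiv ℝ v x - L z‖ ^ p
        ≤ K * ∫⁻ x in Metric.ball z (bdist Ω z / 4), F x) →
      ∀ x, ∀ z ∈ Ω, ∀ z' ∈ Ω, dist x z ≤ C * bdist Ω z ^ s → dist x z' ≤ C * bdist Ω z' ^ s →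
        dist z z' ≤ 1 / 32 * bdist Ω z →
        ENNReal.ofReal ‖L z - L z'‖ ^ p ≤
          M * conePotential Ω F (n + σ * p) s (2 * (C + R)) x *
            ENNReal.ofReal (bdist Ω z ^ (σ * p)) := by
  obtain ⟨hω0, hω⟩ := volume_ball_ne_top_and_ne_zero (n := n)
  set ω := volume (Metric.ball (0 : Evec n) 1) with hωd
  set m : ℝ := n + σ * p with hm
  have hm0 : 0 ≤ m := by positivity
  refine ⟨2 ^ (p - 1) * (K * (ENNReal.ofReal (2 ^ m) * (1 + ENNReal.ofReal (2 ^ m)))) *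
    (ENNReal.ofReal (16 ^ n) * ω⁻¹), by finiteness, ?_⟩
  intro v F L hL x z hz z' hz' hxz hxz' hd
  have hρ := bdist_pos hΩ hu hz
  have hρ' := bdist_pos hΩ hu hz'
  set P := conePotential Ω F m s (2 * (C + R)) x with hP
  have h1 := ofReal_norm_sub_rpow_mul_volume_le hΩ hu hp hL hz hz' hd
  have h2 := setLIntegral_le_conePotential hΩ hu F hm0 hs0 hs1 hC hR1 hR hz hxz
  have h3 := setLIntegral_le_conePotential hΩ hu F hm0 hs0 hs1 hC hR1 hR hz' hxz'
  have hle : bdist Ω z' ≤ 2 * bdist Ω z := by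
    have := bdist_le_add_dist Ω z' z
    rw [dist_comm] at this
    linarith
  have h4 : ENNReal.ofReal (2 ^ m * bdist Ω z' ^ m) ≤
      ENNReal.ofReal (2 ^ m) * ENNReal.ofReal (2 ^ m) * ENNReal.ofReal (bdist Ω z ^ m) := by
    rw [← ENNReal.ofReal_mul (by positivity), ← ENNReal.ofReal_mul (by positivity), mul_assoc,
      ← Real.mul_rpow (by norm_num) hρ.le]
    gcongr
  set V := volume (Metric.ball z (bdist Ω z / 16)) with hV
  have hV0 : V ≠ 0 := (Metric.measure_ball_pos _ _ (by positivity)).ne'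
  have hVt : V ≠ ⊤ := measure_ball_lt_top.ne
  have hVeq : ENNReal.ofReal (16 ^ n) * ω⁻¹ * V = ENNReal.ofReal (bdist Ω z ^ n) := by
    rw [hV, volume_ball_eq z (by positivity), ← hωd]
    calc ENNReal.ofReal (16 ^ n) * ω⁻¹ * (ENNReal.ofReal ((bdist Ω z / 16) ^ n) * ω)
        = ENNReal.ofReal (16 ^ n) * ENNReal.ofReal ((bdist Ω z / 16) ^ n) * (ω⁻¹ * ω) := by ring
      _ = ENNReal.ofReal (bdist Ω z ^ n) := by
          rw [ENNReal.inv_mul_cancel hω0 hω, mul_one, ← ENNReal.ofReal_mul (by positivity),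
            ← mul_pow, mul_div_cancel₀ _ (by norm_num)]
  have hpow : ENNReal.ofReal (bdist Ω z ^ n) * ENNReal.ofReal (bdist Ω z ^ (σ * p)) =
      ENNReal.ofReal (bdist Ω z ^ m) := by
    rw [← ENNReal.ofReal_mul (by positivity), hm, Real.rpow_add hρ, Real.rpow_natCast]
  rw [← ENNReal.mul_le_mul_iff_left hV0 hVt]
  refine h1.trans ?_
  calc 2 ^ (p - 1) * (K * (∫⁻ x in Metric.ball z (bdist Ω z / 4), F x) +
        K * ∫⁻ x in Metric.ball z' (bdist Ω z' / 4), F x)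
      ≤ 2 ^ (p - 1) * (K * (ENNReal.ofReal (2 ^ m) * ENNReal.ofReal (bdist Ω z ^ m) * P) +
        K * (ENNReal.ofReal (2 ^ m) * ENNReal.ofReal (2 ^ m) *
          ENNReal.ofReal (bdist Ω z ^ m) * P)) := by
        gcongr
        · rwa [← ENNReal.ofReal_mul (by positivity)]
        · exact h3.trans (mul_le_mul' h4 le_rfl)
    _ = 2 ^ (p - 1) * (K * (ENNReal.ofReal (2 ^ m) * (1 + ENNReal.ofReal (2 ^ m)))) *
          (P * ENNReal.ofReal (bdist Ω z ^ m)) := by ring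
    _ = _ := by
        rw [← hpow, ← hVeq]
        ring

end rotations

section averages

variable {n : ℕ} {Ω : Set (Evec n)} (hΩ : IsBoundedDomain Ω) (hu : Ω ≠ univ)
include hΩ

theorem exists_local_rotation {p : ℝ} (hu : Ω ≠ univ) (hp : 1 < p) :
    ∃ K : ℝ≥0∞, K ≠ ⊤ ∧ ∀ v : Evec n → Evec n, DifferentiableOn ℝ v Ω →
      ∃ L : Evec n → Evec n →L[ℝ] Evec n, ∀ z ∈ Ω,
        ∫⁻ x in Metric.ball z (bdist Ω z / 8), ENNReal.ofReal ‖fderiv ℝ v x - L z‖ ^ p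
          ≤ K * ∫⁻ x in Metric.ball z (bdist Ω z / 4), ENNReal.ofReal (epsLen v x) ^ p ∧
        ENNReal.ofReal ‖L z‖ ^ p ≤
          K * (ENNReal.ofReal (bdist Ω z / 8)⁻¹ ^ p * ENNReal.ofReal |((bdist Ω z / 8) ^ n)⁻¹|) *
            ∫⁻ x in Metric.ball z (bdist Ω z / 4), ENNReal.ofReal ‖v x‖ ^ p := by
  obtain ⟨K, hK, H⟩ := exists_local_korn n hp
  refine ⟨K, hK, fun v hv => ?_⟩
  have hex : ∀ z : Ω, ∃ L : Evec n →L[ℝ] Evec n,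
        ∫⁻ x in Metric.ball z.1 (bdist Ω z / 8), ENNReal.ofReal ‖fderiv ℝ v x - L‖ ^ p
          ≤ K * ∫⁻ x in Metric.ball z.1 (bdist Ω z / 4), ENNReal.ofReal (epsLen v x) ^ p ∧
        ENNReal.ofReal ‖L‖ ^ p ≤
          K * (ENNReal.ofReal (bdist Ω z / 8)⁻¹ ^ p * ENNReal.ofReal |((bdist Ω z / 8) ^ n)⁻¹|) *
            ∫⁻ x in Metric.ball z.1 (bdist Ω z / 4), ENNReal.ofReal ‖v x‖ ^ p := by
    rintro ⟨z, hz⟩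
    have hρ := bdist_pos hΩ hu hz
    have h2 : 2 * (bdist Ω z / 8) = bdist Ω z / 4 := by ring
    have h := H v z (bdist Ω z / 8) (by positivity) fun x hx => by
      refine hv.differentiableAt (hΩ.1.mem_nhds (ball_bdist_subset hΩ hz ?_))
      exact Metric.ball_subset_ball (by linarith) hx
    rwa [h2] at h
  choose L hL using hex
  classical
  refine ⟨fun z => if hz : z ∈ Ω then L ⟨z, hz⟩ else 0, fun z hz => ?_⟩
  simpa only [dif_pos hz] using hL ⟨z, hz⟩

include hu

theorem exists_setLIntegral_fderiv_le {β p A c : ℝ} (hβ0 : 0 < β) (hβ : β ≤ 1) (hq : QHBC Ω β)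
    (hp : 1 < p) (h : c < A * (2 * β / (1 + β))) :
    ∃ s σ C : ℝ, 0 < s ∧ s ≤ 1 ∧ 0 < σ ∧ 0 < C ∧ c + σ * p ≤ s * A ∧
      ∃ x₀ ∈ Ω, ∃ M : ℝ≥0∞, M ≠ ⊤ ∧ ∀ v : Evec n → Evec n, DifferentiableOn ℝ v Ω →
        ∀ x ∈ Ω, ∫⁻ y in Metric.ball x (bdist Ω x / 8), ENNReal.ofReal ‖fderiv ℝ v y‖ ^ p ≤
          M * ENNReal.ofReal (bdist Ω x ^ n) *
            (conePotential Ω (fun y => ENNReal.ofReal (epsLen v y) ^ p) (n + σ * p) s C x +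
              ∫⁻ y in Metric.ball x₀ (bdist Ω x₀ / 4), ENNReal.ofReal ‖v y‖ ^ p) := by
  have hp0 : 0 < p := by linarith
  obtain ⟨s, σ, hs0, hs1, hσ, hc, x₀, hx₀, C, hC, q, hq0, hq1, hchain⟩ :=
    exists_holder_chain hΩ hu hβ0 hβ hq hp0 h
  obtain ⟨R, hR1, hR⟩ := exists_bdist_le hΩ hu
  obtain ⟨K, hK, hrot⟩ := exists_local_rotation hΩ hu hp
  obtain ⟨M, hM, hstep⟩ := exists_ofReal_norm_sub_step_le hΩ hu hp.le hσ hs0 hs1 hC hR1 hR hK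
  obtain ⟨-, hω⟩ := volume_ball_ne_top_and_ne_zero (n := n)
  set ω := volume (Metric.ball (0 : Evec n) 1) with hωd
  set K₀ := K * (ENNReal.ofReal (bdist Ω x₀ / 8)⁻¹ ^ p *
    ENNReal.ofReal |((bdist Ω x₀ / 8) ^ n)⁻¹|) with hK₀
  have hK₀t : K₀ ≠ ⊤ := by
    rw [hK₀]
    finiteness
  set m : ℝ := n + σ * p with hm
  have hm0 : 0 ≤ m := by positivity
  set B := ENNReal.ofReal (C ^ σ * (1 - q ^ σ)⁻¹) ^ p * M with hB
  have hBt : B ≠ ⊤ := by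
    rw [hB]
    finiteness
  refine ⟨s, σ, 2 * (C + R), hs0, hs1, hσ, by positivity, hc, x₀, hx₀,
    2 ^ (p - 1) * (K * ENNReal.ofReal (2 ^ m * R ^ (σ * p)) + 2 ^ (p - 1) * (B + K₀) * ω),
    by finiteness, ?_⟩
  intro v hv x hx
  obtain ⟨L, hL⟩ := hrot v hv
  have hρ := bdist_pos hΩ hu hx
  obtain ⟨N, y, hy0, hyN, hyΩ, hyd, hyx, hyq⟩ := hchain x hx
  set P := conePotential Ω (fun y => ENNReal.ofReal (epsLen v y) ^ p) m s (2 * (C + R)) x with hP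
  set V := ∫⁻ y in Metric.ball x₀ (bdist Ω x₀ / 4), ENNReal.ofReal ‖v y‖ ^ p with hV
  have hdiff : ENNReal.ofReal ‖L x - L x₀‖ ^ p ≤ B * P := by
    have h := ofReal_norm_sub_rpow_le_of_chain (M := M * P) (w := fun i => L (y i))
      (ρ := fun i => bdist Ω (y i)) hp0 hσ hC hq0 hq1 (fun i _ => bdist_nonneg _ _) hyq
      fun i hi => hstep v _ L (fun z hz => (hL z hz).1) x _ (hyΩ i hi.le) _ (hyΩ (i + 1) hi)
        (hyx i hi.le) (hyx (i + 1) hi) (hyd i hi)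
    simpa only [hy0, hyN, hB, mul_assoc] using h
  have hLx : ENNReal.ofReal ‖L x‖ ^ p ≤ 2 ^ (p - 1) * (B + K₀) * (P + V) := by
    have h := ofReal_norm_sub_rpow_le hp.le (L x) (L x₀) 0
    rw [sub_zero, sub_zero, norm_sub_rev] at h
    calc ENNReal.ofReal ‖L x‖ ^ p ≤ 2 ^ (p - 1) * (B * P + K₀ * V) :=
          h.trans (mul_le_mul' le_rfl (add_le_add hdiff (hL x₀ hx₀).2))
      _ ≤ 2 ^ (p - 1) * ((B + K₀) * P + (B + K₀) * V) := by
          gcongr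
          · exact le_self_add
          · exact le_add_self
      _ = _ := by ring
  have hloc : ∫⁻ y in Metric.ball x (bdist Ω x / 8), ENNReal.ofReal ‖fderiv ℝ v y - L x‖ ^ p ≤
      K * ENNReal.ofReal (2 ^ m * R ^ (σ * p)) * ENNReal.ofReal (bdist Ω x ^ n) * (P + V) := by
    refine (hL x hx).1.trans ?_
    have h := setLIntegral_le_conePotential hΩ hu
      (fun y => ENNReal.ofReal (epsLen v y) ^ p) hm0 hs0 hs1 hC hR1 hR hx
      (x := x) (by rw [dist_self]; positivity)
    calc K * ∫⁻ x in Metric.ball x (bdist Ω x / 4), ENNReal.ofReal (epsLen v x) ^ p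
        ≤ K * (ENNReal.ofReal (2 ^ m * bdist Ω x ^ m) * P) := mul_le_mul' le_rfl h
      _ ≤ K * (ENNReal.ofReal (2 ^ m * R ^ (σ * p) * bdist Ω x ^ n) * (P + V)) := by
          refine mul_le_mul' le_rfl (mul_le_mul' (ENNReal.ofReal_le_ofReal ?_) le_self_add)
          rw [hm, Real.rpow_add hρ, Real.rpow_natCast, mul_assoc, mul_comm (bdist Ω x ^ n)]
          gcongr
          exact hR x hx
      _ = _ := by
          rw [ENNReal.ofReal_mul (by positivity)]
          ring
  have hvol : volume (Metric.ball x (bdist Ω x / 8)) ≤ ENNReal.ofReal (bdist Ω x ^ n) * ω := by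
    rw [volume_ball_eq x (by positivity)]
    gcongr
    linarith
  calc ∫⁻ y in Metric.ball x (bdist Ω x / 8), ENNReal.ofReal ‖fderiv ℝ v y‖ ^ p
      ≤ ∫⁻ y in Metric.ball x (bdist Ω x / 8), 2 ^ (p - 1) *
          (ENNReal.ofReal ‖fderiv ℝ v y - L x‖ ^ p + ENNReal.ofReal ‖L x‖ ^ p) := by
        refine lintegral_mono fun y => ?_
        have h := ofReal_norm_sub_rpow_le hp.le (fderiv ℝ v y) (L x) 0
        rwa [sub_zero, sub_zero, norm_sub_rev] at h
    _ = 2 ^ (p - 1) * ((∫⁻ y in Metric.ball x (bdist Ω x / 8),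
          ENNReal.ofReal ‖fderiv ℝ v y - L x‖ ^ p) +
          ENNReal.ofReal ‖L x‖ ^ p * volume (Metric.ball x (bdist Ω x / 8))) := by
        rw [lintegral_const_mul' _ _ (by finiteness), lintegral_add_right _ measurable_const,
          setLIntegral_const]
    _ ≤ 2 ^ (p - 1) * (K * ENNReal.ofReal (2 ^ m * R ^ (σ * p)) *
          ENNReal.ofReal (bdist Ω x ^ n) * (P + V) +
          2 ^ (p - 1) * (B + K₀) * (P + V) * (ENNReal.ofReal (bdist Ω x ^ n) * ω)) :=
        mul_le_mul' le_rfl (add_le_add hloc (mul_le_mul' hLx hvol))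
    _ = _ := by ring

end averages

theorem lintegral_mul_setLIntegral_swap {α γ : Type*} [MeasurableSpace α] [MeasurableSpace γ]
    {μ : Measure α} {ν : Measure γ} [SFinite μ] [SFinite ν] {f : α → ℝ≥0∞} {g : γ → ℝ≥0∞}
    (hf : Measurable f) (hg : Measurable g) {S : Set (α × γ)} (hS : MeasurableSet S) :
    ∫⁻ x, f x * ∫⁻ y in {y | (x, y) ∈ S}, g y ∂ν ∂μ =
      ∫⁻ y, g y * ∫⁻ x in {x | (x, y) ∈ S}, f x ∂μ ∂ν := by
  have hm : Measurable (S.indicator fun z : α × γ => f z.1 * g z.2) :=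
    ((hf.comp measurable_fst).mul (hg.comp measurable_snd)).indicator hS
  calc ∫⁻ x, f x * ∫⁻ y in {y | (x, y) ∈ S}, g y ∂ν ∂μ
      = ∫⁻ x, ∫⁻ y, S.indicator (fun z : α × γ => f z.1 * g z.2) (x, y) ∂ν ∂μ := by
        refine lintegral_congr fun x => ?_
        rw [← lintegral_const_mul _ hg, ← lintegral_indicator
          (show MeasurableSet {y | (x, y) ∈ S} from measurable_prodMk_left hS)]
        rfl
    _ = ∫⁻ y, ∫⁻ x, S.indicator (fun z : α × γ => f z.1 * g z.2) (x, y) ∂μ ∂ν :=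
        lintegral_lintegral_swap hm.aemeasurable
    _ = _ := by
        refine lintegral_congr fun y => ?_
        rw [← lintegral_const_mul _ hf, ← lintegral_indicator
          (show MeasurableSet {x | (x, y) ∈ S} from measurable_prodMk_right hS)]
        refine lintegral_congr fun x => ?_
        by_cases h : (x, y) ∈ S
        · rw [indicator_of_mem h, indicator_of_mem (show x ∈ {x | (x, y) ∈ S} from h), mul_comm]
        · rw [indicator_of_notMem h, indicator_of_notMem (show x ∉ {x | (x, y) ∈ S} from h)]

section assembly

variable {n : ℕ} {Ω : Set (Evec n)} (hΩ : IsBoundedDomain Ω) (hu : Ω ≠ univ)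
include hΩ hu

theorem exists_setLIntegral_mul_le_average (a : ℝ) (ha : 0 ≤ a) :
    ∃ M : ℝ≥0∞, M ≠ ⊤ ∧ ∀ g : Evec n → ℝ≥0∞, Measurable g →
      ∫⁻ y in Ω, g y * ENNReal.ofReal (bdist Ω y ^ a) ≤
        M * ∫⁻ x in Ω, ENNReal.ofReal (bdist Ω x ^ a * (bdist Ω x ^ n)⁻¹) *
          ∫⁻ y in Metric.ball x (bdist Ω x / 8), g y := by
  obtain ⟨hω0, hω⟩ := volume_ball_ne_top_and_ne_zero (n := n)
  set ω := volume (Metric.ball (0 : Evec n) 1) with hωd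
  have hcont := continuous_bdist Ω
  refine ⟨ENNReal.ofReal (2 ^ a * 32 ^ n) * ω⁻¹, by finiteness, fun g hg => ?_⟩
  have hS : MeasurableSet {z : Evec n × Evec n | dist z.2 z.1 < bdist Ω z.1 / 8} :=
    measurableSet_lt (by fun_prop) ((hcont.comp continuous_fst).measurable.div_const _)
  have hf : Measurable fun x => ENNReal.ofReal (bdist Ω x ^ a * (bdist Ω x ^ n)⁻¹) :=
    ((hcont.measurable.pow_const _).mul (hcont.measurable.pow_const _).inv).ennreal_ofReal
  have hswap := lintegral_mul_setLIntegral_swap (μ := volume.restrict Ω) (ν := volume) hf hg hS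
  have hball : ∀ x, Metric.ball x (bdist Ω x / 8) =
      {y | (x, y) ∈ {z : Evec n × Evec n | dist z.2 z.1 < bdist Ω z.1 / 8}} := fun x => rfl
  simp only [hball]
  rw [hswap, ← lintegral_const_mul' _ _ (by finiteness)]
  refine le_trans ?_ (setLIntegral_le_lintegral Ω _)
  refine setLIntegral_mono' hΩ.1.measurableSet fun y hy => ?_
  have hρ := bdist_pos hΩ hu hy
  have hsub : Metric.ball y (bdist Ω y / 16) ⊆ Ω :=
    (Metric.ball_subset_ball (by linarith)).trans (ball_bdist_subset hΩ hy)
  have hlow : ENNReal.ofReal ((bdist Ω y / 2) ^ a * ((2 * bdist Ω y) ^ n)⁻¹) *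
      volume (Metric.ball y (bdist Ω y / 16)) ≤
      ∫⁻ x in {x | dist y x < bdist Ω x / 8}, ENNReal.ofReal (bdist Ω x ^ a * (bdist Ω x ^ n)⁻¹)
        ∂volume.restrict Ω := by
    rw [Measure.restrict_restrict
      (measurableSet_lt (by fun_prop) (hcont.measurable.div_const _)), ← setLIntegral_const]
    have hsub2 : Metric.ball y (bdist Ω y / 16) ⊆ {x | dist y x < bdist Ω x / 8} ∩ Ω := by
      intro x hx
      refine ⟨?_, hsub hx⟩
      rw [Metric.mem_ball'] at hx
      have := bdist_le_add_dist Ω y x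
      change dist y x < bdist Ω x / 8
      linarith
    refine le_trans ?_ (lintegral_mono_set hsub2)
    refine setLIntegral_mono' measurableSet_ball fun x hx => ENNReal.ofReal_le_ofReal ?_
    have hρx := bdist_pos hΩ hu (hsub hx)
    rw [Metric.mem_ball'] at hx
    have h1 := bdist_le_add_dist Ω y x
    have h2 := bdist_le_add_dist Ω x y
    rw [dist_comm] at h2
    gcongr
    · linarith
    · linarith
  have hkey : ENNReal.ofReal (bdist Ω y ^ a) =
      ENNReal.ofReal (2 ^ a * 32 ^ n) * ω⁻¹ *
        (ENNReal.ofReal ((bdist Ω y / 2) ^ a * ((2 * bdist Ω y) ^ n)⁻¹) *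
          volume (Metric.ball y (bdist Ω y / 16))) := by
    rw [volume_ball_eq y (by positivity), ← hωd]
    have h1 : bdist Ω y ^ a = 2 ^ a * 32 ^ n *
        ((bdist Ω y / 2) ^ a * ((2 * bdist Ω y) ^ n)⁻¹) * (bdist Ω y / 16) ^ n := by
      rw [Real.div_rpow hρ.le (by norm_num), div_pow, mul_pow,
        show (32 : ℝ) = 2 * 16 by norm_num, mul_pow]
      field_simp
    calc ENNReal.ofReal (bdist Ω y ^ a) = ENNReal.ofReal (2 ^ a * 32 ^ n) *
          ENNReal.ofReal ((bdist Ω y / 2) ^ a * ((2 * bdist Ω y) ^ n)⁻¹) *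
            ENNReal.ofReal ((bdist Ω y / 16) ^ n) * (ω⁻¹ * ω) := by
          rw [ENNReal.inv_mul_cancel hω0 hω, mul_one, ← ENNReal.ofReal_mul (by positivity),
            ← ENNReal.ofReal_mul (by positivity), ← h1]
      _ = _ := by ring
  calc g y * ENNReal.ofReal (bdist Ω y ^ a) =
        ENNReal.ofReal (2 ^ a * 32 ^ n) * ω⁻¹ * (g y *
        (ENNReal.ofReal ((bdist Ω y / 2) ^ a * ((2 * bdist Ω y) ^ n)⁻¹) *
          volume (Metric.ball y (bdist Ω y / 16)))) := by
        rw [hkey]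
        ring
    _ ≤ _ := mul_le_mul' le_rfl (mul_le_mul' le_rfl hlow)

theorem exists_setLIntegral_conePotential_le {a s m d C : ℝ} (ha : 0 ≤ a) (hs0 : 0 < s)
    (hs1 : s ≤ 1) (hC : 0 < C) (hd : d + m ≤ s * (a + n)) :
    ∃ M : ℝ≥0∞, M ≠ ⊤ ∧ ∀ F : Evec n → ℝ≥0∞, Measurable F →
      ∫⁻ x in Ω, ENNReal.ofReal (bdist Ω x ^ a) * conePotential Ω F m s C x ≤
        M * ∫⁻ y in Ω, F y * ENNReal.ofReal (bdist Ω y ^ d) := by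
  obtain ⟨-, hω⟩ := volume_ball_ne_top_and_ne_zero (n := n)
  set ω := volume (Metric.ball (0 : Evec n) 1) with hωd
  obtain ⟨R, hR1, hR⟩ := exists_bdist_le hΩ hu
  have hcont := continuous_bdist Ω
  have hmeas : ∀ t : ℝ, Measurable fun x => ENNReal.ofReal (bdist Ω x ^ t) :=
    fun t => (hcont.measurable.pow_const t).ennreal_ofReal
  set e := s * (a + n) - (d + m) with he
  refine ⟨ENNReal.ofReal ((C + R) ^ a * C ^ n * R ^ e) * ω, by finiteness, fun F hF => ?_⟩
  have hS : MeasurableSet {z : Evec n × Evec n | dist z.1 z.2 ≤ C * bdist Ω z.2 ^ s} :=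
    measurableSet_le (by fun_prop)
      (((hcont.comp continuous_snd).measurable.pow_const s).const_mul C)
  have hswap := lintegral_mul_setLIntegral_swap (μ := volume.restrict Ω)
    (ν := volume.restrict Ω) (hmeas a) (hF.mul (hmeas (-m))) hS
  have hpot : ∀ x, conePotential Ω F m s C x =
      ∫⁻ y in {y | (x, y) ∈ {z : Evec n × Evec n | dist z.1 z.2 ≤ C * bdist Ω z.2 ^ s}},
        F y * ENNReal.ofReal (bdist Ω y ^ (-m)) ∂volume.restrict Ω := by
    intro x
    rw [Measure.restrict_restrict (show MeasurableSet {y | (x, y) ∈ _} from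
      measurable_prodMk_left hS), inter_comm]
    rfl
  simp only [hpot]
  refine hswap.le.trans ?_
  rw [← lintegral_const_mul' _ _ (by finiteness)]
  refine setLIntegral_mono' hΩ.1.measurableSet fun y hy => ?_
  have hρ := bdist_pos hΩ hu hy
  have hinner : ∫⁻ x in {x | dist x y ≤ C * bdist Ω y ^ s}, ENNReal.ofReal (bdist Ω x ^ a)
      ∂volume.restrict Ω ≤ ENNReal.ofReal (((C + R) * bdist Ω y ^ s) ^ a *
        (C * bdist Ω y ^ s) ^ n) * ω := by
    have hcb : {x | dist x y ≤ C * bdist Ω y ^ s} = Metric.closedBall y (C * bdist Ω y ^ s) := rfl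
    calc _ ≤ ∫⁻ x in Metric.closedBall y (C * bdist Ω y ^ s), ENNReal.ofReal (bdist Ω x ^ a) := by
          rw [hcb]
          exact lintegral_mono' (Measure.restrict_mono_measure Measure.restrict_le_self _) le_rfl
      _ ≤ ∫⁻ x in Metric.closedBall y (C * bdist Ω y ^ s),
            ENNReal.ofReal (((C + R) * bdist Ω y ^ s) ^ a) := by
          refine setLIntegral_mono' measurableSet_closedBall fun x hx =>
            ENNReal.ofReal_le_ofReal (Real.rpow_le_rpow (bdist_nonneg _ _) ?_ ha)
          have h1 := bdist_le_add_dist Ω x y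
          have h2 : dist x y ≤ C * bdist Ω y ^ s := hx
          have h3 := le_mul_rpow_of_le hρ (hR y hy) hR1 hs0.le hs1
          linarith
      _ = _ := by
          rw [setLIntegral_const, Measure.addHaar_closedBall _ _ (by positivity),
            finrank_euclideanSpace_fin, ENNReal.ofReal_mul (by positivity), mul_assoc]
  have hreal : bdist Ω y ^ (-m) * (((C + R) * bdist Ω y ^ s) ^ a * (C * bdist Ω y ^ s) ^ n) ≤
      (C + R) ^ a * C ^ n * R ^ e * bdist Ω y ^ d := by
    have h1 : bdist Ω y ^ (-m) * (((C + R) * bdist Ω y ^ s) ^ a * (C * bdist Ω y ^ s) ^ n) =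
        (C + R) ^ a * C ^ n * (bdist Ω y ^ e * bdist Ω y ^ d) := by
      have h2 : bdist Ω y ^ e * bdist Ω y ^ d =
          bdist Ω y ^ (-m) * ((bdist Ω y ^ s) ^ a * (bdist Ω y ^ s) ^ n) := by
        rw [← Real.rpow_natCast (bdist Ω y ^ s), ← Real.rpow_mul hρ.le, ← Real.rpow_mul hρ.le,
          ← Real.rpow_add hρ, ← Real.rpow_add hρ, ← Real.rpow_add hρ, he]
        congr 1
        ring
      rw [h2, Real.mul_rpow (by positivity) (by positivity), mul_pow]
      ring
    rw [h1, mul_assoc _ (R ^ e)]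
    gcongr
    exact hR y hy
  calc F y * ENNReal.ofReal (bdist Ω y ^ (-m)) *
        ∫⁻ x in {x | dist x y ≤ C * bdist Ω y ^ s}, ENNReal.ofReal (bdist Ω x ^ a)
          ∂volume.restrict Ω
      ≤ F y * ENNReal.ofReal (bdist Ω y ^ (-m)) * (ENNReal.ofReal (((C + R) * bdist Ω y ^ s) ^ a *
        (C * bdist Ω y ^ s) ^ n) * ω) := mul_le_mul' le_rfl hinner
    _ = F y * ω * ENNReal.ofReal (bdist Ω y ^ (-m) * (((C + R) * bdist Ω y ^ s) ^ a *
        (C * bdist Ω y ^ s) ^ n)) := by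
        rw [ENNReal.ofReal_mul (p := bdist Ω y ^ (-m)) (by positivity)]
        ring
    _ ≤ F y * ω * ENNReal.ofReal ((C + R) ^ a * C ^ n * R ^ e * bdist Ω y ^ d) := by
        gcongr
    _ = _ := by
        rw [ENNReal.ofReal_mul (by positivity)]
        ring

end assembly

theorem wIp_eq_of_nonneg {n : ℕ} (Ω S : Set (Evec n)) {p : ℝ} (hp : 0 ≤ p) (a : ℝ)
    {g : Evec n → ℝ} (hg : ∀ x, 0 ≤ g x) :
    wIp Ω S p a g = ∫⁻ x in S, ENNReal.ofReal (g x) ^ p * ENNReal.ofReal (bdist Ω x ^ a) := by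
  refine lintegral_congr fun x => ?_
  rw [abs_of_nonneg (hg x), ENNReal.ofReal_mul (Real.rpow_nonneg (hg x) p),
    ENNReal.ofReal_rpow_of_nonneg (hg x) hp]

theorem wIp_DvLen_le {n : ℕ} (Ω : Set (Evec n)) {p : ℝ} (hp : 0 ≤ p) (a : ℝ)
    (v : Evec n → Evec n) :
    wIp Ω Ω p a (DvLen v) ≤ ENNReal.ofReal (n * n) ^ p *
      ∫⁻ x in Ω, ENNReal.ofReal ‖fderiv ℝ v x‖ ^ p * ENNReal.ofReal (bdist Ω x ^ a) := by
  rw [wIp_eq_of_nonneg Ω Ω hp a (DvLen_nonneg v), ← lintegral_const_mul' _ _ (by finiteness)]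
  refine lintegral_mono fun x => ?_
  rw [← mul_assoc, ← ENNReal.mul_rpow_of_nonneg _ _ hp, ← ENNReal.ofReal_mul (by positivity)]
  gcongr
  exact DvLen_le_norm_fderiv v x

section assembly

variable {n : ℕ} {Ω : Set (Evec n)} (hΩ : IsBoundedDomain Ω) (hu : Ω ≠ univ)
include hΩ hu

theorem setLIntegral_rpow_bdist_ne_top {a : ℝ} (ha : 0 ≤ a) :
    ∫⁻ x in Ω, ENNReal.ofReal (bdist Ω x ^ a) ≠ ⊤ := by
  obtain ⟨R, -, hR⟩ := exists_bdist_le hΩ hu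
  refine ne_top_of_le_ne_top (b := ENNReal.ofReal (R ^ a) * volume Ω)
    (ENNReal.mul_ne_top ENNReal.ofReal_ne_top hΩ.2.2.measure_lt_top.ne) ?_
  rw [← setLIntegral_const]
  exact setLIntegral_mono' hΩ.1.measurableSet fun x hx =>
    ENNReal.ofReal_le_ofReal (Real.rpow_le_rpow (bdist_nonneg _ _) (hR x hx) ha)

theorem setLIntegral_ball_le_wIp {p a : ℝ} (hp : 0 ≤ p) (ha : 0 ≤ a) {z : Evec n} (hz : z ∈ Ω)
    (v : Evec n → Evec n) :
    ∫⁻ y in Metric.ball z (bdist Ω z / 4), ENNReal.ofReal ‖v y‖ ^ p ≤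
      ENNReal.ofReal (((bdist Ω z / 2) ^ a)⁻¹) * wIp Ω Ω p a (fun x => ‖v x‖) := by
  have hρ := bdist_pos hΩ hu hz
  have hsub : Metric.ball z (bdist Ω z / 4) ⊆ Ω :=
    (Metric.ball_subset_ball (by linarith)).trans (ball_bdist_subset hΩ hz)
  rw [wIp_eq_of_nonneg Ω Ω hp a fun x => norm_nonneg (v x),
    ← lintegral_const_mul' _ _ ENNReal.ofReal_ne_top]
  refine le_trans ?_ (lintegral_mono_set hsub)
  refine setLIntegral_mono' measurableSet_ball fun y hy => ?_
  rw [Metric.mem_ball'] at hy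
  have h1 := bdist_le_add_dist Ω z y
  have h2 : 1 ≤ ((bdist Ω z / 2) ^ a)⁻¹ * bdist Ω y ^ a := by
    rw [inv_mul_eq_div, one_le_div (by positivity)]
    exact Real.rpow_le_rpow (by positivity) (by linarith) ha
  calc ENNReal.ofReal ‖v y‖ ^ p = 1 * ENNReal.ofReal ‖v y‖ ^ p := (one_mul _).symm
    _ ≤ ENNReal.ofReal (((bdist Ω z / 2) ^ a)⁻¹ * bdist Ω y ^ a) * ENNReal.ofReal ‖v y‖ ^ p := by
        gcongr
        exact ENNReal.one_le_ofReal.2 h2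
    _ = _ := by
        rw [ENNReal.ofReal_mul (by positivity)]
        ring

theorem exists_wIp_DvLen_le {β p a b : ℝ} (hβ0 : 0 < β) (hβ : β ≤ 1) (hqh : QHBC Ω β)
    (hp : 1 < p) (ha : 0 ≤ a) (hcond : (n : ℝ) + b - p < (a + n) * (2 * β / (1 + β))) :
    ∃ C : ℝ≥0∞, C ≠ ⊤ ∧ ∀ v : Evec n → Evec n, DifferentiableOn ℝ v Ω →
      wIp Ω Ω p a (DvLen v) ≤
        C * (wIp Ω Ω p (b - p) (epsLen v) + wIp Ω Ω p a (fun x => ‖v x‖)) := by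
  have hp0 : 0 ≤ p := by linarith
  obtain ⟨s, σ, C, hs0, hs1, -, hC, hc, x₀, hx₀, M, hM, hpt⟩ :=
    exists_setLIntegral_fderiv_le hΩ hu hβ0 hβ hqh hp hcond
  obtain ⟨M₁, hM₁, havg⟩ := exists_setLIntegral_mul_le_average hΩ hu a ha
  obtain ⟨M₂, hM₂, hpot⟩ := exists_setLIntegral_conePotential_le (m := n + σ * p) (d := b - p)
    hΩ hu ha hs0 hs1 hC (by linarith)
  set I := ∫⁻ x in Ω, ENNReal.ofReal (bdist Ω x ^ a) with hI
  have hIt : I ≠ ⊤ := setLIntegral_rpow_bdist_ne_top hΩ hu ha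
  set c₀ := ENNReal.ofReal (((bdist Ω x₀ / 2) ^ a)⁻¹) with hc₀
  have hc₀t : c₀ ≠ ⊤ := ENNReal.ofReal_ne_top
  refine ⟨ENNReal.ofReal (n * n) ^ p * (M₁ * (M * (M₂ + I * c₀))), by finiteness,
    fun v hv => ?_⟩
  set E := wIp Ω Ω p (b - p) (epsLen v) with hE
  set W := wIp Ω Ω p a (fun x => ‖v x‖) with hW
  set V := ∫⁻ y in Metric.ball x₀ (bdist Ω x₀ / 4), ENNReal.ofReal ‖v y‖ ^ p with hV
  set P := conePotential Ω (fun y => ENNReal.ofReal (epsLen v y) ^ p) (n + σ * p) s C with hP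
  have hVW : V ≤ c₀ * W := setLIntegral_ball_le_wIp hΩ hu hp0 ha hx₀ v
  have hPE : ∫⁻ x in Ω, ENNReal.ofReal (bdist Ω x ^ a) * P x ≤ M₂ * E := by
    rw [hE, wIp_eq_of_nonneg Ω Ω hp0 _ (epsLen_nonneg v)]
    exact hpot _ ((measurable_epsLen v).ennreal_ofReal.pow_const _)
  have hmeas : Measurable fun x => ENNReal.ofReal (bdist Ω x ^ a) :=
    ((continuous_bdist Ω).measurable.pow_const _).ennreal_ofReal
  have hint : ∫⁻ x in Ω, ENNReal.ofReal (bdist Ω x ^ a * (bdist Ω x ^ n)⁻¹) *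
      (∫⁻ y in Metric.ball x (bdist Ω x / 8), ENNReal.ofReal ‖fderiv ℝ v y‖ ^ p) ≤
      M * (M₂ * E + I * (c₀ * W)) := by
    calc _ ≤ ∫⁻ x in Ω, M * (ENNReal.ofReal (bdist Ω x ^ a) * P x +
          ENNReal.ofReal (bdist Ω x ^ a) * V) := by
          refine setLIntegral_mono' hΩ.1.measurableSet fun x hx => ?_
          have hρ := bdist_pos hΩ hu hx
          refine (mul_le_mul' le_rfl (hpt v hv x hx)).trans_eq ?_
          have h1 : ENNReal.ofReal (bdist Ω x ^ a * (bdist Ω x ^ n)⁻¹) *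
              ENNReal.ofReal (bdist Ω x ^ n) = ENNReal.ofReal (bdist Ω x ^ a) := by
            rw [← ENNReal.ofReal_mul (by positivity), inv_mul_cancel_right₀ (by positivity)]
          rw [← mul_add, ← h1]
          ring
      _ = M * ((∫⁻ x in Ω, ENNReal.ofReal (bdist Ω x ^ a) * P x) + I * V) := by
          rw [lintegral_const_mul' _ _ hM, lintegral_add_right _ (hmeas.mul_const _),
            lintegral_mul_const _ hmeas]
      _ ≤ _ := by gcongr
  refine (wIp_DvLen_le Ω hp0 a v).trans ?_
  rw [mul_assoc]
  refine mul_le_mul' le_rfl ?_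
  refine (havg _ (((measurable_fderiv ℝ v).norm).ennreal_ofReal.pow_const p)).trans ?_
  rw [mul_assoc]
  refine mul_le_mul' le_rfl (hint.trans ?_)
  rw [mul_assoc]
  refine mul_le_mul' le_rfl ?_
  calc M₂ * E + I * (c₀ * W) = M₂ * E + I * c₀ * W := by rw [mul_assoc I]
    _ ≤ (M₂ + I * c₀) * E + (M₂ + I * c₀) * W := by
        gcongr
        · exact le_self_add
        · exact le_add_self
    _ = (M₂ + I * c₀) * (E + W) := (mul_add _ _ _).symm

end assembly

/-- **Theorem 3.4 (positive part).** Let `Ω ⊊ ℝⁿ`, `n ≥ 2`, be a bounded proper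
subdomain satisfying a `β`-quasihyperbolic boundary condition, `0 < β ≤ 1`, `p > 1`,
`a ≥ 0`, with `(a+n)(2β/(1+β)) > n + b − p`. Then the weighted Korn inequality
`∫_Ω |Dv|^p ρ^a ≤ C { ∫_Ω |ε(v)|^p ρ^{b−p} + ∫_Ω |v|^p ρ^a }` holds for every
`v ∈ W^{1,p}(Ω,ρ^a)ⁿ`. -/
theorem qhbc_korn {n : ℕ} (hn : 2 ≤ n) (Ω : Set (Evec n)) (β p a b : ℝ)
    (hΩ : IsBoundedDomain Ω) (hΩp : Ω ≠ univ)
    (hβ0 : 0 < β) (hβ : β ≤ 1) (hqh : QHBC Ω β)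
    (hp : 1 < p) (ha : 0 ≤ a)
    (hcond : (n : ℝ) + b - p < (a + n) * (2 * β / (1 + β))) :
    ∃ C > 0, ∀ v : Evec n → Evec n, MemW1Vec Ω p a a v →
      wIp Ω Ω p a (DvLen v) ≤
        ENNReal.ofReal C * (wIp Ω Ω p (b - p) (epsLen v) + wIp Ω Ω p a (fun x => ‖v x‖)) := by
  obtain ⟨C, hC, H⟩ := exists_wIp_DvLen_le hΩ hΩp hβ0 hβ hqh hp ha hcond
  refine ⟨C.toReal + 1, by positivity, fun v hv => (H v hv.1).trans ?_⟩
  gcongr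
  rw [← ENNReal.ofReal_toReal hC]
  exact ENNReal.ofReal_le_ofReal (by simp)
end
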